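/- For every integer N ≥ 1, every exponent p with 1 < p < 1 + 4/N, and every E₀ ∈ ℝ, there exists a constant C > 0 such that every u ∈ H¹(ℝ^N; ℂ) satisfying ‖u‖_{L²} = ‖Q‖_{L²} and E⁻(u) ≤ E₀ obeys ‖u‖_{H¹} ≤ C. (This is the uniform a priori H¹ bound at critical mass underlying the statement that every critical-mass solution of the NLS with defocusing subcritical perturbation is global and bounded in H¹.) -/

import Mathlib

open MeasureTheory Filter Complex

noncomputable section

/-- The Laplacian `Δf = ∑ᵢ ∂ᵢ²f` on `ℝ^N`. -/
def lapl {N : ℕ} {F : Type*} [NormedAddCommGroup F] [NormedSpace ℝ F]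
    (f : EuclideanSpace ℝ (Fin N) → F) (x : EuclideanSpace ℝ (Fin N)) : F :=
  ∑ i : Fin N, fderiv ℝ (fun y => fderiv ℝ f y (EuclideanSpace.single i (1:ℝ))) x
    (EuclideanSpace.single i (1:ℝ))

/-- `|∇f(x)|² = ∑ᵢ |∂ᵢf(x)|²`. -/
def gradSq {N : ℕ} {F : Type*} [NormedAddCommGroup F] [NormedSpace ℝ F]
    (f : EuclideanSpace ℝ (Fin N) → F) (x : EuclideanSpace ℝ (Fin N)) : ℝ :=
  ∑ i : Fin N, ‖fderiv ℝ f x (EuclideanSpace.single i (1:ℝ))‖ ^ 2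

/-- `Q` is the ground state: a smooth, positive, radial solution of
`ΔQ − Q + Q^{1+4/N} = 0` with exponential decay. -/
def IsGroundState (N : ℕ) (Q : EuclideanSpace ℝ (Fin N) → ℝ) : Prop :=
  ContDiff ℝ (⊤ : ℕ∞) Q ∧ (∀ x, 0 < Q x) ∧ (∀ x y, ‖x‖ = ‖y‖ → Q x = Q y) ∧
  (∀ x, lapl Q x - Q x + Q x ^ ((1:ℝ) + 4 / N) = 0) ∧
  ∃ C c : ℝ, 0 < C ∧ 0 < c ∧ ∀ x, Q x ≤ C * Real.exp (-c * ‖x‖)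

namespace CM
open Set Topology

structure Sol (n : ℝ) (u u1 : ℝ → ℝ) (u0 : ℝ) : Prop where
  pos : ∀ r, 0 < r → 0 < u r
  d0 : ∀ r, 0 < r → HasDerivAt u (u1 r) r
  d1 : ∀ r, 0 < r → HasDerivAt u1 (-(n-1)/r*u1 r + u r - u r^(1+4/n)) r
  lim0 : Tendsto u (𝓝[>] 0) (𝓝 u0)
  u0pos : 0 < u0
  small : ∃ C, ∀ r, 0 < r → r ≤ 1 → |u1 r| ≤ C*r
  decay : ∃ C, ∀ r, 1 ≤ r → u r ≤ C * r^(-n/2)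

lemma low_bound {n : ℝ} (hn : 1 ≤ n) {u u1 : ℝ → ℝ}
    (nn : ∀ r, 0 < r → 0 ≤ u r)
    (d0 : ∀ r, 0 < r → HasDerivAt u (u1 r) r)
    (d1 : ∀ r, 0 < r → HasDerivAt u1 (-(n-1)/r*u1 r + u r - u r^(1+4/n)) r)
    {δ : ℝ} (hδ : 0 < δ) : ∀ r, δ ≤ r → 0 ≤ u1 r + ((n-1)/δ+1) * u r := by
  intro r0 hr0
  by_contra hneg
  push Not at hneg
  set K := (n-1)/δ+1 with hK
  have hK1 : 1 ≤ K := by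
    have : 0 ≤ (n-1)/δ := div_nonneg (by linarith) hδ.le
    linarith
  set η := u1 r0 + K * u r0 with hη
  have hder : ∀ s, 0 < s → HasDerivAt (fun s => u1 s + K * u s)
      (-(n-1)/s*u1 s + u s - u s^(1+4/n) + K * u1 s) s := fun s hs =>
    (d1 s hs).add ((d0 s hs).const_mul K)
  have key : ∀ s, r0 ≤ s → u1 s + K * u s ≤ η := by
    intro s hs
    have := image_le_of_deriv_right_lt_deriv_boundary' (f := fun s => u1 s + K * u s)
      (f' := fun s => -(n-1)/s*u1 s + u s - u s^(1+4/n) + K * u1 s) (a := r0) (b := s)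
      (fun x hx => (hder x (by linarith [hx.1])).continuousAt.continuousWithinAt)
      (fun x hx => (hder x (by linarith [hx.1])).hasDerivWithinAt) (B := fun _ => η) (B' := fun _ => 0)
      (le_of_eq hη.symm) continuousOn_const (fun x _ => hasDerivWithinAt_const _ _ _)
      (by
        intro x hx hxe
        have hx0 : 0 < x := by linarith [hx.1]
        have hxu := nn x hx0
        have h1 : u1 x < - K * u x := by
          have : u1 x + K * u x < 0 := by rw [hxe]; exact hneg
          linarith
        have h2 : (n-1)/x ≤ (n-1)/δ := by
          apply div_le_div_of_nonneg_left (by linarith) hδ; linarith [hx.1]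
        have h3 : 0 ≤ u x ^ (1+4/n) := Real.rpow_nonneg hxu _
        have h4 : u1 x < 0 := by nlinarith
        have h5 : (K - (n-1)/x) * u1 x ≤ u1 x := by nlinarith
        have h6 : -(n-1)/x*u1 x = - ((n-1)/x) * u1 x := by ring
        nlinarith)
    exact this (right_mem_Icc.2 hs)
  have hu1 : ∀ s, r0 ≤ s → u1 s ≤ η := fun s hs => by
    have := key s hs
    have := nn s (by linarith)
    nlinarith
  set s := r0 + (u r0 + 1) / (-η) with hs
  have hη0 : 0 < -η := by linarith
  have hur0 := nn r0 (by linarith)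
  have hs0 : r0 ≤ s := by
    have : 0 ≤ (u r0 + 1) / (-η) := by positivity
    linarith
  have h := image_le_of_deriv_right_le_deriv_boundary (f := u) (f' := u1) (a := r0) (b := s)
      (fun x hx => (d0 x (by linarith [hx.1])).continuousAt.continuousWithinAt)
      (fun x hx => (d0 x (by linarith [hx.1])).hasDerivWithinAt) (B := fun x => u r0 + η * (x - r0))
      (B' := fun _ => η) (by simp) (by fun_prop)
      (fun x _ => by
        have : HasDerivAt (fun x => u r0 + η * (x - r0)) (η * 1) x :=
          (((hasDerivAt_id x).sub_const r0).const_mul η).const_add _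
        simpa using this.hasDerivWithinAt)
      (fun x hx => hu1 x hx.1) (right_mem_Icc.2 hs0)
  have h2 : η * (s - r0) = - (u r0 + 1) := by
    have hηne : η ≠ 0 := by linarith
    rw [hs]; field_simp; ring
  have := nn s (by linarith)
  linarith

lemma decay_zero {n : ℝ} (hn : 1 ≤ n) {u : ℝ → ℝ} (pos : ∀ r, 0 < r → 0 < u r)
    (decay : ∃ C, ∀ r, 1 ≤ r → u r ≤ C * r^(-n/2)) : Tendsto u atTop (𝓝 0) := by
  obtain ⟨C, hC⟩ := decay
  have h1 : Tendsto (fun r : ℝ => C * r^(-n/2)) atTop (𝓝 0) := by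
    have := (tendsto_rpow_neg_atTop (y := n/2) (by linarith)).const_mul C
    simpa [neg_div] using this
  refine tendsto_of_tendsto_of_tendsto_of_le_of_le' tendsto_const_nhds h1 ?_ ?_
  · filter_upwards [eventually_gt_atTop 0] with r hr using (pos r hr).le
  · filter_upwards [eventually_ge_atTop 1] with r hr using hC r hr

lemma grad_bound {n : ℝ} (hn : 1 ≤ n) {u u1 : ℝ → ℝ} {u0 : ℝ} (S : Sol n u u1 u0) :
    ∃ K R, 0 ≤ K ∧ 1 ≤ R ∧ ∀ r, R ≤ r → |u1 r| ≤ K * u r := by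
  have hz := decay_zero hn S.pos S.decay
  obtain ⟨R, hR⟩ := eventually_atTop.1 ((hz.eventually (gt_mem_nhds one_pos)).and (eventually_ge_atTop 1))
  refine ⟨(n-1)/1+1, max R 1, by simpa using (by linarith : 0 ≤ n), le_max_right _ _, fun r hr => ?_⟩
  have hr1 : 1 ≤ r := le_trans (le_max_right _ _) hr
  have hrR : R ≤ r := le_trans (le_max_left _ _) hr
  have hlow := low_bound hn (fun r hr => (S.pos r hr).le) S.d0 S.d1 one_pos r hr1
  have hup : u1 r ≤ 0 := by
    by_contra hpos
    push Not at hpos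
    have hd : ∀ x, 0 < x → HasDerivAt (fun x => x^(n-1) * u1 x) (x^(n-1) * (u x - u x^(1+4/n))) x := by
      intro x hx
      have h1 := (Real.hasDerivAt_rpow_const (p := n-1) (Or.inl hx.ne')).mul (S.d1 x hx)
      refine h1.congr_deriv ?_
      rw [Real.rpow_sub_one hx.ne' (n-1)]
      field_simp
      ring
    have hm : MonotoneOn (fun x => x^(n-1) * u1 x) (Ici r) := by
      apply monotoneOn_of_deriv_nonneg (convex_Ici r)
      · exact fun x hx => (hd x (by linarith [mem_Ici.1 hx])).continuousAt.continuousWithinAt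
      · intro x hx
        rw [interior_Ici, mem_Ioi] at hx
        exact (hd x (by linarith)).differentiableAt.differentiableWithinAt
      · intro x hx
        rw [interior_Ici, mem_Ioi] at hx
        have hx0 : 0 < x := by linarith
        rw [(hd x hx0).deriv]
        have hux := S.pos x hx0
        have hu1 : u x < 1 := (hR x (by linarith)).1
        have : u x^(1+4/n) ≤ u x^(1:ℝ) :=
          Real.rpow_le_rpow_of_exponent_ge hux hu1.le (by have : 0 < 4/n := by positivity
                                                          linarith)
        rw [Real.rpow_one] at this
        have := Real.rpow_nonneg hx0.le (n-1)
        apply mul_nonneg this; linarith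
    have hmu : MonotoneOn u (Ici r) := by
      apply monotoneOn_of_deriv_nonneg (convex_Ici r)
      · exact fun x hx => (S.d0 x (by linarith [mem_Ici.1 hx])).continuousAt.continuousWithinAt
      · intro x hx
        rw [interior_Ici, mem_Ioi] at hx
        exact (S.d0 x (by linarith)).differentiableAt.differentiableWithinAt
      · intro x hx
        rw [interior_Ici, mem_Ioi] at hx
        have hx0 : 0 < x := by linarith
        rw [(S.d0 x hx0).deriv]
        have h1 := hm (mem_Ici.2 le_rfl) (mem_Ici.2 hx.le) hx.le
        have h2 : 0 < r^(n-1) * u1 r := mul_pos (Real.rpow_pos_of_pos (by linarith) _) hpos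
        have h3 : 0 < x^(n-1) * u1 x := lt_of_lt_of_le h2 h1
        exact (pos_of_mul_pos_right h3 (Real.rpow_nonneg hx0.le _)).le
    have : u r ≤ 0 := by
      apply ge_of_tendsto hz
      filter_upwards [eventually_ge_atTop r] with x hx
      exact hmu (mem_Ici.2 le_rfl) (mem_Ici.2 hx) hx
    linarith [S.pos r (by linarith)]
  rw [abs_of_nonpos hup]; linarith

/-- Pohozaev-type function -/
def Jf (n : ℝ) (u u1 : ℝ → ℝ) (r : ℝ) : ℝ :=
  r^(n - 2/(n+1)) * (u1 r^2/2 - u r^2/2 + u r^(2+4/n)/(2+4/n)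
    + n*(n-1)/(2*(n+1)) * (u r * u1 r) / r + n*(n-1)/(n+1)^2/2 * u r^2 / r^2)

def Gf (n : ℝ) (r : ℝ) : ℝ :=
  n*(n-1)/(2*(n+1)) * r^(n - 2/(n+1)) / r^3 * (-(2/n) * r^2 + (n-2-2/(n+1))/(n+1))

lemma Jf_deriv {n : ℝ} (hn : 1 ≤ n) {u u1 : ℝ → ℝ} {u0 : ℝ} (S : Sol n u u1 u0) {r : ℝ} (hr : 0 < r) :
    HasDerivAt (Jf n u u1) (Gf n r * u r^2) r := by
  have hu := S.pos r hr
  have hA := Real.hasDerivAt_rpow_const (p := n - 2/(n+1)) (x := r) (Or.inl hr.ne')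
  have hU := S.d0 r hr
  have hV := S.d1 r hr
  have hP : HasDerivAt (fun r => u r^(2+4/n)) (u1 r * (2+4/n) * u r^(2+4/n-1)) r :=
    hU.rpow_const (Or.inl hu.ne')
  have hid := hasDerivAt_id r
  have h := hA.mul ((((((hV.pow 2).div_const 2).sub ((hU.pow 2).div_const 2)).add
    (hP.div_const (2+4/n))).add ((((hU.mul hV).const_mul (n*(n-1)/(2*(n+1)))).div hid hr.ne'))).add
    (((hU.pow 2).const_mul (n*(n-1)/(n+1)^2/2)).div (hid.pow 2) (pow_ne_zero 2 hr.ne')))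
  refine h.congr_deriv ?_
  simp only [Pi.add_apply, Pi.sub_apply, Pi.mul_apply, Pi.div_apply, Pi.pow_apply, id, Gf]
  have e1 : u r^(2+4/n-1) = u r^(1+4/n) := by congr 1; ring
  have e2 : u r^(2+4/n) = u r^(1+4/n) * u r := by
    rw [← Real.rpow_add_one hu.ne']; congr 1; ring
  rw [e1, e2, Real.rpow_sub_one hr.ne']
  generalize u r^(1+4/n) = y
  generalize r^(n - 2/(n+1)) = a
  have hn1 : n + 1 ≠ 0 := by linarith
  have hn0 : n ≠ 0 := by linarith
  have hn4 : 2 + 4/n ≠ 0 := by have : 0 < 4/n := by positivity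
                               linarith
  have hn5 : n*2 + 4 ≠ 0 := by linarith
  have hn6 : n + 2 ≠ 0 := by linarith
  field_simp
  ring
end CM

namespace CM
open Set Topology Asymptotics

lemma tendsto_rpow_zero_right {a : ℝ} (ha : 0 < a) : Tendsto (fun r : ℝ => r^a) (𝓝[>] 0) (𝓝 0) := by
  have h := (Real.continuousAt_rpow_const 0 a (Or.inr ha.le)).tendsto
  rw [Real.zero_rpow ha.ne'] at h
  exact h.mono_left nhdsWithin_le_nhds

lemma ru2_lim {n : ℝ} (hn : 1 ≤ n) {u : ℝ → ℝ} (pos : ∀ r, 0 < r → 0 < u r)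
    (decay : ∃ C, ∀ r, 1 ≤ r → u r ≤ C * r^(-n/2)) :
    Tendsto (fun r => r^(n - 2/(n+1)) * u r^2) atTop (𝓝 0) := by
  obtain ⟨C, hC⟩ := decay
  have h1 : Tendsto (fun r : ℝ => C^2 * r^(-(2/(n+1)))) atTop (𝓝 0) := by
    have := (tendsto_rpow_neg_atTop (y := 2/(n+1)) (by positivity)).const_mul (C^2)
    simpa using this
  refine tendsto_of_tendsto_of_tendsto_of_le_of_le' tendsto_const_nhds h1 ?_ ?_
  · filter_upwards [eventually_gt_atTop 0] with r hr
    have := Real.rpow_nonneg hr.le (n - 2/(n+1)); positivity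
  · filter_upwards [eventually_ge_atTop 1] with r hr
    have hr0 : 0 < r := by linarith
    have h2 : u r^2 ≤ (C * r^(-n/2))^2 := pow_le_pow_left₀ (pos r hr0).le (hC r hr) 2
    have h3 : (C * r^(-n/2))^2 = C^2 * r^(-n) := by
      rw [mul_pow, ← Real.rpow_natCast (r^(-n/2)) 2, ← Real.rpow_mul hr0.le]; congr 2; push_cast; ring
    calc r^(n - 2/(n+1)) * u r^2 ≤ r^(n - 2/(n+1)) * (C^2 * r^(-n)) := by
          rw [← h3]; exact mul_le_mul_of_nonneg_left h2 (Real.rpow_nonneg hr0.le _)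
      _ = C^2 * (r^(n - 2/(n+1)) * r^(-n)) := by ring
      _ = _ := by rw [← Real.rpow_add hr0]; congr 2; ring

lemma Jf_bound {n : ℝ} (hn : 1 ≤ n) {u u1 : ℝ → ℝ} {u0 : ℝ} (S : Sol n u u1 u0) :
    ∃ C R, 1 ≤ R ∧ ∀ r, R ≤ r → |Jf n u u1 r| ≤ C * (r^(n - 2/(n+1)) * u r^2) := by
  obtain ⟨K, R, hK, hR, h⟩ := grad_bound hn S
  have hz := decay_zero hn S.pos S.decay
  obtain ⟨R', hR'⟩ := eventually_atTop.1 (hz.eventually (gt_mem_nhds one_pos))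
  set b := n*(n-1)/(2*(n+1)) with hb
  set c := n*(n-1)/(n+1)^2/2 with hc
  have hb0 : 0 ≤ b := div_nonneg (mul_nonneg (by linarith) (by linarith)) (by linarith)
  have hc0 : 0 ≤ c := by
    apply div_nonneg (div_nonneg (mul_nonneg (by linarith) (by linarith)) (by positivity)) (by norm_num)
  refine ⟨K^2/2 + 1/2 + 1 + b*K + c, max R R', le_trans hR (le_max_left _ _), fun r hr => ?_⟩
  have hrR : R ≤ r := le_trans (le_max_left _ _) hr
  have hrR' : R' ≤ r := le_trans (le_max_right _ _) hr
  have hr0 : 0 < r := by linarith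
  have hu := S.pos r hr0
  have hu1 := hR' r hrR'
  have hd := h r hrR
  have ha := Real.rpow_nonneg hr0.le (n - 2/(n+1))
  rw [Jf, abs_mul, abs_of_nonneg ha]
  rw [mul_left_comm (K^2/2 + 1/2 + 1 + b*K + c)]
  apply mul_le_mul_of_nonneg_left _ ha
  have e1 : |u1 r^2/2| ≤ K^2/2 * u r^2 := by
    rw [abs_of_nonneg (by positivity)]
    have := pow_le_pow_left₀ (abs_nonneg _) hd 2
    rw [sq_abs] at this; nlinarith
  have e2 : |u r^2/2| ≤ 1/2 * u r^2 := by rw [abs_of_nonneg (by positivity)]; linarith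
  have hn4 : 0 < 4/n := by positivity
  have e3 : |u r^(2+4/n)/(2+4/n)| ≤ 1 * u r^2 := by
    have h0 := Real.rpow_nonneg hu.le (2+4/n)
    rw [abs_of_nonneg (by positivity)]
    have : u r^(2+4/n) ≤ u r^(2:ℝ) :=
      Real.rpow_le_rpow_of_exponent_ge hu hu1.le (by linarith)
    rw [Real.rpow_two] at this
    rw [div_le_iff₀ (by linarith)]
    nlinarith [sq_nonneg (u r)]
  have e4 : |b * (u r * u1 r) / r| ≤ b*K * u r^2 := by
    rw [abs_div, abs_mul, abs_mul, abs_of_nonneg hb0, abs_of_pos hu, abs_of_pos hr0]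
    apply div_le_of_le_mul₀ hr0.le (by positivity)
    have : b * (u r * |u1 r|) ≤ b * (u r * (K * u r)) := by gcongr
    have h2 : 0 ≤ b*K*u r^2 := by positivity
    nlinarith
  have e5 : |c * u r^2 / r^2| ≤ c * u r^2 := by
    rw [abs_of_nonneg (by positivity)]
    apply div_le_of_le_mul₀ (by positivity) (by positivity)
    have h2 : 0 ≤ c*u r^2 := by positivity
    have : 1 ≤ r^2 := by nlinarith
    nlinarith
  rw [abs_le] at *
  constructor <;> linarith [e1.1, e1.2, e2.1, e2.2, e3.1, e3.2, e4.1, e4.2, e5.1, e5.2]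

lemma Jf_top {n : ℝ} (hn : 1 ≤ n) {u u1 : ℝ → ℝ} {u0 : ℝ} (S : Sol n u u1 u0) :
    Tendsto (Jf n u u1) atTop (𝓝 0) := by
  obtain ⟨C, R, hR, h⟩ := Jf_bound hn S
  have h1 := (ru2_lim hn S.pos S.decay).const_mul C
  rw [mul_zero] at h1
  apply squeeze_zero_norm' _ h1
  filter_upwards [eventually_ge_atTop R] with r hr
  exact h r hr

lemma Sol.bigO_u {n : ℝ} {u u1 : ℝ → ℝ} {u0 : ℝ} (S : Sol n u u1 u0) :
    u =O[𝓝[>] 0] (fun _ => (1:ℝ)) := S.lim0.isBigO_one ℝ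

lemma Sol.bigO_u1r {n : ℝ} {u u1 : ℝ → ℝ} {u0 : ℝ} (S : Sol n u u1 u0) :
    (fun r => u1 r / r) =O[𝓝[>] 0] (fun _ => (1:ℝ)) := by
  obtain ⟨C, hC⟩ := S.small
  apply IsBigO.of_bound C
  have : ∀ᶠ r : ℝ in 𝓝[>] 0, r ∈ Ioc 0 1 := Ioc_mem_nhdsGT one_pos
  filter_upwards [this] with r hr
  rw [norm_one, mul_one, Real.norm_eq_abs, abs_div, abs_of_pos hr.1]
  exact div_le_of_le_mul₀ hr.1.le (by
    have h1 := hC 1 one_pos le_rfl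
    have := abs_nonneg (u1 1)
    linarith) (hC r hr.1 hr.2)

lemma O1mul {F G : ℝ → ℝ} (hF : F =O[𝓝[>] 0] (fun _ => (1:ℝ))) (hG : G =O[𝓝[>] 0] (fun _ => (1:ℝ))) :
    (fun r => F r * G r) =O[𝓝[>] 0] (fun _ => (1:ℝ)) := by
  simpa using hF.mul hG

lemma bigO_id : (fun r : ℝ => r) =O[𝓝[>] 0] (fun _ => (1:ℝ)) :=
  Tendsto.isBigO_one (c := (0:ℝ)) ℝ (tendsto_id.mono_left nhdsWithin_le_nhds)

lemma Sol.bigO_u1 {n : ℝ} {u u1 : ℝ → ℝ} {u0 : ℝ} (S : Sol n u u1 u0) :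
    u1 =O[𝓝[>] 0] (fun _ => (1:ℝ)) := by
  have h := (S.bigO_u1r.mul bigO_id)
  simp only [mul_one] at h
  refine h.congr' ?_ EventuallyEq.rfl
  filter_upwards [self_mem_nhdsWithin] with r hr
  exact div_mul_cancel₀ _ (ne_of_gt hr)

lemma Sol.bigO_uq {n : ℝ} {u u1 : ℝ → ℝ} {u0 : ℝ} (S : Sol n u u1 u0) (q : ℝ) :
    (fun r => u r ^ q) =O[𝓝[>] 0] (fun _ => (1:ℝ)) :=
  (S.lim0.rpow_const (Or.inl S.u0pos.ne')).isBigO_one ℝ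

lemma zero_of_rpow_mul {a : ℝ} (ha : 0 < a) {F : ℝ → ℝ} (hF : F =O[𝓝[>] 0] (fun _ => (1:ℝ))) :
    Tendsto (fun r => r^a * F r) (𝓝[>] 0) (𝓝 0) := by
  have h1 : (fun r : ℝ => r^a) =o[𝓝[>] 0] (fun _ => (1:ℝ)) :=
    (isLittleO_one_iff ℝ).2 (tendsto_rpow_zero_right ha)
  have := h1.mul_isBigO hF
  simp only [mul_one] at this
  exact (isLittleO_one_iff ℝ).1 this

lemma Jf_zero {n : ℝ} (hn : 1 ≤ n) {u u1 : ℝ → ℝ} {u0 : ℝ} (S : Sol n u u1 u0)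
    (hα : 2 < n - 2/(n+1)) : Tendsto (Jf n u u1) (𝓝[>] 0) (𝓝 0) := by
  have hid := bigO_id
  have h2 : (fun r => r * r * (1/2 * (u1 r * u1 r) - 1/2 * (u r * u r) + 1/(2+4/n) * (u r^(2+4/n)))
    + n*(n-1)/(2*(n+1)) * (u r * u1 r * r) + n*(n-1)/(n+1)^2/2 * (u r * u r)) =O[𝓝[>] 0] (fun _ => (1:ℝ)) := by
    have hu := S.bigO_u
    have hu1 := S.bigO_u1
    have hq := S.bigO_uq (2+4/n)
    exact ((O1mul (O1mul hid hid) ((((O1mul hu1 hu1).const_mul_left (1/2)).sub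
      ((O1mul hu hu).const_mul_left (1/2))).add (hq.const_mul_left (1/(2+4/n))))).add
      ((O1mul (O1mul hu hu1) hid).const_mul_left (n*(n-1)/(2*(n+1))))).add
      ((O1mul hu hu).const_mul_left (n*(n-1)/(n+1)^2/2))
  have := zero_of_rpow_mul (a := n - 2/(n+1) - 2) (by linarith) h2
  refine this.congr' ?_
  filter_upwards [self_mem_nhdsWithin] with r hr
  have hr : 0 < r := hr
  rw [Jf, Real.rpow_sub hr _ 2, Real.rpow_two]
  field_simp

lemma Gf_sign {n : ℝ} (hn : 1 ≤ n) {r : ℝ} (hr : 0 < r)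
    (h : -(2/n) * r^2 + (n-2-2/(n+1))/(n+1) ≤ 0) {s : ℝ} (hs : r ≤ s) : Gf n s ≤ 0 := by
  have : 0 < s := by linarith
  apply mul_nonpos_of_nonneg_of_nonpos
  · have := Real.rpow_nonneg this.le (n - 2/(n+1))
    have h1 : 0 ≤ n*(n-1)/(2*(n+1)) := div_nonneg (mul_nonneg (by linarith) (by linarith)) (by linarith)
    positivity
  · have : 2/n * r^2 ≤ 2/n * s^2 := by gcongr
    linarith

lemma Gf_sign' {n : ℝ} (hn : 1 ≤ n) {r : ℝ} 
    (h : 0 ≤ -(2/n) * r^2 + (n-2-2/(n+1))/(n+1)) {s : ℝ} (hs0 : 0 < s) (hs : s ≤ r) : 0 ≤ Gf n s := by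
  apply mul_nonneg
  · have := Real.rpow_nonneg hs0.le (n - 2/(n+1))
    have h1 : 0 ≤ n*(n-1)/(2*(n+1)) := div_nonneg (mul_nonneg (by linarith) (by linarith)) (by linarith)
    positivity
  · have : 2/n * s^2 ≤ 2/n * r^2 := by gcongr
    linarith

lemma mono_Ioc {F F' : ℝ → ℝ} {b : ℝ} (hd : ∀ r, 0 < r → r ≤ b → HasDerivAt F (F' r) r)
    (h : ∀ r, 0 < r → r ≤ b → 0 ≤ F' r) : MonotoneOn F (Ioc 0 b) := by
  apply monotoneOn_of_deriv_nonneg (convex_Ioc 0 b)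
  · exact fun x hx => (hd x hx.1 hx.2).continuousAt.continuousWithinAt
  · intro x hx
    rw [interior_Ioc] at hx
    exact (hd x hx.1 hx.2.le).differentiableAt.differentiableWithinAt
  · intro x hx
    rw [interior_Ioc] at hx
    rw [(hd x hx.1 hx.2.le).deriv]; exact h x hx.1 hx.2.le

lemma nonneg_of_mono {F F' : ℝ → ℝ} {b l : ℝ} (hb : 0 < b) (hd : ∀ r, 0 < r → r ≤ b → HasDerivAt F (F' r) r)
    (h : ∀ r, 0 < r → r ≤ b → 0 ≤ F' r) (h0 : Tendsto F (𝓝[>] 0) (𝓝 l)) : l ≤ F b := by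
  have hm := mono_Ioc hd h
  apply le_of_tendsto h0
  have : ∀ᶠ r : ℝ in 𝓝[>] 0, r ∈ Ioc 0 b := Ioc_mem_nhdsGT hb
  filter_upwards [this] with r hr
  exact hm hr ⟨hb, le_rfl⟩ hr.2

lemma Jf_nonneg {n : ℝ} (hn : 1 ≤ n) {u u1 : ℝ → ℝ} {u0 : ℝ} (S : Sol n u u1 u0) {r : ℝ} (hr : 0 < r) :
    0 ≤ Jf n u u1 r := by
  rcases le_or_gt (-(2/n) * r^2 + (n-2-2/(n+1))/(n+1)) 0 with h | h
  · have hm : AntitoneOn (Jf n u u1) (Ici r) := by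
      apply antitoneOn_of_deriv_nonpos (convex_Ici r)
      · exact fun x hx => (Jf_deriv hn S (by linarith [mem_Ici.1 hx])).continuousAt.continuousWithinAt
      · intro x hx
        rw [interior_Ici, mem_Ioi] at hx
        exact (Jf_deriv hn S (by linarith)).differentiableAt.differentiableWithinAt
      · intro x hx
        rw [interior_Ici, mem_Ioi] at hx
        rw [(Jf_deriv hn S (by linarith)).deriv]
        exact mul_nonpos_of_nonpos_of_nonneg (Gf_sign hn hr h hx.le) (sq_nonneg _)
    apply le_of_tendsto (Jf_top hn S)
    filter_upwards [eventually_ge_atTop r] with x hx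
    exact hm (mem_Ici.2 le_rfl) (mem_Ici.2 hx) hx
  · have hα : 2 < n - 2/(n+1) := by
      have h1 : 0 ≤ 2/n * r^2 := by positivity
      have h2 : 0 < (n-2-2/(n+1))/(n+1) := by linarith
      have := (div_pos_iff_of_pos_right (by linarith : 0 < n+1)).1 h2
      linarith
    exact nonneg_of_mono hr (fun s hs _ => Jf_deriv hn S hs)
      (fun s hs hsr => mul_nonneg (Gf_sign' hn h.le hs hsr) (sq_nonneg _)) (Jf_zero hn S hα)
end CM

namespace CM
open Set Topology Asymptotics

lemma X_zero {n : ℝ} (hn : 2 ≤ n) {u u1 v v1 : ℝ → ℝ} {u0 v0 : ℝ} (S : Sol n u u1 u0) (T : Sol n v v1 v0) :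
    Tendsto (fun r => (v r / u r)^2 * Jf n u u1 r - Jf n v v1 r) (𝓝[>] 0) (𝓝 0) := by
  have hw : (fun r => v r / u r) =O[𝓝[>] 0] (fun _ => (1:ℝ)) :=
    (T.lim0.div S.lim0 S.u0pos.ne').isBigO_one ℝ
  have hw2 := O1mul hw hw
  have h := (((O1mul hw2 (O1mul S.bigO_u1 S.bigO_u1)).sub (O1mul T.bigO_u1 T.bigO_u1)).const_mul_left (1/2)).add
    ((((O1mul hw2 (S.bigO_uq (2+4/n))).sub (T.bigO_uq (2+4/n))).const_mul_left (1/(2+4/n))).add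
    (((O1mul hw2 (O1mul S.bigO_u S.bigO_u1r)).sub (O1mul T.bigO_u T.bigO_u1r)).const_mul_left (n*(n-1)/(2*(n+1)))))
  have ha : 0 < n - 2/(n+1) := by
    have : 2/(n+1) ≤ 1 := by rw [div_le_one (by linarith)]; linarith
    linarith
  refine (zero_of_rpow_mul ha h).congr' ?_
  filter_upwards [self_mem_nhdsWithin] with r hr
  have hr : 0 < r := hr
  have hu := S.pos r hr
  rw [Jf, Jf]
  field_simp
  ring

lemma X_top {n : ℝ} (hn : 1 ≤ n) {u u1 v v1 : ℝ → ℝ} {u0 v0 : ℝ} (S : Sol n u u1 u0) (T : Sol n v v1 v0) :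
    Tendsto (fun r => (v r / u r)^2 * Jf n u u1 r - Jf n v v1 r) atTop (𝓝 0) := by
  obtain ⟨C, R, hR, h⟩ := Jf_bound hn S
  have h1 := (ru2_lim hn T.pos T.decay).const_mul C
  rw [mul_zero] at h1
  have : Tendsto (fun r => (v r / u r)^2 * Jf n u u1 r) atTop (𝓝 0) := by
    apply squeeze_zero_norm' _ h1
    filter_upwards [eventually_ge_atTop R] with r hr
    have hu := S.pos r (by linarith)
    rw [norm_mul, Real.norm_eq_abs, Real.norm_eq_abs, abs_of_nonneg (by positivity)]
    calc _ ≤ (v r / u r)^2 * (C * (r^(n - 2/(n+1)) * u r^2)) :=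
          mul_le_mul_of_nonneg_left (h r hr) (by positivity)
      _ = _ := by field_simp
  simpa using this.sub (Jf_top hn T)

lemma w_deriv {n : ℝ} {u u1 v v1 : ℝ → ℝ} {u0 v0 : ℝ} (S : Sol n u u1 u0) (T : Sol n v v1 v0)
    {r : ℝ} (hr : 0 < r) : HasDerivAt (fun r => v r / u r) ((v1 r * u r - v r * u1 r) / u r^2) r :=
  (T.d0 r hr).div (S.d0 r hr) (S.pos r hr).ne'

lemma X_deriv {n : ℝ} (hn : 1 ≤ n) {u u1 v v1 : ℝ → ℝ} {u0 v0 : ℝ} (S : Sol n u u1 u0) (T : Sol n v v1 v0)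
    {r : ℝ} (hr : 0 < r) :
    HasDerivAt (fun r => (v r / u r)^2 * Jf n u u1 r - Jf n v v1 r)
      (2 * (v r / u r) * ((v1 r * u r - v r * u1 r) / u r^2) * Jf n u u1 r) r := by
  have h := (((w_deriv S T hr).pow 2).mul (Jf_deriv hn S hr)).sub (Jf_deriv hn T hr)
  refine h.congr_deriv ?_
  have hu := S.pos r hr
  simp only [Pi.pow_apply, Nat.cast_ofNat, Nat.add_one_sub_one, pow_one]
  field_simp
  ring

/-- Wronskian -/
def Wr (n : ℝ) (u u1 v v1 : ℝ → ℝ) (r : ℝ) : ℝ := r^(n-1) * (v1 r * u r - v r * u1 r)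

lemma Wr_deriv {n : ℝ} {u u1 v v1 : ℝ → ℝ} {u0 v0 : ℝ} (S : Sol n u u1 u0) (T : Sol n v v1 v0)
    {r : ℝ} (hr : 0 < r) : HasDerivAt (Wr n u u1 v v1)
      (r^(n-1) * (u r * v r * (u r^(4/n) - v r^(4/n)))) r := by
  have h := (Real.hasDerivAt_rpow_const (p := n-1) (Or.inl hr.ne')).mul
    (((T.d1 r hr).mul (S.d0 r hr)).sub ((T.d0 r hr).mul (S.d1 r hr)))
  refine h.congr_deriv ?_
  simp only [Pi.mul_apply, Pi.sub_apply]
  rw [Real.rpow_sub_one hr.ne' (n-1), Real.rpow_add (S.pos r hr), Real.rpow_add (T.pos r hr), Real.rpow_one,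
    Real.rpow_one]
  field_simp
  ring

lemma Wr_zero {n : ℝ} (hn : 2 ≤ n) {u u1 v v1 : ℝ → ℝ} {u0 v0 : ℝ} (S : Sol n u u1 u0) (T : Sol n v v1 v0) :
    Tendsto (Wr n u u1 v v1) (𝓝[>] 0) (𝓝 0) :=
  zero_of_rpow_mul (by linarith) ((O1mul T.bigO_u1 S.bigO_u).sub (O1mul T.bigO_u S.bigO_u1))

set_option maxHeartbeats 1000000 in
lemma uniq_aux {n : ℝ} (hn : 2 ≤ n) {u u1 v v1 : ℝ → ℝ} {u0 v0 : ℝ} (S : Sol n u u1 u0) (T : Sol n v v1 v0)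
    (hlt : v0 < u0) : False := by
  have hn1 : 1 ≤ n := by linarith
  have hq : 0 < 4/n := by positivity
  -- near zero
  obtain ⟨d, hd0, hd⟩ : ∃ d > 0, ∀ r, 0 < r → r ≤ d → v r < u r := by
    have h1 := (T.lim0.eventually_lt S.lim0 hlt)
    obtain ⟨d, hd, h⟩ := mem_nhdsGT_iff_exists_Ioc_subset.1 h1
    exact ⟨d, hd, fun r h0 h1 => h ⟨h0, h1⟩⟩
  have hWd : ∀ r, 0 < r → v r < u r → 0 < r^(n-1) * (u r * v r * (u r^(4/n) - v r^(4/n))) := by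
    intro r hr h
    have h1 := S.pos r hr
    have h2 := T.pos r hr
    have h3 := Real.rpow_lt_rpow h2.le h hq
    have := Real.rpow_pos_of_pos hr (n-1)
    have h4 : 0 < u r^(4/n) - v r^(4/n) := by linarith
    positivity
  have hW0 : ∀ r, 0 < r → r ≤ d → 0 < Wr n u u1 v v1 r := by
    intro r hr hrd
    have hm : StrictMonoOn (Wr n u u1 v v1) (Ioc 0 r) := by
      apply strictMonoOn_of_deriv_pos (convex_Ioc 0 r)
      · exact fun x hx => (Wr_deriv S T hx.1).continuousAt.continuousWithinAt
      · intro x hx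
        rw [interior_Ioc] at hx
        rw [(Wr_deriv S T hx.1).deriv]
        exact hWd x hx.1 (hd x hx.1 (by linarith [hx.2]))
    have h1 := nonneg_of_mono (half_pos hr) (fun s hs _ => Wr_deriv S T hs)
      (fun s hs hs' => (hWd s hs (hd s hs (by linarith))).le) (Wr_zero hn S T)
    have := hm (⟨half_pos hr, by linarith⟩ : r/2 ∈ Ioc 0 r) ⟨hr, le_rfl⟩ (by linarith)
    linarith
  have sgn : ∀ r, 0 < r → 0 < Wr n u u1 v v1 r → 0 < (v1 r * u r - v r * u1 r) / u r^2 := by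
    intro r hr h
    have := pos_of_mul_pos_right h (Real.rpow_nonneg hr.le _)
    exact div_pos this (pow_pos (S.pos r hr) 2)
  have hW : ∀ r, 0 < r → 0 < Wr n u u1 v v1 r := by
    by_contra hcon
    push Not at hcon
    obtain ⟨R, hR, hWR⟩ := hcon
    have hdR : d ≤ R := by
      by_contra h
      push Not at h
      linarith [hW0 R hR h.le]
    -- first zero
    obtain ⟨r1, hr1, hWr1, hbefore⟩ : ∃ r1, d < r1 ∧ Wr n u u1 v v1 r1 ≤ 0 ∧ ∀ r, 0 < r → r < r1 → 0 < Wr n u u1 v v1 r := by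
      have hcont : ContinuousOn (Wr n u u1 v v1) (Icc d R) :=
        fun x hx => (Wr_deriv S T (by linarith [hx.1])).continuousAt.continuousWithinAt
      have hK : IsCompact (Icc d R ∩ Wr n u u1 v v1 ⁻¹' Iic 0) :=
        (isCompact_Icc).of_isClosed_subset (hcont.preimage_isClosed_of_isClosed isClosed_Icc isClosed_Iic)
          inter_subset_left
      obtain ⟨r1, hr1, hmin⟩ := hK.exists_isLeast ⟨R, ⟨hdR, le_rfl⟩, hWR⟩
      refine ⟨r1, ?_, hr1.2, ?_⟩
      · rcases hr1.1.1.lt_or_eq with h | h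
        · exact h
        · have := hW0 d hd0 le_rfl
          have h2 : Wr n u u1 v v1 r1 ≤ 0 := hr1.2
          rw [← h] at h2; linarith
      · intro r hr hlt
        rcases le_or_gt r d with h | h
        · exact hW0 r hr h
        · by_contra hneg
          push Not at hneg
          have := hmin ⟨⟨h.le, by linarith [hr1.1.2]⟩, hneg⟩
          linarith
    have hr10 : 0 < r1 := by linarith
    have hWr1' : Wr n u u1 v v1 r1 = 0 := by
      apply le_antisymm hWr1
      have hc : Tendsto (Wr n u u1 v v1) (𝓝[<] r1) (𝓝 (Wr n u u1 v v1 r1)) :=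
        (Wr_deriv S T hr10).continuousAt.tendsto.mono_left nhdsWithin_le_nhds
      apply ge_of_tendsto hc
      have : ∀ᶠ r : ℝ in 𝓝[<] r1, r ∈ Ioo 0 r1 := Ioo_mem_nhdsLT hr10
      filter_upwards [this] with r hr using (hbefore r hr.1 hr.2).le
    have hnn : ∀ s, 0 < s → s ≤ r1 → 0 ≤ (v1 s * u s - v s * u1 s) / u s^2 := by
      intro s hs hsr
      rcases hsr.lt_or_eq with h | h
      · exact (sgn s hs (hbefore s hs h)).le
      · subst h
        rw [Wr] at hWr1'
        have := (mul_eq_zero.1 hWr1').resolve_left (Real.rpow_pos_of_pos hs _).ne'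
        rw [this]; simp
    have hwm := mono_Ioc (b := r1) (fun s hs _ => w_deriv S T hs) hnn
    have hu := S.pos r1 hr10
    have hv := T.pos r1 hr10
    have hgt : u r1 < v r1 := by
      by_contra hle
      push Not at hle
      have hle1 : ∀ s, 0 < s → s ≤ r1 → v s ≤ u s := by
        intro s hs hsr
        have h1 := hwm ⟨hs, hsr⟩ ⟨hr10, le_rfl⟩ hsr
        have h2 : v r1 / u r1 ≤ 1 := (div_le_one hu).2 hle
        exact (div_le_one (S.pos s hs)).1 (h1.trans h2)
      have hm := mono_Ioc (b := r1) (fun s hs _ => Wr_deriv S T hs) (by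
        intro s hs hsr
        have h1 := S.pos s hs
        have h2 := T.pos s hs
        have h3 := Real.rpow_le_rpow h2.le (hle1 s hs hsr) hq.le
        have := Real.rpow_pos_of_pos hs (n-1)
        have h4 : 0 ≤ u s^(4/n) - v s^(4/n) := by linarith
        positivity)
      have := hm ⟨hd0, hr1.le⟩ ⟨hr10, le_rfl⟩ hr1.le
      linarith [hW0 d hd0 le_rfl]
    have hX := nonneg_of_mono (F := fun r => (v r/u r)^2*Jf n u u1 r - Jf n v v1 r) hr10 (fun s hs _ => X_deriv hn1 S T hs) (by
      intro s hs hsr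
      have h1 := hnn s hs hsr
      have h2 := Jf_nonneg hn1 S hs
      have h3 := S.pos s hs
      have h4 := T.pos s hs
      positivity) (X_zero hn S T)
    have hcr : v1 r1 * u r1 - v r1 * u1 r1 = 0 := by
      rw [Wr] at hWr1'
      exact (mul_eq_zero.1 hWr1').resolve_left (Real.rpow_pos_of_pos hr10 _).ne'
    have hv1 : v1 r1 = v r1 * u1 r1 / u r1 := by field_simp; linarith
    have hXe : (v r1 / u r1)^2 * Jf n u u1 r1 - Jf n v v1 r1 =
        r1^(n - 2/(n+1)) * (v r1^2 * (u r1^(4/n) - v r1^(4/n)) / (2+4/n)) := by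
      rw [Jf, Jf, hv1, Real.rpow_add hu, Real.rpow_add hv, Real.rpow_two, Real.rpow_two]
      field_simp
      ring
    rw [hXe] at hX
    have h3 := Real.rpow_lt_rpow hu.le hgt hq
    have h4 : v r1^2 * (u r1^(4/n) - v r1^(4/n)) / (2+4/n) < 0 :=
      div_neg_of_neg_of_pos (mul_neg_of_pos_of_neg (by positivity) (by linarith)) (by linarith)
    have := mul_neg_of_pos_of_neg (Real.rpow_pos_of_pos hr10 (n - 2/(n+1))) h4
    linarith
  -- now X is monotone with limits 0 and 0
  have hXnn : ∀ r, 0 < r → 0 ≤ 2 * (v r / u r) * ((v1 r * u r - v r * u1 r) / u r^2) * Jf n u u1 r := by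
    intro s hs
    have h1 := (sgn s hs (hW s hs)).le
    have h2 := Jf_nonneg hn1 S hs
    have h3 := S.pos s hs
    have h4 := T.pos s hs
    positivity
  have hX0 : ∀ r, 0 < r → (v r / u r)^2 * Jf n u u1 r - Jf n v v1 r = 0 := by
    intro r hr
    apply le_antisymm
    · apply ge_of_tendsto (X_top hn1 S T)
      filter_upwards [eventually_ge_atTop r] with x hx
      exact mono_Ioc (F := fun r => (v r/u r)^2*Jf n u u1 r - Jf n v v1 r) (b := x) (fun s hs _ => X_deriv hn1 S T hs) (fun s hs _ => hXnn s hs) ⟨hr, hx⟩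
        ⟨by linarith, le_rfl⟩ hx
    · exact nonneg_of_mono (F := fun r => (v r/u r)^2*Jf n u u1 r - Jf n v v1 r) hr (fun s hs _ => X_deriv hn1 S T hs) (fun s hs _ => hXnn s hs) (X_zero hn S T)
  have hJ0 : ∀ r, 0 < r → Jf n u u1 r = 0 := by
    intro r hr
    have h1 : HasDerivAt (fun r => (v r / u r)^2 * Jf n u u1 r - Jf n v v1 r) 0 r := by
      apply (hasDerivAt_const r (0:ℝ)).congr_of_eventuallyEq
      filter_upwards [lt_mem_nhds hr] with x hx using hX0 x hx
    have h2 := (X_deriv hn1 S T hr).unique h1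
    have h3 := sgn r hr (hW r hr)
    have h4 := S.pos r hr
    have h5 := T.pos r hr
    have h6 : 2 * (v r / u r) * ((v1 r * u r - v r * u1 r) / u r^2) ≠ 0 := by positivity
    exact (mul_eq_zero.1 h2).resolve_left h6
  have hG0 : ∀ r, 0 < r → Gf n r = 0 := by
    intro r hr
    have h1 : HasDerivAt (Jf n u u1) 0 r := by
      apply (hasDerivAt_const r (0:ℝ)).congr_of_eventuallyEq
      filter_upwards [lt_mem_nhds hr] with x hx using hJ0 x hx
    have h2 := (Jf_deriv hn1 S hr).unique h1
    exact (mul_eq_zero.1 h2).resolve_right (pow_pos (S.pos r hr) 2).ne'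
  have hbr : ∀ r, 0 < r → -(2/n) * r^2 + (n-2-2/(n+1))/(n+1) = 0 := by
    intro r hr
    have h := hG0 r hr
    rw [Gf] at h
    refine (mul_eq_zero.1 h).resolve_left ?_
    have := Real.rpow_pos_of_pos hr (n - 2/(n+1))
    have h1 : 0 < n-1 := by linarith
    positivity
  have a1 := hbr 1 one_pos
  have a2 := hbr 2 two_pos
  have : 0 < 2/n := by positivity
  linarith

lemma u0_eq_one {u u1 : ℝ → ℝ} {u0 : ℝ} (S : Sol 1 u u1 u0) : u0^(4:ℝ) = 3 := by
  have hd := fun r (hr : 0 < r) => Jf_deriv le_rfl S hr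
  have hJ : ∀ r, 0 < r → Jf 1 u u1 r = 0 := by
    intro r hr
    have hG : ∀ s, Gf 1 s = 0 := fun s => by simp [Gf]
    apply le_antisymm
    · apply ge_of_tendsto (Jf_top le_rfl S)
      filter_upwards [eventually_ge_atTop r] with x hx
      exact mono_Ioc (b := x) (fun s hs _ => hd s hs) (fun s hs _ => by simp [hG]) ⟨hr, hx⟩
        ⟨by linarith, le_rfl⟩ hx
    · exact Jf_nonneg le_rfl S hr
  have hu1 : Tendsto u1 (𝓝[>] 0) (𝓝 0) := by
    have := zero_of_rpow_mul one_pos S.bigO_u1r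
    refine this.congr' ?_
    filter_upwards [self_mem_nhdsWithin] with r hr
    have hr : 0 < r := hr
    rw [Real.rpow_one]; field_simp
  have h1 : Tendsto (fun r => u1 r^2/2 - u r^2/2 + u r^(6:ℝ)/6) (𝓝[>] 0) (𝓝 (0^2/2 - u0^2/2 + u0^(6:ℝ)/6)) :=
    (((hu1.pow 2).div_const 2).sub ((S.lim0.pow 2).div_const 2)).add
      ((S.lim0.rpow_const (Or.inl S.u0pos.ne')).div_const 6)
  have h2 : Tendsto (fun r => u1 r^2/2 - u r^2/2 + u r^(6:ℝ)/6) (𝓝[>] 0) (𝓝 0) := by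
    refine tendsto_const_nhds.congr' ?_
    filter_upwards [self_mem_nhdsWithin] with r hr
    have := hJ r hr
    have e : (6:ℝ) = ((6:ℕ):ℝ) := by norm_num
    rw [e, Real.rpow_natCast]
    norm_num [Jf] at this
    linarith
  have h3 := tendsto_nhds_unique h1 h2
  have h4 : u0^(6:ℝ) = u0^(4:ℝ) * u0^2 := by
    rw [← Real.rpow_two, ← Real.rpow_add S.u0pos]; norm_num
  rw [h4] at h3
  have := S.u0pos
  have h5 : u0^2 * (u0^(4:ℝ) - 3) = 0 := by nlinarith
  have := (mul_eq_zero.1 h5).resolve_left (by positivity)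
  linarith

lemma rpow_lip {p M : ℝ} (hp : 1 ≤ p) (hM : 0 ≤ M) {x y : ℝ} (hx : 0 ≤ x) (hy : 0 ≤ y) (hxM : x ≤ M) (hyM : y ≤ M) :
    |x^p - y^p| ≤ p * M^(p-1) * |x - y| := by
  have := Convex.norm_image_sub_le_of_norm_hasDerivWithin_le (f := fun x : ℝ => x^p) (f' := fun x => p * x^(p-1))
    (s := Icc 0 M) (C := p * M^(p-1)) (x := y) (y := x)
    (fun z hz => (Real.hasDerivAt_rpow_const (Or.inr hp)).hasDerivWithinAt)
    (fun z hz => by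
      rw [Real.norm_eq_abs, abs_of_nonneg (mul_nonneg (by linarith) (Real.rpow_nonneg hz.1 _))]
      exact mul_le_mul_of_nonneg_left (Real.rpow_le_rpow hz.1 hz.2 (by linarith)) (by linarith))
    (convex_Icc 0 M) ⟨hy, hyM⟩ ⟨hx, hxM⟩
  exact this

lemma eq_of_u0 {n : ℝ} (hn : 1 ≤ n) {u u1 v v1 : ℝ → ℝ} {u0 : ℝ} (S : Sol n u u1 u0) (T : Sol n v v1 u0)
    {R : ℝ} (hR : 0 < R) : u R = v R := by
  have bdd : ∀ {u u1 : ℝ → ℝ} (_ : Sol n u u1 u0), ∃ M, 0 ≤ M ∧ ∀ r, 0 < r → r ≤ R → u r ≤ M := by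
    intro u u1 S
    have h1 := S.lim0.eventually (gt_mem_nhds (lt_add_one u0))
    obtain ⟨d, hd, h⟩ := mem_nhdsGT_iff_exists_Ioc_subset.1 h1
    have hd : 0 < d := hd
    have hc : ContinuousOn u (Icc d (max d R)) :=
      fun x hx => (S.d0 x (by linarith [hx.1])).continuousAt.continuousWithinAt
    obtain ⟨M, hM⟩ := (isCompact_Icc.image_of_continuousOn hc).bddAbove
    refine ⟨max (u0+1) M, le_trans (by linarith [S.u0pos]) (le_max_left _ _), fun r hr hrR => ?_⟩
    rcases le_or_gt r d with h2 | h2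
    · exact le_trans (le_of_lt (h ⟨hr, h2⟩)) (le_max_left _ _)
    · exact le_trans (hM ⟨r, ⟨h2.le, le_trans hrR (le_max_right _ _)⟩, rfl⟩) (le_max_right _ _)
  obtain ⟨M1, hM1, hb1⟩ := bdd S
  obtain ⟨M2, hM2, hb2⟩ := bdd T
  set M := max M1 M2
  have hp : 1 ≤ 1 + 4/n := by have : 0 < 4/n := by positivity
                              linarith
  set L := (1+4/n) * M^(1+4/n-1) with hL
  have hL0 : 0 ≤ L := mul_nonneg (by linarith) (Real.rpow_nonneg (le_trans hM1 (le_max_left _ _)) _)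
  set K := 2 + L with hK
  set F := fun r => -(Real.exp (-K*r) * ((u r - v r)^2 + (u1 r - v1 r)^2)) with hF
  have hd : ∀ r, 0 < r → r ≤ R → HasDerivAt F (-((Real.exp (-K*r) * (-K*1)) * ((u r - v r)^2 + (u1 r - v1 r)^2)
      + Real.exp (-K*r) * (2 * (u r - v r)^(2-1) * (u1 r - v1 r) + 2 * (u1 r - v1 r)^(2-1) *
        ((-(n-1)/r*u1 r + u r - u r^(1+4/n)) - (-(n-1)/r*v1 r + v r - v r^(1+4/n)))))) r := by
    intro r hr _
    have := ((((hasDerivAt_id r).const_mul (-K)).exp).mul ((((S.d0 r hr).sub (T.d0 r hr)).pow 2).add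
      (((S.d1 r hr).sub (T.d1 r hr)).pow 2))).neg
    exact this
  have hlim : Tendsto F (𝓝[>] 0) (𝓝 0) := by
    have t1 : ∀ {u u1 : ℝ → ℝ} (_ : Sol n u u1 u0), Tendsto u1 (𝓝[>] 0) (𝓝 0) := by
      intro u u1 S
      have := zero_of_rpow_mul one_pos S.bigO_u1r
      refine this.congr' ?_
      filter_upwards [self_mem_nhdsWithin] with r hr
      have hr : 0 < r := hr
      rw [Real.rpow_one]; field_simp
    have he : Tendsto (fun r : ℝ => Real.exp (-K*r)) (𝓝[>] 0) (𝓝 (Real.exp (-K*0))) :=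
      (Continuous.tendsto (by fun_prop) 0).mono_left nhdsWithin_le_nhds
    have := (he.mul (((S.lim0.sub T.lim0).pow 2).add (((t1 S).sub (t1 T)).pow 2))).neg
    simpa [F] using this
  have := nonneg_of_mono (F := F) hR hd (by
    intro r hr hrR
    have hl := rpow_lip (p := 1+4/n) (M := M) hp (le_trans hM1 (le_max_left _ _)) (S.pos r hr).le (T.pos r hr).le
      ((hb1 r hr hrR).trans (le_max_left _ _)) ((hb2 r hr hrR).trans (le_max_right _ _))
    rw [← hL] at hl
    set a := u r - v r with ha
    set b := u1 r - v1 r with hb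
    set y := u r^(1+4/n) - v r^(1+4/n) with hy
    have he := Real.exp_pos (-K*r)
    have hbr : 0 ≤ K * (a^2+b^2) - (2*a*b + 2*b*(-((n-1)/r)*b + a - y)) := by
      have h1 : 0 ≤ (n-1)/r := div_nonneg (by linarith) hr.le
      have h2 : 0 ≤ (n-1)/r*b^2 := by positivity
      have h3 : 2*b*y ≤ 2*|b| * (L*|a|) := by
        calc 2*b*y ≤ |2*b*y| := le_abs_self _
          _ = 2*|b| * |y| := by rw [abs_mul, abs_mul, abs_two]
          _ ≤ _ := by gcongr
      have h3' : -(2*|b| * (L*|a|)) ≤ 2*b*y := by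
        have : -(2*b*y) ≤ |2*b*y| := neg_le_abs _
        have h4 : |2*b*y| = 2*|b| * |y| := by rw [abs_mul, abs_mul, abs_two]
        have h5 : 2*|b| * |y| ≤ 2*|b| * (L*|a|) := by gcongr
        linarith
      have h6 : 2*|b| * |a| ≤ a^2+b^2 := by nlinarith [sq_nonneg (|a|-|b|), sq_abs a, sq_abs b]
      have h7 : 2*|b| * (L*|a|) ≤ L*(a^2+b^2) := by nlinarith
      have h8 : 2*a*b ≤ a^2+b^2 := by nlinarith [sq_nonneg (a-b)]
      rw [hK]; nlinarith
    have : 0 ≤ Real.exp (-K*r) * (K * (a^2+b^2) - (2*a*b + 2*b*(-((n-1)/r)*b + a - y))) := by positivity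
    refine le_of_le_of_eq this ?_
    rw [ha, hb, hy]
    ring) hlim
  have he := Real.exp_pos (-K*R)
  have h1 : (u R - v R)^2 + (u1 R - v1 R)^2 ≤ 0 := by
    by_contra h
    push Not at h
    have : 0 < Real.exp (-K*R) * ((u R - v R)^2 + (u1 R - v1 R)^2) := mul_pos he h
    simp only [hF] at *
    linarith
  have : (u R - v R)^2 = 0 := by nlinarith [sq_nonneg (u R - v R), sq_nonneg (u1 R - v1 R)]
  have := pow_eq_zero_iff (two_ne_zero) |>.1 this
  linarith

theorem sol_unique {N : ℕ} (hN : 1 ≤ N) {u u1 v v1 : ℝ → ℝ} {u0 v0 : ℝ} (S : Sol N u u1 u0) (T : Sol N v v1 v0)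
    {r : ℝ} (hr : 0 < r) : u r = v r := by
  have hn : (1:ℝ) ≤ N := by exact_mod_cast hN
  have h0 : u0 = v0 := by
    rcases hN.lt_or_eq with h | h
    · have h2 : (2:ℝ) ≤ N := by exact_mod_cast h
      rcases lt_trichotomy u0 v0 with h3 | h3 | h3
      · exact (uniq_aux h2 T S h3).elim
      · exact h3
      · exact (uniq_aux h2 S T h3).elim
    · subst h
      rw [Nat.cast_one] at S T
      have a := u0_eq_one S
      have b := u0_eq_one T
      exact (Real.rpow_left_inj S.u0pos.le T.u0pos.le (by norm_num)).1 (a.trans b.symm)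
  subst h0
  exact eq_of_u0 hn S T hr
end CM

namespace CM
open Set Topology Asymptotics

lemma second_deriv_line {N : ℕ} {Q : EuclideanSpace ℝ (Fin N) → ℝ} (hQ : ContDiff ℝ (⊤ : ℕ∞) Q)
    (x e : EuclideanSpace ℝ (Fin N)) (s : ℝ) :
    HasDerivAt (fun s : ℝ => Q (x + s • e)) (fderiv ℝ Q (x + s • e) e) s ∧
    HasDerivAt (fun s : ℝ => fderiv ℝ Q (x + s • e) e) (fderiv ℝ (fun y => fderiv ℝ Q y e) (x + s • e) e) s := by
  have hl : HasDerivAt (fun s : ℝ => x + s • e) e s := by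
    simpa using ((hasDerivAt_id s).smul_const e).const_add x
  have h1 : Differentiable ℝ Q := hQ.differentiable (by simp)
  have h2 : Differentiable ℝ (fun y => fderiv ℝ Q y e) := by
    have : ContDiff ℝ 1 (fderiv ℝ Q) := (contDiff_infty.1 hQ 2).fderiv_right (by norm_num)
    exact (this.clm_apply contDiff_const).differentiable (by simp)
  exact ⟨(h1 _).hasFDerivAt.comp_hasDerivAt s hl, (h2 _).hasFDerivAt.comp_hasDerivAt s hl⟩

lemma norm_line {N : ℕ} {i j : Fin N} (hij : i ≠ j) (r s : ℝ) :
    ‖(r • EuclideanSpace.single j (1:ℝ) + s • EuclideanSpace.single i (1:ℝ) : EuclideanSpace ℝ (Fin N))‖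
      = √(r^2+s^2) := by
  have hinner : inner ℝ (r • EuclideanSpace.single j (1:ℝ) : EuclideanSpace ℝ (Fin N))
      (s • EuclideanSpace.single i (1:ℝ)) = 0 := by
    rw [inner_smul_left, inner_smul_right]
    simp [EuclideanSpace.inner_single_left, hij.symm]
  have := norm_add_sq_eq_norm_sq_add_norm_sq_of_inner_eq_zero _ _ hinner
  rw [← Real.sqrt_mul_self (norm_nonneg _), this]
  congr 1
  simp [norm_smul]
  ring

lemma Q_sol {N : ℕ} (hN : 1 ≤ N) {Q : EuclideanSpace ℝ (Fin N) → ℝ} (hQ : IsGroundState N Q) :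
    ∃ u u1 : ℝ → ℝ, ∃ u0, Sol N u u1 u0 ∧ ∀ x, Q x = u ‖x‖ := by
  obtain ⟨hs, hpos, hrad, heq, C, c, hC, hc, hdec⟩ := hQ
  let j : Fin N := ⟨0, hN⟩
  let e : EuclideanSpace ℝ (Fin N) := EuclideanSpace.single j (1:ℝ)
  have he : ‖e‖ = 1 := by simp [e]
  let u : ℝ → ℝ := fun r => Q (0 + r • e)
  let u1 : ℝ → ℝ := fun r => fderiv ℝ Q (0 + r • e) e
  let u2 : ℝ → ℝ := fun r => fderiv ℝ (fun y => fderiv ℝ Q y e) (0 + r • e) e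
  have hd0 : ∀ r, HasDerivAt u (u1 r) r := fun r => (second_deriv_line hs 0 e r).1
  have hd1 : ∀ r, HasDerivAt u1 (u2 r) r := fun r => (second_deriv_line hs 0 e r).2
  have hQu : ∀ x, Q x = u ‖x‖ := fun x => hrad _ _ (by simp [norm_smul, he])
  have hlap : ∀ r, 0 < r → lapl Q (0 + r • e) = u2 r + (N-1) * (u1 r / r) := by
    intro r hr
    have hj : fderiv ℝ (fun y => fderiv ℝ Q y (EuclideanSpace.single j (1:ℝ))) (0 + r • e)
      (EuclideanSpace.single j (1:ℝ)) = u2 r := rfl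
    have hi : ∀ i, i ≠ j → fderiv ℝ (fun y => fderiv ℝ Q y (EuclideanSpace.single i (1:ℝ))) (0 + r • e)
      (EuclideanSpace.single i (1:ℝ)) = u1 r / r := by
      intro i hij
      set ei : EuclideanSpace ℝ (Fin N) := EuclideanSpace.single i (1:ℝ)
      have h1 := fun s => second_deriv_line hs (0 + r • e) ei s
      have hg : (fun s : ℝ => Q ((0 + r • e) + s • ei)) = fun s => u (√(r^2+s^2)) := by
        funext s
        rw [hQu, zero_add, norm_line hij]
      have hsq : ∀ s : ℝ, HasDerivAt (fun s : ℝ => √(r^2+s^2)) (s / √(r^2+s^2)) s := by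
        intro s
        have h := ((hasDerivAt_pow 2 s).const_add (r^2)).sqrt (by positivity)
        refine h.congr_deriv ?_
        have : 0 < √(r^2+s^2) := Real.sqrt_pos.2 (by positivity)
        field_simp
        norm_num
      have hg' : (fun s : ℝ => fderiv ℝ Q ((0 + r • e) + s • ei) ei) =
          fun s => u1 (√(r^2+s^2)) * (s / √(r^2+s^2)) := by
        funext s
        have h2 := (h1 s).1
        rw [hg] at h2
        exact h2.unique ((hd0 _).comp s (hsq s))
      have h3 := (h1 0).2
      rw [hg'] at h3
      have hs0 : √(r^2+(0:ℝ)^2) = r := by simp [Real.sqrt_sq hr.le]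
      have h4 := ((hd1 _).comp (0:ℝ) (hsq 0)).mul ((hasDerivAt_id (0:ℝ)).div (hsq 0) (by rw [hs0]; exact hr.ne'))
      have h5 := h3.unique h4
      rw [zero_smul, add_zero] at h5
      rw [h5]
      simp [Real.sqrt_sq hr.le]
      field_simp
    rw [lapl, ← Finset.add_sum_erase _ _ (Finset.mem_univ j), hj,
      Finset.sum_congr rfl (fun i hi' => hi i (Finset.ne_of_mem_erase hi'))]
    simp [Finset.card_erase_of_mem, Nat.cast_sub hN]
  have heven : ∀ r, u (-r) = u r := fun r => hrad _ _ (by simp)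
  have h10 : u1 0 = 0 := by
    have h1 : HasDerivAt (fun r => u (-r)) (u1 (-0) * (-1)) 0 := (hd0 (-0)).comp (0:ℝ) (hasDerivAt_neg 0)
    have h2 : (fun r => u (-r)) = u := funext heven
    rw [h2] at h1
    have := h1.unique (hd0 0)
    rw [neg_zero] at this
    linarith
  refine ⟨u, u1, u 0, ⟨fun r _ => hpos _, fun r _ => hd0 r, ?_, ?_, hpos _, ?_, ?_⟩, hQu⟩
  · intro r hr
    refine (hd1 r).congr_deriv ?_
    have h := heq (0 + r • e)
    rw [hlap r hr] at h
    have : u2 r + (N-1) * (u1 r / r) - u r + u r ^ ((1:ℝ)+4/N) = 0 := h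
    linear_combination this
  · exact (hd0 0).continuousAt.tendsto.mono_left nhdsWithin_le_nhds
  · have hc2 : Continuous u2 := by
      have h1 : ContDiff ℝ 1 (fun y => fderiv ℝ Q y e) :=
        ((contDiff_infty.1 hs 2).fderiv_right (m := 1) (by norm_num)).clm_apply contDiff_const
      have h2 : Continuous (fderiv ℝ (fun y => fderiv ℝ Q y e)) := h1.continuous_fderiv (by simp)
      exact (h2.comp (by fun_prop : Continuous fun r : ℝ => (0:EuclideanSpace ℝ (Fin N)) + r • e)).clm_apply continuous_const
    obtain ⟨M, hM⟩ := (isCompact_Icc (a := (0:ℝ)) (b := 1)).exists_bound_of_continuousOn hc2.continuousOn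
    refine ⟨M, fun r hr hr1 => ?_⟩
    have := Convex.norm_image_sub_le_of_norm_hasDerivWithin_le (s := Icc (0:ℝ) 1) (x := 0) (y := r)
      (fun x _ => (hd1 x).hasDerivWithinAt) hM (convex_Icc 0 1) ⟨le_rfl, zero_le_one⟩ ⟨hr.le, hr1⟩
    simpa [h10, abs_of_pos hr] using this
  · refine ⟨C * (N.factorial / c^N), fun r hr => ?_⟩
    have hr0 : 0 < r := by linarith
    have h1 := hdec (0 + r • e)
    rw [zero_add, norm_smul, he, Real.norm_eq_abs, abs_of_pos hr0, mul_one] at h1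
    have h2 := Real.pow_div_factorial_le_exp (c*r) (by positivity) N
    have h3 : Real.exp (-c*r) ≤ N.factorial / c^N * r^(-(N:ℝ)/2) := by
      have h4 : r^(-(N:ℝ)) ≤ r^(-(N:ℝ)/2) := Real.rpow_le_rpow_of_exponent_le hr (by
        have : (0:ℝ) ≤ N := by positivity
        linarith)
      have hf : (0:ℝ) < N.factorial := by exact_mod_cast N.factorial_pos
      calc Real.exp (-c*r) = (Real.exp (c*r))⁻¹ := by rw [← Real.exp_neg]; ring_nf
        _ ≤ ((c*r)^N/N.factorial)⁻¹ := inv_anti₀ (by positivity) h2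
        _ = N.factorial / c^N * r^(-(N:ℝ)) := by
            rw [Real.rpow_neg hr0.le, Real.rpow_natCast, mul_pow]; field_simp
        _ ≤ _ := by gcongr
    have : u r ≤ C * Real.exp (-c*r) := by simpa [u] using h1
    calc u r ≤ C * Real.exp (-c*r) := this
      _ ≤ C * (N.factorial / c^N * r^(-(N:ℝ)/2)) := by gcongr
      _ = _ := by ring
end CM

namespace CM
open Set Topology Asymptotics

/-- Lipschitz profiles vanishing far out -/
def Prof (f : ℝ → ℝ) : Prop := (∃ L, LipschitzWith L f) ∧ ∃ R, 0 < R ∧ ∀ r, R ≤ r → f r = 0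
def Dec (f : ℝ → ℝ) : Prop := Prof f ∧ (∀ r, 0 ≤ f r) ∧ AntitoneOn f (Ioi 0)
def Af (n : ℝ) (f : ℝ → ℝ) : ℝ := ∫ r in Ioi 0, r^(n-1) * (deriv f r)^2
def Pf (n s : ℝ) (f : ℝ → ℝ) : ℝ := ∫ r in Ioi 0, r^(n-1) * |f r|^s

lemma intW {n : ℝ} (hn : 1 ≤ n) {g : ℝ → ℝ} (hg : Measurable g) {M R : ℝ} (hM : ∀ r, 0 < r → |g r| ≤ M)
    (hR : ∀ r, R < r → g r = 0) : IntegrableOn (fun r => r^(n-1) * g r) (Ioi 0) := by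
  have hi : Integrable (fun r => (Ioc 0 R).indicator (fun _ => R^(n-1) * M) r) (volume.restrict (Ioi 0)) := by
    apply Integrable.mono_measure _ Measure.restrict_le_self
    rw [integrable_indicator_iff measurableSet_Ioc]
    exact integrableOn_const (by simp)
  apply hi.mono' (by fun_prop)
  rw [ae_restrict_iff' measurableSet_Ioi]
  filter_upwards with r hr
  have hr : 0 < r := hr
  rcases le_or_gt r R with h | h
  · rw [indicator_of_mem (show r ∈ Ioc 0 R from ⟨hr, h⟩), norm_mul, Real.norm_eq_abs, Real.norm_eq_abs,
      abs_of_nonneg (Real.rpow_nonneg hr.le _)]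
    exact mul_le_mul (Real.rpow_le_rpow hr.le h (by linarith)) (hM r hr) (abs_nonneg _)
      (Real.rpow_nonneg (by linarith) _)
  · rw [indicator_of_notMem (by simp [h]), hR r h]; simp

namespace Prof
variable {f g : ℝ → ℝ}

lemma cont (hf : Prof f) : Continuous f := hf.1.choose_spec.continuous

lemma bdd (hf : Prof f) : ∃ M, ∀ r, 0 < r → |f r| ≤ M := by
  obtain ⟨R, hR, h⟩ := hf.2
  obtain ⟨M, hM⟩ := (isCompact_Icc (a := (0:ℝ)) (b := R)).exists_bound_of_continuousOn hf.cont.continuousOn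
  refine ⟨M, fun r hr => ?_⟩
  rcases le_or_gt r R with h1 | h1
  · exact hM r ⟨hr.le, h1⟩
  · rw [h r h1.le, abs_zero]
    exact (norm_nonneg _).trans (hM 0 ⟨le_rfl, hR.le⟩)

lemma deriv_zero (hf : Prof f) : ∃ R, ∀ r, R < r → deriv f r = 0 := by
  obtain ⟨R, hR, h⟩ := hf.2
  refine ⟨R, fun r hr => ?_⟩
  have : f =ᶠ[𝓝 r] fun _ => 0 := by
    filter_upwards [lt_mem_nhds hr] with x hx using h x hx.le
  rw [this.deriv_eq]; simp

lemma deriv_bdd (hf : Prof f) : ∃ M, ∀ r, |deriv f r| ≤ M := by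
  obtain ⟨L, hL⟩ := hf.1
  exact ⟨L, fun r => by simpa using norm_deriv_le_of_lipschitz hL⟩

lemma ae_diff (hf : Prof f) : ∀ᵐ r, DifferentiableAt ℝ f r := by
  obtain ⟨L, hL⟩ := hf.1
  exact hL.ae_differentiableAt_real

lemma intP {n s : ℝ} (hn : 1 ≤ n) (hs : 0 < s) (hf : Prof f) :
    IntegrableOn (fun r => r^(n-1) * |f r|^s) (Ioi 0) := by
  obtain ⟨M, hM⟩ := hf.bdd
  obtain ⟨R, hR, h⟩ := hf.2
  have := hf.cont.measurable
  apply intW hn (by fun_prop) (M := M^s) (R := R)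
  · intro r hr
    rw [abs_of_nonneg (Real.rpow_nonneg (abs_nonneg _) _)]
    exact Real.rpow_le_rpow (abs_nonneg _) (hM r hr) hs.le
  · intro r hr
    rw [h r hr.le, abs_zero, Real.zero_rpow hs.ne']

lemma intA {n : ℝ} (hn : 1 ≤ n) (hf : Prof f) :
    IntegrableOn (fun r => r^(n-1) * (deriv f r)^2) (Ioi 0) := by
  obtain ⟨M, hM⟩ := hf.deriv_bdd
  obtain ⟨R, h⟩ := hf.deriv_zero
  have := measurable_deriv f
  apply intW hn (by fun_prop) (M := M^2) (R := R)
  · intro r hr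
    rw [abs_pow]
    exact pow_le_pow_left₀ (abs_nonneg _) (hM r) 2
  · intro r hr
    rw [h r hr]; simp

lemma intAA {n : ℝ} (hn : 1 ≤ n) (hf : Prof f) (hg : Prof g) :
    IntegrableOn (fun r => r^(n-1) * (deriv f r * deriv g r)) (Ioi 0) := by
  obtain ⟨M, hM⟩ := hf.deriv_bdd
  obtain ⟨M', hM'⟩ := hg.deriv_bdd
  obtain ⟨R, h⟩ := hf.deriv_zero
  have := measurable_deriv f
  have := measurable_deriv g
  apply intW hn (by fun_prop) (M := M*M') (R := R)
  · intro r hr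
    rw [abs_mul]
    exact mul_le_mul (hM r) (hM' r) (abs_nonneg _) ((abs_nonneg _).trans (hM r))
  · intro r hr
    rw [h r hr]; simp

/-- fundamental theorem of calculus -/
lemma ftc (hf : Prof f) (a b : ℝ) : IntervalIntegrable (deriv f) volume a b ∧ ∫ x in a..b, deriv f x = f b - f a := by
  obtain ⟨L, hL⟩ := hf.1
  have h := (hL.lipschitzOnWith (s := uIcc a b)).absolutelyContinuousOnInterval
  exact ⟨h.intervalIntegrable_deriv, h.integral_deriv_eq_sub⟩

lemma add_smul (hf : Prof f) (hg : Prof g) (t : ℝ) : Prof (fun r => f r + t * g r) := by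
  obtain ⟨⟨L, hL⟩, R, hR, h⟩ := hf
  obtain ⟨⟨L', hL'⟩, R', hR', h'⟩ := hg
  refine ⟨⟨_, hL.add ((lipschitzWith_smul t).comp hL')⟩, max R R', lt_max_of_lt_left hR, fun r hr => ?_⟩
  show f r + t * g r = 0
  rw [h r ((le_max_left _ _).trans hr), h' r ((le_max_right _ _).trans hr)]; simp
end Prof

lemma Af_nonneg (n : ℝ) (f : ℝ → ℝ) : 0 ≤ Af n f :=
  setIntegral_nonneg measurableSet_Ioi fun r hr => mul_nonneg (Real.rpow_nonneg (le_of_lt hr) _) (sq_nonneg _)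
lemma Pf_nonneg (n s : ℝ) (f : ℝ → ℝ) : 0 ≤ Pf n s f :=
  setIntegral_nonneg measurableSet_Ioi fun r hr => mul_nonneg (Real.rpow_nonneg (le_of_lt hr) _)
    (Real.rpow_nonneg (abs_nonneg _) _)

/-- difference bound -/
lemma diff_bound {n : ℝ} (hn : 1 ≤ n) {f : ℝ → ℝ} (hf : Prof f) {r s l : ℝ} (hr : 0 < r) (hrs : r ≤ s) (hl : 0 < l) :
    |f r - f s| ≤ (l * Af n f + l⁻¹ * ∫ x in r..s, x^(1-n)) / 2 := by
  obtain ⟨hi, he⟩ := hf.ftc r s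
  have hsub : Ioc r s ⊆ Ioi 0 := fun x hx => lt_trans hr hx.1
  have hA : IntervalIntegrable (fun x => x^(n-1) * (deriv f x)^2) volume r s := by
    rw [intervalIntegrable_iff_integrableOn_Ioc_of_le hrs]
    exact (hf.intA hn).mono_set hsub
  have hB : IntervalIntegrable (fun x : ℝ => x^(1-n)) volume r s := by
    apply intervalIntegral.intervalIntegrable_rpow
    right; rw [uIcc_of_le hrs]; simp [hr]
  have h1 : |f r - f s| ≤ ∫ x in r..s, |deriv f x| := by
    rw [abs_sub_comm, ← he]
    exact intervalIntegral.abs_integral_le_integral_abs hrs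
  have h2 : ∫ x in r..s, |deriv f x| ≤ ∫ x in r..s, (l/2 * (x^(n-1) * (deriv f x)^2) + l⁻¹/2 * x^(1-n)) := by
    apply intervalIntegral.integral_mono_on hrs hi.abs ((hA.const_mul _).add (hB.const_mul _))
    intro x hx
    have hx0 : 0 < x := lt_of_lt_of_le hr hx.1
    have e : x^(1-n) = (x^(n-1))⁻¹ := by rw [← Real.rpow_neg hx0.le]; ring_nf
    rw [e]
    have hw := Real.rpow_pos_of_pos hx0 (n-1)
    set w := x^(n-1)
    set d := |deriv f x| with hd
    rw [← sq_abs (deriv f x), ← hd]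
    have : l/2*(w*d^2) + l⁻¹/2*w⁻¹ - d = (l*w*d-1)^2/(2*l*w) := by field_simp; ring
    have h3 : 0 ≤ (l*w*d-1)^2/(2*l*w) := by positivity
    linarith
  have h3 : ∫ x in r..s, x^(n-1) * (deriv f x)^2 ≤ Af n f := by
    rw [intervalIntegral.integral_of_le hrs]
    apply setIntegral_mono_set (hf.intA hn)
    · rw [EventuallyLE, ae_restrict_iff' measurableSet_Ioi]
      filter_upwards with x hx
      exact mul_nonneg (Real.rpow_nonneg (le_of_lt hx) _) (sq_nonneg _)
    · exact hsub.eventuallyLE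
  rw [intervalIntegral.integral_add (hA.const_mul _) (hB.const_mul _), intervalIntegral.integral_const_mul,
    intervalIntegral.integral_const_mul] at h2
  have := mul_le_mul_of_nonneg_left h3 hl.le
  linarith

/-- monotone bound -/
lemma dec_bound {n s : ℝ} (hn : 1 ≤ n) (hs : 0 < s) {f : ℝ → ℝ} (hf : Dec f) {r : ℝ} (hr : 0 < r) :
    f r^s * r^n ≤ n * Pf n s f := by
  have h1 : ∫ x in (0:ℝ)..r, x^(n-1) * f r^s ≤ Pf n s f := by
    rw [intervalIntegral.integral_of_le hr.le]
    have hI := (hf.1.intP hn hs)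
    calc _ ≤ ∫ x in Ioc 0 r, x^(n-1) * |f x|^s := by
          apply setIntegral_mono_on _ (hI.mono_set Ioc_subset_Ioi_self) measurableSet_Ioc
          · intro x hx
            rw [abs_of_nonneg (hf.2.1 x)]
            exact mul_le_mul_of_nonneg_left (Real.rpow_le_rpow (hf.2.1 r) (hf.2.2 hx.1 hr hx.2) hs.le)
              (Real.rpow_nonneg hx.1.le _)
          · rw [← intervalIntegrable_iff_integrableOn_Ioc_of_le hr.le]
            exact (intervalIntegral.intervalIntegrable_rpow' (by linarith)).mul_const _
      _ ≤ _ := by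
          apply setIntegral_mono_set hI _ Ioc_subset_Ioi_self.eventuallyLE
          rw [EventuallyLE, ae_restrict_iff' measurableSet_Ioi]
          filter_upwards with x hx
          exact mul_nonneg (Real.rpow_nonneg (le_of_lt hx) _) (Real.rpow_nonneg (abs_nonneg _) _)
  rw [intervalIntegral.integral_mul_const, integral_rpow (Or.inl (by linarith)), sub_add_cancel,
    Real.zero_rpow (by linarith), sub_zero] at h1
  have h2 := mul_le_mul_of_nonneg_left h1 (by linarith : 0 ≤ n)
  refine le_trans (le_of_eq ?_) h2
  field_simp
end CM

namespace CM
open Set Topology Asymptotics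

def qq (n : ℝ) : ℝ := 2 + 4/n
def bt (n : ℝ) : ℝ := (n^2 - 1/2)/(n+2)/2
def KK (n : ℝ) : ℝ := n + 1/2 + 1/(4*bt n)
def env (n r : ℝ) : ℝ := if r ≤ 1 then KK n * r^(-bt n) else KK n * r^(-(n/2))
def Unit1 (n : ℝ) (f : ℝ → ℝ) : Prop := Dec f ∧ Af n f ≤ 1 ∧ Pf n 2 f ≤ 1


lemma bt_pos {n : ℝ} (hn : 1 ≤ n) : 0 < bt n := by
  rw [bt]
  have : 0 < n^2 - 1/2 := by nlinarith
  positivity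
lemma bt_ge {n : ℝ} (hn : 1 ≤ n) : n - 2 ≤ 2 * bt n := by
  rw [bt, mul_div_cancel₀ _ two_ne_zero, le_div_iff₀ (by linarith)]; nlinarith
lemma bt_lt {n : ℝ} (hn : 1 ≤ n) : bt n * qq n < n := by
  have : bt n * qq n = (n^2-1/2)/n := by rw [bt, qq]; field_simp; ring
  rw [this, div_lt_iff₀ (by linarith)]; nlinarith
lemma qq_gt {n : ℝ} (hn : 1 ≤ n) : 2 < qq n := by
  have : 0 < 4/n := by positivity
  rw [qq]; linarith
lemma nqq {n : ℝ} (hn : 1 ≤ n) : n/2 * qq n = n + 2 := by rw [qq]; field_simp; ring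
lemma KK_ge {n : ℝ} (hn : 1 ≤ n) : n ≤ KK n := by
  have := bt_pos hn
  have : 0 < 1/(4*bt n) := by positivity
  rw [KK]; linarith
lemma KK_pos {n : ℝ} (hn : 1 ≤ n) : 0 < KK n := by linarith [KK_ge hn]

lemma env_pos {n : ℝ} (hn : 1 ≤ n) {r : ℝ} (hr : 0 < r) : 0 < env n r := by
  have := KK_pos hn
  rw [env]; split_ifs <;> positivity

lemma far_bound {n : ℝ} (hn : 1 ≤ n) {f : ℝ → ℝ} (hf : Dec f) (hP : Pf n 2 f ≤ 1) {r : ℝ} (hr : 0 < r) : f r ≤ n * r^(-(n/2)) := by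
  have h := dec_bound hn two_pos hf hr
  rw [Real.rpow_two] at h
  have h0 := hf.2.1 r
  have e : r^n = (r^(n/2))^2 := by rw [← Real.rpow_natCast, ← Real.rpow_mul hr.le]; norm_num
  have hw := Real.rpow_pos_of_pos hr (n/2)
  rw [Real.rpow_neg hr.le, ← div_eq_mul_inv, le_div_iff₀ hw]
  rw [e] at h
  apply le_of_sq_le_sq _ (by linarith)
  nlinarith

lemma int_rpow_le {b r : ℝ} (hb : 0 < b) (hr : 0 < r) (hr1 : r ≤ 1) : ∫ x in r..1, x^(-1-b) ≤ r^(-b)/b := by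
  rw [integral_rpow (Or.inr ⟨by linarith, by rw [uIcc_of_le hr1]; simp [hr]⟩)]
  have e : -1 - b + 1 = -b := by ring
  rw [e, Real.one_rpow, div_neg, ← neg_div]
  gcongr
  linarith

lemma near_bound {n : ℝ} (hn : 1 ≤ n) {f : ℝ → ℝ} (hf : Unit1 n f) {r : ℝ} (hr : 0 < r) (hr1 : r ≤ 1) : f r ≤ KK n * r^(-bt n) := by
  have hb := bt_pos hn
  have h := diff_bound hn hf.1.1 hr hr1 (Real.rpow_pos_of_pos hr (-bt n))
  have h1 := far_bound hn hf.1 hf.2.2 one_pos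
  rw [Real.one_rpow, mul_one] at h1
  have hI : ∫ x in r..1, x^(1-n) ≤ r^(-(2*bt n))/(2*bt n) := by
    refine le_trans ?_ (int_rpow_le (by linarith) hr hr1)
    have hnot : (0:ℝ) ∉ uIcc r 1 := by rw [uIcc_of_le hr1]; simp [hr]
    apply intervalIntegral.integral_mono_on hr1 (intervalIntegral.intervalIntegrable_rpow (Or.inr hnot))
      (intervalIntegral.intervalIntegrable_rpow (Or.inr hnot))
    intro x hx
    exact Real.rpow_le_rpow_of_exponent_ge (by linarith [hx.1]) hx.2 (by linarith [bt_ge hn])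
  have e1 : r^(-(2*bt n)) = r^(-bt n) * r^(-bt n) := by rw [← Real.rpow_add hr]; ring_nf
  have hw := Real.rpow_pos_of_pos hr (-bt n)
  have hw1 : 1 ≤ r^(-bt n) := Real.one_le_rpow_of_pos_of_le_one_of_nonpos hr hr1 (by linarith)
  rw [e1] at hI
  have h2 := (le_abs_self _).trans h
  have h3 : (r^(-bt n))⁻¹ * ∫ x in r..1, x^(1-n) ≤ r^(-bt n)/(2*bt n) := by
    calc _ ≤ (r^(-bt n))⁻¹ * (r^(-bt n) * r^(-bt n)/(2*bt n)) := by gcongr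
      _ = _ := by field_simp
  have h4 : r^(-bt n) * Af n f ≤ r^(-bt n) := by nlinarith [hf.2.1]
  have h5 : KK n * r^(-bt n) = n * r^(-bt n) + (r^(-bt n) + r^(-bt n)/(2*bt n))/2 := by
    rw [KK]; field_simp; ring
  rw [h5]
  nlinarith

lemma env_bound {n : ℝ} (hn : 1 ≤ n) {f : ℝ → ℝ} (hf : Unit1 n f) {r : ℝ} (hr : 0 < r) : f r ≤ env n r := by
  rw [env]; split_ifs with h
  · exact near_bound hn hf hr h
  · refine (far_bound hn hf.1 hf.2.2 hr).trans ?_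
    have := KK_ge hn
    gcongr

lemma env_int {n : ℝ} (hn : 1 ≤ n) : IntegrableOn (fun r => r^(n-1) * env n r^qq n) (Ioi 0) := by
  have hK := (KK_pos hn).le
  rw [← Ioc_union_Ioi_eq_Ioi zero_le_one]
  apply IntegrableOn.union
  · have h : IntegrableOn (fun r : ℝ => KK n^qq n * r^(n-1-bt n*qq n)) (Ioc 0 1) := by
      rw [← intervalIntegrable_iff_integrableOn_Ioc_of_le zero_le_one]
      exact (intervalIntegral.intervalIntegrable_rpow' (by linarith [bt_lt hn])).const_mul _
    refine h.congr_fun ?_ measurableSet_Ioc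
    intro r hr
    have hr0 := hr.1
    simp only [env, if_pos hr.2]
    rw [Real.mul_rpow hK (by positivity), ← Real.rpow_mul hr0.le, sub_eq_add_neg (n-1), Real.rpow_add hr0]
    ring_nf
  · have h : IntegrableOn (fun r : ℝ => KK n^qq n * r^(-3:ℝ)) (Ioi 1) :=
      (integrableOn_Ioi_rpow_of_lt (by norm_num) one_pos).const_mul _
    refine h.congr_fun ?_ measurableSet_Ioi
    intro r hr
    have hr1 : 1 < r := hr
    have hr0 : 0 < r := by linarith
    simp only [env, if_neg (not_le.2 hr1)]
    rw [Real.mul_rpow hK (by positivity), ← Real.rpow_mul hr0.le, neg_mul, nqq hn]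
    rw [show (-3:ℝ) = n - 1 + -(n+2) by ring, Real.rpow_add hr0]
    ring

/-- dominated convergence for `B`, stated for a general sequence -/
lemma Bconv {n : ℝ} (hn : 1 ≤ n) {f : ℕ → ℝ → ℝ} (hf : ∀ k, Unit1 n (f k)) {g : ℝ → ℝ} (hg : ∀ r, 0 < r → Tendsto (fun k => f k r) atTop (𝓝 (g r))) :
    Tendsto (fun k => Pf n (qq n) (f k)) atTop (𝓝 (Pf n (qq n) g)) := by
  have hq := qq_gt hn
  apply tendsto_integral_of_dominated_convergence (fun r => r^(n-1) * env n r^qq n)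
  · intro k; exact ((hf k).1.1.intP hn (by linarith)).aestronglyMeasurable
  · exact env_int hn
  · intro k
    rw [ae_restrict_iff' measurableSet_Ioi]
    filter_upwards with r hr
    have hr : 0 < r := hr
    rw [Real.norm_eq_abs, abs_of_nonneg (by positivity), abs_of_nonneg ((hf k).1.2.1 r)]
    have := (hf k).1.2.1 r
    have := env_bound hn (hf k) hr
    gcongr
  · rw [ae_restrict_iff' measurableSet_Ioi]
    filter_upwards with r hr
    exact ((hg r hr).abs.rpow_const (Or.inr (by linarith))).const_mul _

lemma B_le {n : ℝ} (hn : 1 ≤ n) {f : ℝ → ℝ} (hf : Unit1 n f) : Pf n (qq n) f ≤ ∫ r in Ioi 0, r^(n-1) * env n r^qq n := by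
  have hq := qq_gt hn
  apply setIntegral_mono_on (hf.1.1.intP hn (by linarith)) (env_int hn) measurableSet_Ioi
  intro r hr
  have hr : 0 < r := hr
  rw [abs_of_nonneg (hf.1.2.1 r)]
  have := hf.1.2.1 r
  have := env_bound hn hf hr
  gcongr

lemma B_small {n : ℝ} (hn : 1 ≤ n) {s : ℝ} (hs : 0 < s) {η : ℝ} (hη : 0 < η) :
    ∃ δ > 0, ∀ f, Unit1 n f → Pf n s f ≤ δ → Pf n (qq n) f ≤ η := by
  by_contra hcon
  push Not at hcon
  choose! f hf hfs hfη using fun k : ℕ => hcon (1/((k:ℝ)+1)) (by positivity)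
  have hz : ∀ r, 0 < r → Tendsto (fun k => f k r) atTop (𝓝 0) := by
    intro r hr
    have h1 : Tendsto (fun k : ℕ => (n * (1/((k:ℝ)+1)) / r^n)^(1/s)) atTop (𝓝 0) := by
      have h2 : Tendsto (fun k : ℕ => n * (1/((k:ℝ)+1)) / r^n) atTop (𝓝 (n*0/r^n)) :=
        (tendsto_one_div_add_atTop_nhds_zero_nat.const_mul n).div_const _
      have := h2.rpow_const (p := 1/s) (Or.inr (by positivity))
      rwa [mul_zero, zero_div, Real.zero_rpow (by positivity)] at this
    refine squeeze_zero (fun k => (hf k).1.2.1 r) (fun k => ?_) h1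
    have h0 := (hf k).1.2.1 r
    have h3 := dec_bound hn hs (hf k).1 hr
    have hw := Real.rpow_pos_of_pos hr n
    have h4 : f k r^s ≤ n * (1/((k:ℝ)+1)) / r^n := by
      rw [le_div_iff₀ hw]
      exact h3.trans (mul_le_mul_of_nonneg_left (hfs k) (by linarith))
    calc f k r = (f k r^s)^(1/s) := by rw [← Real.rpow_mul h0, mul_one_div_cancel hs.ne', Real.rpow_one]
      _ ≤ _ := Real.rpow_le_rpow (Real.rpow_nonneg h0 _) h4 (by positivity)
  have hc := Bconv hn hf (g := fun _ => 0) hz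
  have h0 : Pf n (qq n) (fun _ => 0) = 0 := by
    have := qq_gt hn
    simp [Pf, Real.zero_rpow (by linarith : qq n ≠ 0)]
  rw [h0] at hc
  have := ge_of_tendsto hc (Eventually.of_forall fun k => (hfη k).le)
  linarith
end CM

namespace CM
open Set Topology Asymptotics

lemma Pf_scale {n s : ℝ} {f : ℝ → ℝ} {l m : ℝ} (hl : 0 < l) (hm : 0 < m) :
    Pf n s (fun r => m * f (l * r)) = m^s * l^(-n) * Pf n s f := by
  have h := integral_comp_mul_left_Ioi (fun r => r^(n-1) * |f r|^s) 0 hl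
  rw [mul_zero, smul_eq_mul] at h
  rw [Pf, Pf]
  calc _ = ∫ r in Ioi 0, (m^s * l^(-(n-1))) * ((l*r)^(n-1) * |f (l*r)|^s) := by
        apply setIntegral_congr_fun measurableSet_Ioi
        intro r hr
        have hr : 0 < r := hr
        simp only []
        rw [abs_mul, abs_of_pos hm, Real.mul_rpow hm.le (abs_nonneg _), Real.mul_rpow hl.le hr.le, Real.rpow_neg hl.le]
        have := Real.rpow_pos_of_pos hl (n-1)
        field_simp
    _ = _ := by
        rw [integral_const_mul, h]
        have : l^(-n) = l^(-(n-1)) * l⁻¹ := by rw [← Real.rpow_neg_one l, ← Real.rpow_add hl]; ring_nf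
        rw [this]; ring

lemma Af_scale {n : ℝ} {f : ℝ → ℝ} {l m : ℝ} (hl : 0 < l) :
    Af n (fun r => m * f (l * r)) = m^2 * l^(2-n) * Af n f := by
  have h := integral_comp_mul_left_Ioi (fun r => r^(n-1) * (deriv f r)^2) 0 hl
  rw [mul_zero, smul_eq_mul] at h
  rw [Af, Af]
  have hd : ∀ r, deriv (fun r => m * f (l * r)) r = m * (l * deriv f (l*r)) := by
    intro r
    rw [deriv_const_mul_field, deriv_comp_mul_left, smul_eq_mul]
  calc _ = ∫ r in Ioi 0, (m^2 * l^2 * l^(-(n-1))) * ((l*r)^(n-1) * (deriv f (l*r))^2) := by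
        apply setIntegral_congr_fun measurableSet_Ioi
        intro r hr
        have hr : 0 < r := hr
        simp only []
        rw [hd, Real.mul_rpow hl.le hr.le, Real.rpow_neg hl.le]
        have := Real.rpow_pos_of_pos hl (n-1)
        field_simp
    _ = _ := by
        rw [integral_const_mul, h]
        have : l^(2-n) = l^2 * l^(-(n-1)) * l⁻¹ := by
          rw [← Real.rpow_neg_one l, ← Real.rpow_two, ← Real.rpow_add hl, ← Real.rpow_add hl]; ring_nf
        rw [this]; ring

lemma Dec.scale {f : ℝ → ℝ} (hf : Dec f) {l m : ℝ} (hl : 0 < l) (hm : 0 < m) : Dec (fun r => m * f (l*r)) := by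
  obtain ⟨⟨⟨L, hL⟩, R, hR, h⟩, h0, ha⟩ := hf
  refine ⟨⟨⟨_, (lipschitzWith_smul m).comp (hL.comp (lipschitzWith_smul l))⟩, R/l, by positivity, ?_⟩, ?_, ?_⟩
  · intro r hr
    have : R ≤ l*r := by rw [div_le_iff₀ hl] at hr; linarith
    simp [h _ this]
  · exact fun r => mul_nonneg hm.le (h0 _)
  · intro x hx y hy hxy
    have hx : 0 < x := hx
    have hy : 0 < y := hy
    exact mul_le_mul_of_nonneg_left (ha (mul_pos hl hx) (mul_pos hl hy) (by gcongr)) hm.le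

lemma scale_unit {n : ℝ} {f : ℝ → ℝ} (hf : Dec f) {a m : ℝ} (ha : 0 < a) (hm : 0 < m)
    (hA : Af n f ≤ a) (hP : Pf n 2 f ≤ m) :
    ∃ g, Unit1 n g ∧ ∀ s, Pf n s g = (m/a)^(n*(s-2)/4) * m^(-(s/2)) * Pf n s f := by
  set t := m/a with ht
  have ht0 : 0 < t := by positivity
  set l := t^(1/2:ℝ) with hl
  have hl0 : 0 < l := by positivity
  set μ := t^(n/4) * m^(-(1/2:ℝ)) with hμ
  have hμ0 : 0 < μ := by positivity
  have e1 : ∀ s, μ^s * l^(-n) = t^(n*(s-2)/4) * m^(-(s/2)) := by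
    intro s
    rw [hμ, hl, Real.mul_rpow (by positivity) (by positivity), ← Real.rpow_mul ht0.le, ← Real.rpow_mul hm.le,
      ← Real.rpow_mul ht0.le, mul_right_comm, ← Real.rpow_add ht0]
    ring_nf
  have e2 : μ^2 * l^(2-n) = a⁻¹ := by
    have h1 := e1 2
    rw [sub_self, mul_zero, zero_div, Real.rpow_zero, one_mul, Real.rpow_two] at h1
    have h2 : l^(2-n) = l^(-n) * t := by
      rw [hl, ← Real.rpow_mul ht0.le, ← Real.rpow_mul ht0.le]
      nth_rewrite 3 [← Real.rpow_one t]
      rw [← Real.rpow_add ht0]; ring_nf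
    rw [h2, ← mul_assoc, h1, ht, div_self two_ne_zero, Real.rpow_neg_one]
    field_simp
  refine ⟨fun r => μ * f (l*r), ⟨hf.scale hl0 hμ0, ?_, ?_⟩, fun s => ?_⟩
  · rw [Af_scale hl0, e2, inv_mul_le_iff₀ ha]; linarith
  · rw [Pf_scale hl0 hμ0, e1, sub_self, mul_zero, zero_div, Real.rpow_zero, one_mul, div_self two_ne_zero,
      Real.rpow_neg_one, inv_mul_le_iff₀ hm]; linarith
  · rw [Pf_scale hl0 hμ0, e1]

/-- best constant -/
def SS (n : ℝ) : ℝ := sSup {b | ∃ f, Unit1 n f ∧ b = Pf n (qq n) f}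

lemma Unit1_zero (n : ℝ) : Unit1 n (fun _ => 0) := by
  refine ⟨⟨⟨⟨0, LipschitzWith.const 0⟩, 1, one_pos, fun _ _ => rfl⟩, fun _ => le_rfl, fun _ _ _ _ _ => le_rfl⟩, ?_, ?_⟩
  · simp [Af]
  · simp [Pf]

lemma SS_bdd {n : ℝ} (hn : 1 ≤ n) : BddAbove {b | ∃ f, Unit1 n f ∧ b = Pf n (qq n) f} :=
  ⟨_, fun _ ⟨_, hf, e⟩ => e ▸ B_le hn hf⟩

lemma le_SS {n : ℝ} (hn : 1 ≤ n) {f : ℝ → ℝ} (hf : Unit1 n f) : Pf n (qq n) f ≤ SS n :=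
  le_csSup (SS_bdd hn) ⟨f, hf, rfl⟩

lemma GNdec {n : ℝ} (hn : 1 ≤ n) {f : ℝ → ℝ} (hf : Dec f) {a m : ℝ} (ha : 0 < a) (hm : 0 < m)
    (hA : Af n f ≤ a) (hP : Pf n 2 f ≤ m) : Pf n (qq n) f ≤ SS n * a * m^(2/n) := by
  obtain ⟨g, hg, h⟩ := scale_unit hf ha hm hA hP
  have h1 := le_SS hn hg
  rw [h] at h1
  have e : n*(qq n-2)/4 = 1 := by rw [qq]; field_simp; ring
  have e2 : -(qq n/2) = -1 + -(2/n) := by rw [qq]; ring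
  rw [e, e2, Real.rpow_one, Real.rpow_add hm, Real.rpow_neg_one, Real.rpow_neg hm.le] at h1
  have := Real.rpow_pos_of_pos hm (2/n)
  have h2 : m/a*(m⁻¹*(m^(2/n))⁻¹)*Pf n (qq n) f = Pf n (qq n) f/(a*m^(2/n)) := by field_simp
  rw [h2, div_le_iff₀ (by positivity)] at h1
  linarith

lemma exists_Dec_pos {n : ℝ} (hn : 1 ≤ n) : ∃ f, Dec f ∧ 0 < Pf n (qq n) f := by
  have hD : Dec (fun r => max 0 (2 - r)) := by
    refine ⟨⟨⟨_, (LipschitzWith.const' (0:ℝ) (K := 0) |>.max ((LipschitzWith.const' (2:ℝ) (K := 0)).sub LipschitzWith.id))⟩, 2, two_pos, ?_⟩, ?_, ?_⟩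
    · intro r hr; exact max_eq_left (by linarith)
    · intro r; exact le_max_left _ _
    · intro x _ y _ hxy; exact max_le_max le_rfl (by linarith)
  refine ⟨_, hD, ?_⟩
  have h := dec_bound hn (s := qq n) (by linarith [qq_gt hn]) hD one_pos
  norm_num at h
  nlinarith

lemma SS_pos {n : ℝ} (hn : 1 ≤ n) : 0 < SS n := by
  obtain ⟨f, hf, hp⟩ := exists_Dec_pos hn
  have h := GNdec hn hf (a := Af n f + 1) (m := Pf n 2 f + 1) (by linarith [Af_nonneg n f])
    (by linarith [Pf_nonneg n 2 f]) (by linarith) (by linarith)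
  by_contra hc
  push Not at hc
  have h1 := Real.rpow_nonneg (by linarith [Pf_nonneg n 2 f] : 0 ≤ Pf n 2 f + 1) (2/n)
  have h2 : SS n * (Af n f + 1) ≤ 0 := mul_nonpos_of_nonpos_of_nonneg hc (by linarith [Af_nonneg n f])
  have := mul_nonpos_of_nonpos_of_nonneg h2 h1
  linarith

lemma max_seq {n : ℝ} (hn : 1 ≤ n) : ∃ f : ℕ → ℝ → ℝ, (∀ k, Unit1 n (f k)) ∧
    Tendsto (fun k => Pf n (qq n) (f k)) atTop (𝓝 (SS n)) := by
  obtain ⟨b, _, hb, hm⟩ := exists_seq_tendsto_sSup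
    (S := {b | ∃ f, Unit1 n f ∧ b = Pf n (qq n) f}) ⟨_, _, Unit1_zero n, rfl⟩ (SS_bdd hn)
  choose f hf he using hm
  exact ⟨f, hf, by rw [← funext he]; exact hb⟩
end CM

namespace CM
open Set Topology Asymptotics

lemma hold {n : ℝ} (hn : 1 ≤ n) {f : ℝ → ℝ} (hf : Unit1 n f) {d r s : ℝ} (hd : 0 < d) (hr : d ≤ r) (hs : d ≤ s) :
    |f r - f s| ≤ √|r - s| * ((1 + d^(1-n))/2) := by
  wlog hrs : r ≤ s generalizing r s
  · rw [abs_sub_comm, abs_sub_comm r s]; exact this hs hr (le_of_not_ge hrs)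
  rcases hrs.eq_or_lt with h | h
  · subst h; simp
  have hr0 : 0 < r := by linarith
  have hl : 0 < √(s-r) := Real.sqrt_pos.2 (by linarith)
  have h1 := diff_bound hn hf.1.1 hr0 hrs hl
  have hI : ∫ x in r..s, x^(1-n) ≤ (s-r) * d^(1-n) := by
    have hnot : (0:ℝ) ∉ uIcc r s := by rw [uIcc_of_le hrs]; simp [hr0]
    have := intervalIntegral.integral_mono_on hrs (intervalIntegral.intervalIntegrable_rpow (Or.inr hnot))
      (intervalIntegrable_const (μ := volume) (c := d^(1-n))) (fun x hx =>
        Real.rpow_le_rpow_of_nonpos hd (hr.trans hx.1) (by linarith : 1-n ≤ 0))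
    simpa using this
  have h2 : (√(s-r))⁻¹ * ∫ x in r..s, x^(1-n) ≤ √(s-r) * d^(1-n) := by
    calc _ ≤ (√(s-r))⁻¹ * ((s-r) * d^(1-n)) := by gcongr
      _ = (√(s-r))⁻¹ * ((√(s-r)*√(s-r)) * d^(1-n)) := by rw [Real.mul_self_sqrt (by linarith)]
      _ = _ := by field_simp
  have h3 : √(s-r) * Af n f ≤ √(s-r) := by nlinarith [hf.2.1]
  rw [abs_sub_comm r s, abs_of_pos (by linarith : 0 < s - r)]
  linarith

lemma small_hold {n : ℝ} {d e : ℝ} (hd : 0 < d) (he : 0 < e) : ∃ η > 0, ∀ t, |t| < η → √|t| * ((1 + d^(1-n))/2) < e := by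
  have hw := Real.rpow_pos_of_pos hd (1-n)
  have hc : Continuous fun t : ℝ => √|t| * ((1 + d^(1-n))/2) := by fun_prop
  have := hc.tendsto 0
  simp only [abs_zero, Real.sqrt_zero, zero_mul] at this
  obtain ⟨η, hη, h⟩ := Metric.eventually_nhds_iff.1 (this.eventually (gt_mem_nhds he))
  exact ⟨η, hη, fun t ht => h (by simpa using ht)⟩

lemma compact_seq {n : ℝ} (hn : 1 ≤ n) {f : ℕ → ℝ → ℝ} (hf : ∀ k, Unit1 n (f k)) :
    ∃ φ : ℕ → ℕ, StrictMono φ ∧ ∃ g : ℝ → ℝ, ContinuousOn g (Ioi 0) ∧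
      ∀ r, 0 < r → Tendsto (fun k => f (φ k) r) atTop (𝓝 (g r)) := by
  let ι := {x : ℚ // 0 < x}
  have hK : IsCompact (Set.pi univ fun x : ι => Icc (0:ℝ) (env n (x.1:ℝ))) :=
    isCompact_univ_pi fun x => isCompact_Icc
  obtain ⟨y, -, φ, hφ, hy⟩ := hK.tendsto_subseq (x := fun k (x : ι) => f k (x.1:ℝ)) (fun k x _ =>
    ⟨(hf k).1.2.1 _, env_bound hn (hf k) (by exact_mod_cast x.2)⟩)
  have hy' : ∀ x : ι, Tendsto (fun k => f (φ k) (x.1:ℝ)) atTop (𝓝 (y x)) := fun x => (tendsto_pi_nhds.1 hy) x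
  have hlim : ∀ r, 0 < r → ∃ l, Tendsto (fun k => f (φ k) r) atTop (𝓝 l) := by
    intro r hr
    apply cauchySeq_tendsto_of_complete
    rw [Metric.cauchySeq_iff]
    intro e he
    obtain ⟨η, hη, h⟩ := small_hold (n := n) hr (by positivity : 0 < e/3)
    obtain ⟨x, hx1, hx2⟩ := exists_rat_btwn (lt_add_of_pos_right r hη)
    have hx0 : 0 < x := by exact_mod_cast hr.trans hx1
    obtain ⟨K, hKK⟩ := Metric.cauchySeq_iff.1 (hy' ⟨x, hx0⟩).cauchySeq (e/3) (by positivity)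
    refine ⟨K, fun k hk l hl => ?_⟩
    have h1 := hKK k hk l hl
    have hb := fun k => (hold hn (hf (φ k)) hr le_rfl hx1.le).trans_lt (h (r - x) (by rw [abs_sub_comm, abs_of_pos (by linarith)]; linarith))
    have h2 := hb k
    have h3 := hb l
    rw [Real.dist_eq] at h1 ⊢
    rw [abs_lt] at h1 h2 h3 ⊢
    constructor <;> linarith [h1.1, h1.2, h2.1, h2.2, h3.1, h3.2]
  choose! g hg using hlim
  refine ⟨φ, hφ, g, ?_, hg⟩
  intro r hr
  have hr : 0 < r := hr
  apply ContinuousAt.continuousWithinAt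
  rw [Metric.continuousAt_iff]
  intro e he
  obtain ⟨η, hη, h⟩ := small_hold (n := n) (half_pos hr) (half_pos he)
  refine ⟨min η (r/2), by positivity, fun {x} hx => ?_⟩
  rw [Real.dist_eq] at hx ⊢
  have hx2 := hx.trans_le (min_le_right _ _)
  have hxr : r/2 ≤ x := by rw [abs_lt] at hx2; linarith [hx2.1]
  have h1 := ((hg x (by linarith)).sub (hg r hr)).abs
  have : |g x - g r| ≤ e/2 := le_of_tendsto h1 (Eventually.of_forall fun k =>
    (hold hn (hf (φ k)) (half_pos hr) hxr (by linarith)).trans (h _ (hx.trans_le (min_le_left _ _))).le)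
  linarith
end CM

namespace CM
open Set Topology Asymptotics

def tin (n a b : ℝ) : ℝ → ℝ := (Ioc a b).indicator (fun x => x^(1-n))
/-- test function -/
def tst (n a b s : ℝ) : ℝ := ∫ x in s..b, tin n a b x

lemma tin_meas (n a b : ℝ) : Measurable (tin n a b) :=
  (by fun_prop : Measurable fun x : ℝ => x^(1-n)).indicator measurableSet_Ioc

lemma tin_bdd {n a b : ℝ} (hn : 1 ≤ n) (ha : 0 < a) (x : ℝ) : 0 ≤ tin n a b x ∧ tin n a b x ≤ a^(1-n) := by
  rw [tin, indicator_apply]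
  split_ifs with h
  · have : 0 < x := ha.trans h.1
    exact ⟨by positivity, Real.rpow_le_rpow_of_nonpos ha h.1.le (by linarith)⟩
  · exact ⟨le_rfl, by positivity⟩

lemma tin_int {n a b : ℝ} (hn : 1 ≤ n) (ha : 0 < a) (c d : ℝ) : IntervalIntegrable (tin n a b) volume c d := by
  apply IntervalIntegrable.mono_fun' (intervalIntegrable_const (c := a^(1-n))) (tin_meas n a b).aestronglyMeasurable
  filter_upwards with x
  rw [Real.norm_eq_abs, abs_of_nonneg (tin_bdd hn ha x).1]
  exact (tin_bdd hn ha x).2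

lemma tst_sub {n a b : ℝ} (hn : 1 ≤ n) (ha : 0 < a) (s t : ℝ) : tst n a b s - tst n a b t = ∫ x in s..t, tin n a b x := by
  have := intervalIntegral.integral_add_adjacent_intervals (tin_int (b := b) hn ha s t) (tin_int (b := b) hn ha t b)
  rw [tst, tst, ← this]; ring

lemma tst_zero {n a b : ℝ} {s : ℝ} (h : b ≤ s) : tst n a b s = 0 := by
  rw [tst, intervalIntegral.integral_symm, neg_eq_zero]
  apply intervalIntegral.integral_zero_ae
  filter_upwards with x hx
  rw [uIoc_of_le h] at hx
  exact indicator_of_notMem (fun h' => by linarith [h'.2, hx.1]) _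

lemma tst_const {n a b : ℝ} (hn : 1 ≤ n) (ha : 0 < a) {s : ℝ} (h : s ≤ a) : tst n a b s = tst n a b a := by
  rw [← sub_eq_zero, tst_sub hn ha]
  apply intervalIntegral.integral_zero_ae
  filter_upwards with x hx
  rw [uIoc_of_le h] at hx
  exact indicator_of_notMem (fun h' => by linarith [h'.1, hx.2]) _

lemma tst_eq {n a b s : ℝ} (h1 : a ≤ s) (h2 : s ≤ b) : tst n a b s = ∫ x in s..b, x^(1-n) := by
  apply intervalIntegral.integral_congr_ae
  filter_upwards with x hx
  rw [uIoc_of_le h2] at hx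
  exact indicator_of_mem (show x ∈ Ioc a b from ⟨h1.trans_lt hx.1, hx.2⟩) _

lemma tst_prof {n a b : ℝ} (hn : 1 ≤ n) (ha : 0 < a) (hab : a < b) : Prof (tst n a b) := by
  refine ⟨⟨⟨a^(1-n), by positivity⟩, LipschitzWith.of_dist_le_mul fun s t => ?_⟩, b, ha.trans hab, fun r hr => tst_zero hr⟩
  rw [Real.dist_eq, tst_sub hn ha, dist_comm, Real.dist_eq]
  exact intervalIntegral.norm_integral_le_of_norm_le_const (a := s) (b := t) (f := tin n a b) (C := a^(1-n))
    (fun x _ => by rw [Real.norm_eq_abs, abs_of_nonneg (tin_bdd hn ha x).1]; exact (tin_bdd hn ha x).2)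

lemma tst_bdd {n a b : ℝ} (hn : 1 ≤ n) (ha : 0 < a) (hab : a < b) (s : ℝ) : |tst n a b s| ≤ a^(1-n) * b := by
  have hb : 0 < b := ha.trans hab
  rcases le_or_gt b s with h | h
  · rw [tst_zero h, abs_zero]; positivity
  · have key : ∀ s, a ≤ s → s ≤ b → |tst n a b s| ≤ a^(1-n) * b := by
      intro s h1 h2
      have := intervalIntegral.norm_integral_le_of_norm_le_const (a := s) (b := b) (f := tin n a b) (C := a^(1-n))
        (fun x _ => by rw [Real.norm_eq_abs, abs_of_nonneg (tin_bdd hn ha x).1]; exact (tin_bdd hn ha x).2)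
      refine this.trans ?_
      rw [abs_of_nonneg (by linarith)]
      gcongr; linarith
    rcases le_or_gt s a with h' | h'
    · rw [tst_const hn ha h']; exact key a le_rfl hab.le
    · exact key s h'.le h.le

lemma tst_deriv {n a b : ℝ} (hn : 1 ≤ n) (ha : 0 < a) : ∀ᵐ s, deriv (tst n a b) s = - tin n a b s := by
  have hfin : ∀ᵐ s : ℝ, s ∉ ({a, b} : Set ℝ) := by
    have : volume ({a, b} : Set ℝ) = 0 := (Set.toFinite _).measure_zero _
    exact measure_eq_zero_iff_ae_notMem.1 this
  filter_upwards [hfin] with s hs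
  simp only [mem_insert_iff, mem_singleton_iff, not_or] at hs
  have hc : ContinuousAt (tin n a b) s := by
    rcases lt_or_gt_of_ne hs.1 with h | h
    · have : tin n a b =ᶠ[𝓝 s] fun _ => 0 := by
        filter_upwards [gt_mem_nhds h] with x hx
        exact indicator_of_notMem (fun h' => by linarith [h'.1]) _
      exact continuousAt_const.congr this.symm
    rcases lt_or_gt_of_ne hs.2 with h2 | h2
    · have : tin n a b =ᶠ[𝓝 s] fun x => x^(1-n) := by
        filter_upwards [lt_mem_nhds h, gt_mem_nhds h2] with x hx hx2
        exact indicator_of_mem (show x ∈ Ioc a b from ⟨hx, hx2.le⟩) _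
      exact (Real.continuousAt_rpow_const _ _ (Or.inl (by linarith))).congr this.symm
    · have : tin n a b =ᶠ[𝓝 s] fun _ => 0 := by
        filter_upwards [lt_mem_nhds h2] with x hx
        exact indicator_of_notMem (fun h' => by linarith [h'.2]) _
      exact continuousAt_const.congr this.symm
  exact (intervalIntegral.integral_hasDerivAt_left (tin_int hn ha s b)
    ((tin_meas n a b).stronglyMeasurable.stronglyMeasurableAtFilter) hc).deriv

lemma tst_pair {n a b : ℝ} (hn : 1 ≤ n) (ha : 0 < a) (hab : a < b) {f : ℝ → ℝ} (hf : Prof f) :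
    ∫ s in Ioi 0, s^(n-1) * (deriv f s * deriv (tst n a b) s) = f a - f b := by
  have h1 : ∫ s in Ioi 0, s^(n-1) * (deriv f s * deriv (tst n a b) s) =
      ∫ s in Ioi 0, (Ioc a b).indicator (fun s => - deriv f s) s := by
    apply setIntegral_congr_ae measurableSet_Ioi
    filter_upwards [tst_deriv (b := b) hn ha] with s hs hs0
    have hs0 : 0 < s := hs0
    rw [hs, tin, indicator_apply, indicator_apply]
    split_ifs with h
    · have : s^(1-n) = (s^(n-1))⁻¹ := by rw [← Real.rpow_neg hs0.le]; ring_nf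
      rw [this]
      have := Real.rpow_pos_of_pos hs0 (n-1)
      field_simp
    · simp
  rw [h1, setIntegral_indicator measurableSet_Ioc, inter_eq_self_of_subset_right, ← intervalIntegral.integral_of_le hab.le,
    intervalIntegral.integral_neg, (hf.ftc a b).2]
  · ring
  · exact fun x hx => ha.trans hx.1

lemma Af_expand {n : ℝ} (hn : 1 ≤ n) {f g : ℝ → ℝ} (hf : Prof f) (hg : Prof g) (t : ℝ) :
    Af n (fun r => f r + t * g r) = Af n f + 2*t*(∫ s in Ioi 0, s^(n-1) * (deriv f s * deriv g s)) + t^2 * Af n g := by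
  have h2 : IntegrableOn (fun s => s^(n-1) * (deriv f s)^2 + 2*t*(s^(n-1) * (deriv f s * deriv g s))) (Ioi 0) :=
    (hf.intA hn).add ((hf.intAA hn hg).const_mul _)
  rw [Af, Af, Af, ← integral_const_mul, ← integral_const_mul, ← integral_add (hf.intA hn)
    ((hf.intAA hn hg).const_mul _), ← integral_add h2 ((hg.intA hn).const_mul _)]
  apply setIntegral_congr_ae measurableSet_Ioi
  filter_upwards [hf.ae_diff, hg.ae_diff] with s h1 h2 _
  have : deriv (fun r => f r + t * g r) s = deriv f s + t * deriv g s :=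
    (h1.hasDerivAt.add (h2.hasDerivAt.const_mul t)).deriv
  rw [this]; ring

lemma intPP {n : ℝ} (hn : 1 ≤ n) {f g : ℝ → ℝ} (hf : Prof f) (hg : Prof g) {e : ℝ} (he : 0 ≤ e) :
    IntegrableOn (fun s => s^(n-1) * (|f s|^e * g s)) (Ioi 0) := by
  obtain ⟨M, hM⟩ := hf.bdd
  obtain ⟨M', hM'⟩ := hg.bdd
  obtain ⟨R, hR, h⟩ := hg.2
  have := hf.cont.measurable
  have := hg.cont.measurable
  apply intW hn (by fun_prop) (M := M^e * M') (R := R)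
  · intro r hr
    rw [abs_mul, abs_of_nonneg (by positivity)]
    have := hM r hr
    have := hM' r hr
    have : 0 ≤ M := (abs_nonneg _).trans (hM r hr)
    gcongr
  · intro r hr
    rw [h r hr.le]; simp

lemma P2_expand {n : ℝ} (hn : 1 ≤ n) {f g : ℝ → ℝ} (hf : Prof f) (hf0 : ∀ r, 0 ≤ f r) (hg : Prof g) (t : ℝ) :
    Pf n 2 (fun r => f r + t * g r) = Pf n 2 f + 2*t*(∫ s in Ioi 0, s^(n-1) * (|f s|^(1:ℝ) * g s)) + t^2 * Pf n 2 g := by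
  have hi := (intPP hn hf hg zero_le_one)
  have h2 : IntegrableOn (fun s => s^(n-1) * |f s|^(2:ℝ) + 2*t*(s^(n-1) * (|f s|^(1:ℝ) * g s))) (Ioi 0) :=
    (hf.intP hn two_pos).add (hi.const_mul _)
  rw [Pf, Pf, Pf, ← integral_const_mul, ← integral_const_mul, ← integral_add (hf.intP hn two_pos)
    (hi.const_mul _), ← integral_add h2 ((hg.intP hn two_pos).const_mul _)]
  apply setIntegral_congr_fun measurableSet_Ioi
  intro s _
  simp only [Real.rpow_two, sq_abs, Real.rpow_one, abs_of_nonneg (hf0 s)]; ring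

lemma cvx {q x y : ℝ} (hq : 1 < q) (hx : 0 ≤ x) : x^q + q * (x^(q-1) * y) ≤ |x+y|^q := by
  rcases hx.eq_or_lt with h | h
  · subst h
    rw [Real.zero_rpow (by linarith), Real.zero_rpow (by linarith)]
    simp; positivity
  have hxq : x^q = x^(q-1) * x := by
    nth_rewrite 3 [← Real.rpow_one x]
    rw [← Real.rpow_add h]; ring_nf
  have hw := Real.rpow_pos_of_pos h (q-1)
  rcases le_or_gt (-1) (y/x) with h1 | h1
  · have h2 := one_add_mul_self_le_rpow_one_add h1 hq.le
    have h3 : 0 ≤ 1 + y/x := by linarith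
    have e : x + y = x * (1 + y/x) := by field_simp
    rw [e, abs_of_nonneg (by positivity), Real.mul_rpow hx h3]
    calc _ = x^q * (1 + q*(y/x)) := by rw [hxq]; field_simp
      _ ≤ _ := by gcongr
  · rw [div_lt_iff₀ h] at h1
    have : x^q + q * (x^(q-1) * y) ≤ 0 := by
      rw [hxq]
      have : x + q * y ≤ 0 := by nlinarith
      nlinarith
    exact this.trans (by positivity)

lemma Pq_lower {n q : ℝ} (hn : 1 ≤ n) (hq : 1 < q) {f g : ℝ → ℝ} (hf : Prof f) (hf0 : ∀ r, 0 ≤ f r) (hg : Prof g) (t : ℝ) :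
    Pf n q f + q*t*(∫ s in Ioi 0, s^(n-1) * (|f s|^(q-1) * g s)) ≤ Pf n q (fun r => f r + t * g r) := by
  have hi := (intPP hn hf hg (by linarith : 0 ≤ q-1))
  rw [Pf, Pf, ← integral_const_mul, ← integral_add (hf.intP hn (by linarith)) (hi.const_mul _)]
  apply setIntegral_mono_on ((hf.intP hn (by linarith)).add (hi.const_mul _))
    ((hf.add_smul hg t).intP hn (by linarith)) measurableSet_Ioi
  intro s hs
  have hs : 0 < s := hs
  have := cvx (x := f s) (y := t * g s) hq (hf0 s)
  have hw := Real.rpow_pos_of_pos hs (n-1)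
  show s^(n-1) * |f s|^q + q*t*(s^(n-1) * (|f s|^(q-1) * g s)) ≤ s^(n-1) * |f s + t * g s|^q
  rw [abs_of_nonneg (hf0 s)]
  calc _ = s^(n-1) * (f s^q + q * (f s^(q-1) * (t * g s))) := by ring
    _ ≤ _ := by gcongr

lemma pair_conv {n : ℝ} (hn : 1 ≤ n) {f : ℕ → ℝ → ℝ} (hf : ∀ k, Unit1 n (f k)) {g : ℝ → ℝ}
    (hg : ∀ r, 0 < r → Tendsto (fun k => f k r) atTop (𝓝 (g r))) {e : ℝ} (he : 0 ≤ e) (he' : e ≤ qq n)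
    {a b : ℝ} (ha : 0 < a) (hab : a < b) :
    Tendsto (fun k => ∫ s in Ioi 0, s^(n-1) * (|f k s|^e * tst n a b s)) atTop
      (𝓝 (∫ s in Ioi 0, s^(n-1) * (|g s|^e * tst n a b s))) := by
  have hM := tst_bdd hn ha hab
  set M := a^(1-n) * b
  have hb : 0 < b := ha.trans hab
  have hM0 : 0 ≤ M := by positivity
  apply tendsto_integral_of_dominated_convergence (fun r => M * (r^(n-1) * (Iic b).indicator 1 r + r^(n-1) * env n r^qq n))
  · intro k; exact (intPP hn (hf k).1.1 (tst_prof hn ha hab) he).aestronglyMeasurable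
  · refine (Integrable.add (intW hn (measurable_one.indicator measurableSet_Iic) (M := 1) (R := b) ?_ ?_) (env_int hn)).const_mul _
    · intro r _
      rw [indicator_apply]; split_ifs <;> simp
    · intro r hr
      exact indicator_of_notMem (by simpa using hr) _
  · intro k
    rw [ae_restrict_iff' measurableSet_Ioi]
    filter_upwards with r hr
    have hr : 0 < r := hr
    have hw := Real.rpow_pos_of_pos hr (n-1)
    have h0 := (hf k).1.2.1 r
    have hE := env_pos hn hr
    have h1 := env_bound hn (hf k) hr
    rcases le_or_gt r b with h | h
    · have h2 : |f k r|^e ≤ 1 + env n r^qq n := by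
        rw [abs_of_nonneg h0]
        rcases le_or_gt (f k r) 1 with h3 | h3
        · have := Real.rpow_le_one h0 h3 he
          have : 0 ≤ env n r^qq n := by positivity
          linarith
        · have h4 := Real.rpow_le_rpow_of_exponent_le h3.le he'
          have h5 := Real.rpow_le_rpow h0 h1 (by linarith [qq_gt hn] : 0 ≤ qq n)
          linarith
      rw [indicator_of_mem (show r ∈ Iic b from h), norm_mul, norm_mul, Real.norm_eq_abs, Real.norm_eq_abs, Real.norm_eq_abs,
        abs_of_pos hw, abs_of_nonneg (by positivity), Pi.one_apply]
      calc _ ≤ r^(n-1) * ((1 + env n r^qq n) * M) := by gcongr; exact hM r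
        _ = _ := by ring
    · rw [tst_zero h.le, mul_zero, mul_zero, norm_zero]
      have : (0:ℝ) ≤ (Iic b).indicator 1 r := indicator_nonneg (fun _ _ => zero_le_one) _
      positivity
  · rw [ae_restrict_iff' measurableSet_Ioi]
    filter_upwards with r hr
    exact (((hg r hr).abs.rpow_const (Or.inr he)).mul_const _).const_mul _
end CM

namespace CM
open Set Topology Asymptotics

def GNall (n : ℝ) : Prop := ∀ F a m, Prof F → 0 < a → 0 < m → Af n F ≤ a → Pf n 2 F ≤ m →
  Pf n (qq n) F ≤ SS n * a * m^(2/n)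

lemma EL {n : ℝ} (hn : 1 ≤ n) (hGN : GNall n) {f : ℕ → ℝ → ℝ} (hf : ∀ k, Unit1 n (f k)) {g : ℝ → ℝ}
    (hg : ∀ r, 0 < r → Tendsto (fun k => f k r) atTop (𝓝 (g r)))
    (hS : Tendsto (fun k => Pf n (qq n) (f k)) atTop (𝓝 (SS n))) {a b : ℝ} (ha : 0 < a) (hab : a < b) :
    SS n * (2 * (g a - g b) + (4/n) * ∫ s in Ioi 0, s^(n-1) * (|g s|^(1:ℝ) * tst n a b s)) =
      qq n * ∫ s in Ioi 0, s^(n-1) * (|g s|^(qq n - 1) * tst n a b s) := by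
  have hq := qq_gt hn
  have hb := ha.trans hab
  have hp := tst_prof hn ha hab
  have hβ := pair_conv hn hf hg (e := 1) zero_le_one (by linarith) ha hab
  have hγ := pair_conv hn hf hg (e := qq n - 1) (by linarith) (by linarith) ha hab
  have hα := (hg a ha).sub (hg b hb)
  set A := Af n (tst n a b) + 1 with hA
  set M := Pf n 2 (tst n a b) + 1 with hM
  set β := ∫ s in Ioi 0, s^(n-1) * (|g s|^(1:ℝ) * tst n a b s) with hβd
  set γ := ∫ s in Ioi 0, s^(n-1) * (|g s|^(qq n - 1) * tst n a b s) with hγd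
  set α := g a - g b with hαd
  have main : ∀ t : ℝ, t ≠ 0 → SS n + qq n * t * γ ≤ SS n * (1 + 2*t*α + t^2*A) * (1 + 2*t*β + t^2*M)^(2/n) := by
    intro t ht
    have ht2 : 0 < t^2 := by positivity
    refine le_of_tendsto_of_tendsto' (hS.add (hγ.const_mul (qq n * t)))
      ((((tendsto_const_nhds (x := (1:ℝ))).add (hα.const_mul (2*t))).add (tendsto_const_nhds (x := t^2*A))).const_mul (SS n) |>.mul
       ((((tendsto_const_nhds (x := (1:ℝ))).add (hβ.const_mul (2*t))).add (tendsto_const_nhds (x := t^2*M))).rpow_const (p := 2/n) (Or.inr (by positivity)))) ?_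
    intro k
    have h1 := Pq_lower hn (by linarith : 1 < qq n) (hf k).1.1 (hf k).1.2.1 hp t
    have h2 := Af_expand hn (hf k).1.1 hp t
    rw [tst_pair hn ha hab (hf k).1.1] at h2
    have h3 := P2_expand hn (hf k).1.1 (hf k).1.2.1 hp t
    have h4 := Af_nonneg n (fun r => f k r + t * tst n a b r)
    have h5 := Pf_nonneg n 2 (fun r => f k r + t * tst n a b r)
    have h6 := (hf k).2.1
    have h7 := (hf k).2.2
    refine h1.trans (hGN _ _ _ ((hf k).1.1.add_smul hp t) ?_ ?_ ?_ ?_)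
    · rw [hA]; linarith
    · rw [hM]; linarith
    · rw [hA]; linarith
    · rw [hM]; linarith
  let ψ : ℝ → ℝ := fun t => SS n * (1 + 2*t*α + t^2*A) * (1 + 2*t*β + t^2*M)^(2/n) - (SS n + qq n * t * γ)
  have hmin : IsLocalMin ψ 0 := by
    apply Eventually.of_forall
    intro t
    by_cases ht : t = 0
    · rw [ht]
    · have := main t ht
      simp only [ψ]
      simp
      linarith
  have hd1 : HasDerivAt (fun t : ℝ => 1 + 2*t*α + t^2*A) (2*α) 0 := by
    have := (((hasDerivAt_id (0:ℝ)).const_mul 2).mul_const α).const_add 1 |>.add ((hasDerivAt_pow 2 (0:ℝ)).mul_const A)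
    refine this.congr_deriv ?_
    simp
  have hd2 : HasDerivAt (fun t : ℝ => 1 + 2*t*β + t^2*M) (2*β) 0 := by
    have := (((hasDerivAt_id (0:ℝ)).const_mul 2).mul_const β).const_add 1 |>.add ((hasDerivAt_pow 2 (0:ℝ)).mul_const M)
    refine this.congr_deriv ?_
    simp
  have hd3 := hd2.rpow_const (p := 2/n) (Or.inl (by simp))
  have hd4 : HasDerivAt (fun t : ℝ => SS n + qq n * t * γ) (qq n * γ) 0 := by
    have := (((hasDerivAt_id (0:ℝ)).const_mul (qq n)).mul_const γ).const_add (SS n)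
    refine this.congr_deriv ?_
    simp
  have hd : HasDerivAt ψ _ 0 := ((hd1.const_mul (SS n)).mul hd3).sub hd4
  have := hmin.hasDerivAt_eq_zero hd
  simp at this
  rw [← sub_eq_zero, ← this]; ring

/-- Properties of the limit profile -/
structure Lim (n : ℝ) (g : ℝ → ℝ) : Prop where
  nn : ∀ r, 0 < r → 0 ≤ g r
  anti : AntitoneOn g (Ioi 0)
  cont : ContinuousOn g (Ioi 0)
  near : ∀ r, 0 < r → r ≤ 1 → g r ≤ KK n * r^(-bt n)
  far : ∀ r, 0 < r → g r ≤ n * r^(-(n/2))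
  mass : Pf n 2 g ≤ 1
  qn : Pf n (qq n) g = SS n
  el : ∀ a b, 0 < a → a < b → SS n * (2 * (g a - g b) + (4/n) * ∫ s in Ioi 0, s^(n-1) * (|g s|^(1:ℝ) * tst n a b s)) =
      qq n * ∫ s in Ioi 0, s^(n-1) * (|g s|^(qq n - 1) * tst n a b s)

lemma exists_lim {n : ℝ} (hn : 1 ≤ n) (hGN : GNall n) : ∃ g, Lim n g := by
  obtain ⟨f, hf, hS⟩ := max_seq hn
  obtain ⟨φ, hφ, g, hgc, hg⟩ := compact_seq hn hf
  have hS' := hS.comp hφ.tendsto_atTop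
  have hf' : ∀ k, Unit1 n (f (φ k)) := fun k => hf _
  refine ⟨g, fun r hr => ?_, ?_, hgc, fun r hr h1 => ?_, fun r hr => ?_, ?_, ?_, fun a b ha hab => EL hn hGN hf' hg hS' ha hab⟩
  · exact ge_of_tendsto' (hg r hr) fun k => (hf' k).1.2.1 r
  · intro x hx y hy hxy
    exact le_of_tendsto_of_tendsto' (hg y hy) (hg x hx) fun k => (hf' k).1.2.2 hx hy hxy
  · exact le_of_tendsto' (hg r hr) fun k => near_bound hn (hf' k) hr h1
  · exact le_of_tendsto' (hg r hr) fun k => far_bound hn (hf' k).1 (hf' k).2.2 hr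
  · have hwn : ∀ h : ℝ → ℝ, 0 ≤ᵐ[volume.restrict (Ioi 0)] fun r => r^(n-1) * |h r|^(2:ℝ) := by
      intro h
      rw [EventuallyLE, ae_restrict_iff' measurableSet_Ioi]
      filter_upwards with r hr
      have hr : 0 < r := hr
      simp only [Pi.zero_apply]
      positivity
    have hgm : AEStronglyMeasurable (fun r => r^(n-1) * |g r|^(2:ℝ)) (volume.restrict (Ioi 0)) := by
      refine aestronglyMeasurable_of_tendsto_ae atTop (fun k => ((hf' k).1.1.intP hn two_pos).aestronglyMeasurable) ?_
      rw [ae_restrict_iff' measurableSet_Ioi]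
      filter_upwards with r hr
      exact ((hg r hr).abs.rpow_const (Or.inr zero_le_two)).const_mul _
    rw [Pf, integral_eq_lintegral_of_nonneg_ae (hwn g) hgm]
    apply ENNReal.toReal_le_of_le_ofReal zero_le_one
    have hfat := lintegral_liminf_le' (u := atTop) (μ := volume.restrict (Ioi (0:ℝ))) (f := fun k r => ENNReal.ofReal (r^(n-1) * |f (φ k) r|^(2:ℝ)))
      (fun k => ((hf' k).1.1.intP hn two_pos).aestronglyMeasurable.aemeasurable.ennreal_ofReal)
    refine le_trans (le_of_eq ?_) (hfat.trans ?_)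
    · apply setLIntegral_congr_fun measurableSet_Ioi
      intro r hr
      exact (ENNReal.tendsto_ofReal (((hg r hr).abs.rpow_const (Or.inr zero_le_two)).const_mul _)).liminf_eq.symm
    · refine liminf_le_of_frequently_le' (Frequently.of_forall fun k => ?_)
      rw [← ofReal_integral_eq_lintegral_ofReal ((hf' k).1.1.intP hn two_pos) (hwn _)]
      exact ENNReal.ofReal_le_ofReal (hf' k).2.2
  · exact tendsto_nhds_unique (Bconv hn hf' hg) hS'
end CM

namespace CM
open Set Topology Asymptotics

def hh (n : ℝ) (g : ℝ → ℝ) (s : ℝ) : ℝ := qq n/(2*SS n) * |g s|^(qq n - 1) - 2/n * |g s|^(1:ℝ)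
def WW (n : ℝ) (g : ℝ → ℝ) (s : ℝ) : ℝ := s^(n-1) * hh n g s
def HH (n : ℝ) (g : ℝ → ℝ) (r : ℝ) : ℝ := ∫ s in (0:ℝ)..r, WW n g s
def g1 (n : ℝ) (g : ℝ → ℝ) (r : ℝ) : ℝ := - (r^(1-n) * HH n g r)

lemma bt_th {n : ℝ} (hn : 1 ≤ n) {e : ℝ} (he : e ≤ qq n) : bt n * e < n :=
  (mul_le_mul_of_nonneg_left he (bt_pos hn).le).trans_lt (bt_lt hn)

lemma We_int {n : ℝ} (hn : 1 ≤ n) {g : ℝ → ℝ} (L : Lim n g) {e : ℝ} (he : 0 ≤ e) (he' : e ≤ qq n) {b : ℝ} (hb : 0 < b) :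
    IntervalIntegrable (fun s => s^(n-1) * |g s|^e) volume 0 b := by
  have hc : ContinuousOn (fun s => s^(n-1) * |g s|^e) (Ioi 0) := by
    intro s hs
    have hs : 0 < s := hs
    exact ((Real.continuousAt_rpow_const s _ (Or.inl hs.ne')).continuousWithinAt).mul ((L.cont s hs).abs.rpow_const (Or.inr he))
  have h1 : IntervalIntegrable (fun s => s^(n-1) * |g s|^e) volume 0 1 := by
    have hi : IntervalIntegrable (fun s : ℝ => KK n^e * s^(n-1-bt n*e)) volume 0 1 :=
      (intervalIntegral.intervalIntegrable_rpow' (by linarith [bt_th hn he'])).const_mul _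
    rw [intervalIntegrable_iff_integrableOn_Ioc_of_le zero_le_one] at hi ⊢
    refine hi.mono' ((hc.mono fun x hx => hx.1).aestronglyMeasurable measurableSet_Ioc) ?_
    rw [ae_restrict_iff' measurableSet_Ioc]
    filter_upwards with s hs
    have hs0 := hs.1
    have hK := KK_pos hn
    have h0 := L.nn s hs0
    rw [Real.norm_eq_abs, abs_of_nonneg (by positivity), abs_of_nonneg h0]
    calc s^(n-1) * g s^e ≤ s^(n-1) * (KK n * s^(-bt n))^e := by
          gcongr; exact L.near s hs0 hs.2
      _ = KK n^e * (s^(n-1) * s^(-bt n*e)) := by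
          rw [Real.mul_rpow hK.le (by positivity), ← Real.rpow_mul hs0.le]; ring
      _ = _ := by rw [← Real.rpow_add hs0]; ring_nf
  refine h1.trans (ContinuousOn.intervalIntegrable (hc.mono ?_))
  intro x hx
  exact (lt_min one_pos hb).trans_le (by simpa [uIcc] using hx.1)

lemma WW_int {n : ℝ} (hn : 1 ≤ n) {g : ℝ → ℝ} (L : Lim n g) {b : ℝ} (hb : 0 < b) :
    IntervalIntegrable (WW n g) volume 0 b := by
  have hq := qq_gt hn
  have := ((We_int hn L (by linarith : 0 ≤ qq n - 1) (by linarith) hb).const_mul (qq n/(2*SS n))).sub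
    ((We_int hn L zero_le_one (by linarith) hb).const_mul (2/n))
  refine this.congr ?_
  intro s _
  simp only [WW, hh]; ring

lemma hh_cont {n : ℝ} (hn : 1 ≤ n) {g : ℝ → ℝ} (L : Lim n g) {s : ℝ} (hs : 0 < s) : ContinuousAt (hh n g) s := by
  have hc := (L.cont.continuousAt (Ioi_mem_nhds hs)).abs
  have hq := qq_gt hn
  exact ((hc.rpow_const (Or.inr (by linarith))).const_mul _).sub ((hc.rpow_const (Or.inr zero_le_one)).const_mul _)

lemma WW_cont {n : ℝ} (hn : 1 ≤ n) {g : ℝ → ℝ} (L : Lim n g) {s : ℝ} (hs : 0 < s) : ContinuousAt (WW n g) s :=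
  (Real.continuousAt_rpow_const s _ (Or.inl hs.ne')).mul (hh_cont hn L hs)

lemma WW_meas {n : ℝ} (hn : 1 ≤ n) {g : ℝ → ℝ} (L : Lim n g) {s : ℝ} (hs : 0 < s) :
    StronglyMeasurableAtFilter (WW n g) (𝓝 s) := by
  have : ContinuousOn (WW n g) (Ioi 0) := fun x hx => (WW_cont hn L hx).continuousWithinAt
  exact this.stronglyMeasurableAtFilter isOpen_Ioi s hs

lemma el2 {n : ℝ} (hn : 1 ≤ n) {g : ℝ → ℝ} (L : Lim n g) {a b : ℝ} (ha : 0 < a) (hab : a < b) :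
    g a - g b = ∫ s in (0:ℝ)..b, WW n g s * tst n a b s := by
  have hq := qq_gt hn
  have hb := ha.trans hab
  have hS := SS_pos hn
  have hp := tst_prof hn ha hab
  have key : ∀ e : ℝ, ∫ s in Ioi 0, s^(n-1) * (|g s|^e * tst n a b s) = ∫ s in (0:ℝ)..b, (s^(n-1) * |g s|^e) * tst n a b s := by
    intro e
    rw [intervalIntegral.integral_of_le hb.le]
    simp only [← mul_assoc]
    apply setIntegral_eq_of_subset_of_forall_sdiff_eq_zero measurableSet_Ioi Ioc_subset_Ioi_self
    intro x hx
    have : b ≤ x := by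
      by_contra hc
      exact hx.2 ⟨hx.1, (not_le.1 hc).le⟩
    rw [tst_zero this, mul_zero]
  have hel := L.el a b ha hab
  rw [key, key] at hel
  have hi : ∀ e : ℝ, 0 ≤ e → e ≤ qq n → IntervalIntegrable (fun s => (s^(n-1) * |g s|^e) * tst n a b s) volume 0 b :=
    fun e h1 h2 => (We_int hn L h1 h2 hb).mul_continuousOn hp.cont.continuousOn
  have e1 : ∫ s in (0:ℝ)..b, WW n g s * tst n a b s = qq n/(2*SS n) * (∫ s in (0:ℝ)..b, (s^(n-1) * |g s|^(qq n-1)) * tst n a b s)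
      - 2/n * ∫ s in (0:ℝ)..b, (s^(n-1) * |g s|^(1:ℝ)) * tst n a b s := by
    rw [← intervalIntegral.integral_const_mul, ← intervalIntegral.integral_const_mul, ← intervalIntegral.integral_sub]
    · congr 1; ext s; simp only [WW, hh]; ring
    · exact (hi _ (by linarith) (by linarith)).const_mul _
    · exact (hi _ zero_le_one (by linarith)).const_mul _
  rw [e1]
  field_simp
  field_simp at hel
  linarith

lemma g_deriv {n : ℝ} (hn : 1 ≤ n) {g : ℝ → ℝ} (L : Lim n g) {r : ℝ} (hr : 0 < r) : HasDerivAt g (g1 n g r) r := by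
  set b := r + 1 with hb
  have hb0 : 0 < b := by linarith
  let T : ℝ → ℝ := fun s => ∫ x in s..b, x^(1-n)
  have hxi : ∀ s, 0 < s → IntervalIntegrable (fun x : ℝ => x^(1-n)) volume s b := by
    intro s hs
    apply ContinuousOn.intervalIntegrable
    intro x hx
    have : 0 < x := (lt_min hs hb0).trans_le (by simpa [uIcc] using hx.1)
    exact (Real.continuousAt_rpow_const x _ (Or.inl this.ne')).continuousWithinAt
  have hT : ∀ s, 0 < s → HasDerivAt T (-s^(1-n)) s := by
    intro s hs
    have hc : ContinuousAt (fun x : ℝ => x^(1-n)) s := Real.continuousAt_rpow_const s _ (Or.inl hs.ne')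
    exact intervalIntegral.integral_hasDerivAt_left (hxi s hs)
      ((by fun_prop : Measurable fun x : ℝ => x^(1-n)).stronglyMeasurable.stronglyMeasurableAtFilter) hc
  have hH : HasDerivAt (HH n g) (WW n g r) r :=
    intervalIntegral.integral_hasDerivAt_right (WW_int hn L hr) (WW_meas hn L hr) (WW_cont hn L hr)
  have hWT : ∀ s, 0 < s → IntervalIntegrable (fun x => WW n g x * T x) volume s b := by
    intro s hs
    apply ContinuousOn.intervalIntegrable
    intro x hx
    have : 0 < x := (lt_min hs hb0).trans_le (by simpa [uIcc] using hx.1)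
    exact ((WW_cont hn L this).mul (hT x this).continuousAt).continuousWithinAt
  have hJ : HasDerivAt (fun a => ∫ x in a..b, WW n g x * T x) (-(WW n g r * T r)) r := by
    refine intervalIntegral.integral_hasDerivAt_left (hWT r hr) ?_ ((WW_cont hn L hr).mul (hT r hr).continuousAt)
    have : ContinuousOn (fun x => WW n g x * T x) (Ioi 0) :=
      fun x hx => ((WW_cont hn L hx).mul (hT x hx).continuousAt).continuousWithinAt
    exact this.stronglyMeasurableAtFilter isOpen_Ioi r hr
  have heq : ∀ a, 0 < a → a < b → g a = g b + (T a * HH n g a + ∫ x in a..b, WW n g x * T x) := by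
    intro a ha hab
    have h := el2 hn L ha hab
    have hp := tst_prof hn ha hab
    have hi := (WW_int hn L hb0).mul_continuousOn (f := WW n g) (g := tst n a b) hp.cont.continuousOn
    have hia := (WW_int hn L ha).mul_continuousOn (f := WW n g) (g := tst n a b) hp.cont.continuousOn
    rw [← intervalIntegral.integral_add_adjacent_intervals hia (hia.symm.trans hi)] at h
    have e1 : ∫ s in (0:ℝ)..a, WW n g s * tst n a b s = T a * HH n g a := by
      rw [HH, ← intervalIntegral.integral_const_mul]
      apply intervalIntegral.integral_congr
      intro s hs
      rw [uIcc_of_le ha.le] at hs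
      show WW n g s * tst n a b s = T a * WW n g s
      rw [tst_const hn ha hs.2, tst_eq le_rfl hab.le, mul_comm]
    have e2 : ∫ s in a..b, WW n g s * tst n a b s = ∫ x in a..b, WW n g x * T x := by
      apply intervalIntegral.integral_congr
      intro s hs
      rw [uIcc_of_le hab.le] at hs
      show WW n g s * tst n a b s = _
      rw [tst_eq hs.1 hs.2]
    rw [e1, e2] at h
    linarith
  have hd := (((hT r hr).mul hH).add hJ).const_add (g b)
  have hev : g =ᶠ[𝓝 r] fun a => g b + (T a * HH n g a + ∫ x in a..b, WW n g x * T x) := by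
    filter_upwards [lt_mem_nhds hr, gt_mem_nhds (show r < b by linarith)] with a h1 h2 using heq a h1 h2
  refine (HasDerivAt.congr_of_eventuallyEq hd hev).congr_deriv ?_
  rw [g1]; ring

lemma g1_deriv {n : ℝ} (hn : 1 ≤ n) {g : ℝ → ℝ} (L : Lim n g) {r : ℝ} (hr : 0 < r) :
    HasDerivAt (g1 n g) (-(n-1)/r * g1 n g r - hh n g r) r := by
  have hH : HasDerivAt (HH n g) (WW n g r) r :=
    intervalIntegral.integral_hasDerivAt_right (WW_int hn L hr) (WW_meas hn L hr) (WW_cont hn L hr)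
  have h1 : HasDerivAt (fun r : ℝ => r^(1-n)) ((1-n) * r^(1-n-1)) r := Real.hasDerivAt_rpow_const (Or.inl hr.ne')
  refine (h1.mul hH).neg.congr_deriv ?_
  have e1 : r^(1-n-1) = r^(1-n) / r := by rw [Real.rpow_sub_one hr.ne']
  have e2 : r^(1-n) * r^(n-1) = 1 := by rw [← Real.rpow_add hr]; simp
  rw [g1, e1, WW]
  have : -((1-n) * (r^(1-n)/r) * HH n g r + r^(1-n) * (r^(n-1) * hh n g r)) =
    (n-1)/r * (r^(1-n) * HH n g r) - (r^(1-n) * r^(n-1)) * hh n g r := by field_simp; ring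
  rw [this, e2]; ring

/-- bound of g1 from a power bound of hh -/
lemma g1_bound {n : ℝ} {g : ℝ → ℝ} {C κ R : ℝ} (hκ : κ < n)
    (h : ∀ s, 0 < s → s ≤ R → |hh n g s| ≤ C * s^(-κ)) {r : ℝ} (hr : 0 < r) (hrR : r ≤ R) :
    |g1 n g r| ≤ C/(n-κ) * r^(1-κ) := by
  have hnk : 0 < n - κ := by linarith
  have h1 : |HH n g r| ≤ C * (r^(n-κ)/(n-κ)) := by
    have hi : IntervalIntegrable (fun s : ℝ => C * s^(n-κ-1)) volume 0 r :=
      (intervalIntegral.intervalIntegrable_rpow' (by linarith)).const_mul _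
    have := intervalIntegral.norm_integral_le_of_norm_le (f := WW n g) (g := fun s => C * s^(n-κ-1)) hr.le ?_ hi
    · refine this.trans (le_of_eq ?_)
      rw [intervalIntegral.integral_const_mul, integral_rpow (Or.inl (by linarith)), sub_add_cancel,
        Real.zero_rpow hnk.ne', sub_zero]
    · filter_upwards with s hs
      have hs0 := hs.1
      have hw := Real.rpow_pos_of_pos hs0 (n-1)
      rw [WW, Real.norm_eq_abs, abs_mul, abs_of_pos hw]
      calc _ ≤ s^(n-1) * (C * s^(-κ)) := by gcongr; exact h s hs0 (hs.2.trans hrR)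
        _ = C * (s^(n-1) * s^(-κ)) := by ring
        _ = _ := by rw [← Real.rpow_add hs0]; ring_nf
  have hw := Real.rpow_pos_of_pos hr (1-n)
  rw [g1, abs_neg, abs_mul, abs_of_pos hw]
  calc _ ≤ r^(1-n) * (C * (r^(n-κ)/(n-κ))) := by gcongr
    _ = C/(n-κ) * (r^(1-n) * r^(n-κ)) := by ring
    _ = _ := by rw [← Real.rpow_add hr]; ring_nf
end CM

namespace CM
open Set Topology Asymptotics

lemma hh_pow {n : ℝ} (hn : 1 ≤ n) {g : ℝ → ℝ} (L : Lim n g) {C γ s : ℝ} (hs : 0 < s) (hC : 0 < C) (h1 : 1 ≤ C * s^(-γ))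
    (h : g s ≤ C * s^(-γ)) :
    |hh n g s| ≤ ((qq n/(2*SS n) + 2/n) * C^(qq n - 1)) * s^(-(γ*(qq n - 1))) := by
  have hS := SS_pos hn
  have hq := qq_gt hn
  have h0 := L.nn s hs
  have e : (C * s^(-γ))^(qq n - 1) = C^(qq n-1) * s^(-(γ*(qq n - 1))) := by
    rw [Real.mul_rpow hC.le (by positivity), ← Real.rpow_mul hs.le]; ring_nf
  have a1 : |g s|^(qq n - 1) ≤ (C * s^(-γ))^(qq n - 1) := by
    rw [abs_of_nonneg h0]; exact Real.rpow_le_rpow h0 h (by linarith)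
  have a2 : |g s|^(1:ℝ) ≤ (C * s^(-γ))^(qq n - 1) := by
    rw [abs_of_nonneg h0, Real.rpow_one]
    refine h.trans ?_
    conv_lhs => rw [← Real.rpow_one (C * s^(-γ))]
    exact Real.rpow_le_rpow_of_exponent_le h1 (by linarith)
  rw [mul_assoc, ← e, hh]
  have : 0 < qq n := by linarith
  refine (abs_sub _ _).trans ?_
  rw [abs_of_nonneg (a := qq n/(2*SS n) * |g s|^(qq n - 1)) (by positivity), abs_of_nonneg (a := 2/n * |g s|^(1:ℝ)) (by positivity), add_mul]
  exact add_le_add (mul_le_mul_of_nonneg_left a1 (by positivity)) (mul_le_mul_of_nonneg_left a2 (by positivity))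

def PB (g : ℝ → ℝ) (γ : ℝ) : Prop := ∃ C, 0 < C ∧ ∀ r, 0 < r → r ≤ 1 → g r ≤ C * r^(-γ)

lemma PB_g1 {n : ℝ} (hn : 1 ≤ n) {g : ℝ → ℝ} (L : Lim n g) {γ : ℝ} (h0 : 0 ≤ γ) (hγ : γ ≤ bt n) (h : PB g γ) :
    ∃ C, 0 < C ∧ ∀ r, 0 < r → r ≤ 1 → |g1 n g r| ≤ C * r^(1 - γ*(qq n - 1)) := by
  obtain ⟨C, hC, h⟩ := h
  have hq := qq_gt hn
  have hS := SS_pos hn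
  have hk : γ * (qq n - 1) < n := (mul_le_mul_of_nonneg_right hγ (by linarith)).trans_lt (bt_th hn (by linarith))
  have hk' : 0 < n - γ * (qq n - 1) := by linarith
  refine ⟨((qq n/(2*SS n) + 2/n) * (C+1)^(qq n - 1))/(n-γ*(qq n - 1)), by positivity, fun r hr hr1 => ?_⟩
  refine g1_bound hk (fun s hs hs1 => ?_) hr hr1
  have hw : 1 ≤ s^(-γ) := Real.one_le_rpow_of_pos_of_le_one_of_nonpos hs hs1 (by linarith)
  refine hh_pow hn L hs (by linarith) (by nlinarith) ((h s hs hs1).trans ?_)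
  nlinarith

lemma boot {n : ℝ} (hn : 1 ≤ n) {g : ℝ → ℝ} (L : Lim n g) {γ : ℝ} (h0 : 0 ≤ γ) (hγ : γ ≤ bt n) (h : PB g γ) :
    (1 - 2*bt n/n < γ → PB g (γ - (1 - 2*bt n/n))) ∧ (γ ≤ 1 - 2*bt n/n → PB g 0) := by
  obtain ⟨C, hC, hb⟩ := PB_g1 hn L h0 hγ h
  have hn0 : 0 < n := by linarith
  have hb1 : bt n * (2 + 4/n) < n := bt_lt hn
  have hbp := bt_pos hn
  have hε : 0 < 1 - 2*bt n/n := by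
    have : 2*bt n < n := by
      have : 0 < bt n * (4/n) := by positivity
      nlinarith
    rw [sub_pos, div_lt_one hn0]; exact this
  set ε := 1 - 2*bt n/n with hεd
  have hq1 : qq n - 1 = 1 + 4/n := by rw [qq]; ring
  have hge : γ * (4/n) ≤ 2 - 2*ε := by
    have : 2 - 2*ε = bt n * (4/n) := by rw [hεd]; field_simp; ring
    rw [this]; gcongr
  have hg1 := L.nn 1 one_pos
  constructor
  · intro hlt
    set γ' := γ - ε with hγ'
    have hp : 0 < γ' := by linarith
    have hm := mono_Ioc (F := fun r => g r - C/γ' * r^(-γ')) (F' := fun r => g1 n g r - C/γ' * (-γ' * r^(-γ'-1))) (b := 1)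
      (fun r hr _ => (g_deriv hn L hr).sub ((Real.hasDerivAt_rpow_const (Or.inl hr.ne')).const_mul _))
      (fun r hr hr1 => by
        have h1 := hb r hr hr1
        have h2 : r^(1-γ*(qq n - 1)) ≤ r^(-γ'-1) := by
          apply Real.rpow_le_rpow_of_exponent_ge hr hr1
          rw [hq1]; nlinarith
        have h3 : C/γ' * (-γ' * r^(-γ'-1)) = - (C * r^(-γ'-1)) := by field_simp
        rw [h3]
        have := neg_abs_le (g1 n g r)
        nlinarith)
    refine ⟨g 1 + C/γ', by positivity, fun r hr hr1 => ?_⟩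
    have := hm ⟨hr, hr1⟩ ⟨one_pos, le_rfl⟩ hr1
    simp only [Real.one_rpow] at this
    have hw : 1 ≤ r^(-γ') := Real.one_le_rpow_of_pos_of_le_one_of_nonpos hr hr1 (by linarith)
    have : 0 < C/γ' := by positivity
    nlinarith
  · intro hle
    set η := 2 - γ*(qq n - 1) with hη
    have hη0 : 0 < η := by rw [hη, hq1]; nlinarith
    have hm := mono_Ioc (F := fun r => g r + C/η * r^η) (F' := fun r => g1 n g r + C/η * (η * r^(η-1))) (b := 1)
      (fun r hr _ => (g_deriv hn L hr).add ((Real.hasDerivAt_rpow_const (Or.inl hr.ne')).const_mul _))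
      (fun r hr hr1 => by
        have h1 := hb r hr hr1
        have h2 : η - 1 = 1-γ*(qq n - 1) := by rw [hη]; ring
        have h3 : C/η * (η * r^(η-1)) = C * r^(η-1) := by field_simp
        rw [h3, h2]
        have := neg_abs_le (g1 n g r)
        nlinarith)
    refine ⟨g 1 + C/η, by positivity, fun r hr hr1 => ?_⟩
    have := hm ⟨hr, hr1⟩ ⟨one_pos, le_rfl⟩ hr1
    simp only [Real.one_rpow] at this
    have hw : 0 < C/η * r^η := by positivity
    rw [neg_zero, Real.rpow_zero]
    nlinarith

lemma PB_zero {n : ℝ} (hn : 1 ≤ n) {g : ℝ → ℝ} (L : Lim n g) : PB g 0 := by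
  have hn0 : 0 < n := by linarith
  have hb1 : bt n * (2 + 4/n) < n := bt_lt hn
  have hbp := bt_pos hn
  have hε : 0 < 1 - 2*bt n/n := by
    have : 2*bt n < n := by
      have : 0 < bt n * (4/n) := by positivity
      nlinarith
    rw [sub_pos, div_lt_one hn0]; exact this
  have key : ∀ k : ℕ, ∀ γ, 0 ≤ γ → γ ≤ bt n → γ ≤ k * (1 - 2*bt n/n) → PB g γ → PB g 0 := by
    intro k
    induction k with
    | zero =>
      intro γ h0 _ h1 h
      have : γ = 0 := by simp at h1; linarith
      rwa [this] at h
    | succ k ih =>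
      intro γ h0 hb h1 h
      obtain ⟨B1, B2⟩ := boot hn L h0 hb h
      rcases le_or_gt γ (1 - 2*bt n/n) with hc | hc
      · exact B2 hc
      · refine ih _ (by linarith) (by linarith) ?_ (B1 hc)
        push_cast at h1
        linarith
  obtain ⟨k, hk⟩ := exists_nat_ge (bt n / (1 - 2*bt n/n))
  rw [div_le_iff₀ hε] at hk
  exact key k _ hbp.le le_rfl hk ⟨KK n, KK_pos hn, L.near⟩

lemma g_bdd {n : ℝ} (hn : 1 ≤ n) {g : ℝ → ℝ} (L : Lim n g) : ∃ M, 1 ≤ M ∧ ∀ r, 0 < r → g r ≤ M := by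
  obtain ⟨C, hC, h⟩ := PB_zero hn L
  refine ⟨C+1, by linarith, fun r hr => ?_⟩
  have h1 := h (min r 1) (by positivity) (min_le_right _ _)
  rw [neg_zero, Real.rpow_zero] at h1
  have := L.anti (show min r 1 ∈ Ioi 0 from lt_min hr one_pos) hr (min_le_left _ _)
  linarith

lemma g1_lin {n : ℝ} (hn : 1 ≤ n) {g : ℝ → ℝ} (L : Lim n g) : ∃ C, ∀ r, 0 < r → |g1 n g r| ≤ C * r := by
  obtain ⟨M, hM, h⟩ := g_bdd hn L
  refine ⟨((qq n/(2*SS n) + 2/n) * M^(qq n - 1))/(n-0), fun r hr => ?_⟩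
  have := g1_bound (C := (qq n/(2*SS n) + 2/n) * M^(qq n - 1)) (κ := 0) (R := r) (n := n) (g := g) (by linarith) (fun s hs _ => ?_) hr le_rfl
  · rwa [sub_zero 1, Real.rpow_one] at this
  · have := hh_pow hn L (C := M) (γ := 0) hs (by linarith) (by simpa using hM) (by simpa using h s hs)
    rw [zero_mul] at this
    exact this

/-- The optimal profile. -/
lemma exists_opt {n : ℝ} (hn : 1 ≤ n) (hGN : GNall n) : ∃ P P1 p0, Sol n P P1 p0 ∧ SS n * (Pf n 2 P)^(2/n) ≤ qq n / 2 := by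
  obtain ⟨g, L⟩ := exists_lim hn hGN
  have hS := SS_pos hn
  have hq := qq_gt hn
  have hn0 : 0 < n := by linarith
  have hq0 : 0 < qq n := by linarith
  have hq1 : qq n - 1 = 1 + 4/n := by rw [qq]; ring
  set l := √(n/2) with hl
  have hl0 : 0 < l := Real.sqrt_pos.2 (by positivity)
  have hl2 : l^2 = n/2 := Real.sq_sqrt (by positivity)
  set m := (n * qq n/(4*SS n))^(n/4) with hm
  have hm0 : 0 < m := by positivity
  have hm4 : m^(4/n) = n * qq n/(4*SS n) := by
    rw [hm, ← Real.rpow_mul (by positivity)]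
    have : n/4*(4/n) = 1 := by field_simp
    rw [this, Real.rpow_one]
  have hd0 : ∀ r, 0 < r → HasDerivAt (fun r => m * g (l*r)) (m * (l * g1 n g (l*r))) r := by
    intro r hr
    have := (g_deriv hn L (mul_pos hl0 hr)).comp r ((hasDerivAt_id r).const_mul l)
    refine (this.const_mul m).congr_deriv ?_
    ring
  have hd1 : ∀ r, 0 < r → HasDerivAt (fun r => m * (l * g1 n g (l*r)))
      (-(n-1)/r*(m * (l * g1 n g (l*r))) + m * g (l*r) - (m * g (l*r))^(1+4/n)) r := by
    intro r hr
    have hlr := mul_pos hl0 hr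
    have := (g1_deriv hn L hlr).comp r ((hasDerivAt_id r).const_mul l)
    refine ((this.const_mul l).const_mul m).congr_deriv ?_
    have h0 := L.nn (l*r) hlr
    rw [Real.mul_rpow hm0.le h0, Real.rpow_add hm0, hm4, hh, hq1, Real.rpow_one, Real.rpow_one, abs_of_nonneg h0, mul_one]
    have : m * (l * ((-(n-1)/(l*r) * g1 n g (l*r) - (qq n/(2*SS n) * g (l*r)^(1+4/n) - 2/n * g (l*r))) * l)) =
       -(n-1)/r*(m * (l * g1 n g (l*r))) - m * l^2 * (qq n/(2*SS n) * g (l*r)^(1+4/n) - 2/n * g (l*r)) := by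
      field_simp
    rw [this, hl2]
    field_simp
    ring
  have hnn : ∀ r, 0 < r → 0 ≤ m * g (l*r) := fun r hr => mul_nonneg hm0.le (L.nn _ (mul_pos hl0 hr))
  have hpos : ∀ r, 0 < r → 0 < g r := by
    intro r0 hr0
    by_contra hc
    have h00 : g r0 = 0 := le_antisymm (not_lt.1 hc) (L.nn r0 hr0)
    have hz : ∀ s, 0 < s → g s = 0 := by
      intro s hs
      rcases le_or_gt r0 s with h | h
      · exact le_antisymm (h00 ▸ L.anti hr0 hs h) (L.nn s hs)
      · have hlow := low_bound hn hnn hd0 hd1 (div_pos hs hl0)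
        set K := (n-1)/(s/l)+1
        have hmono : MonotoneOn (fun r => m * g (l*r) * Real.exp (K*r)) (Icc (s/l) (r0/l)) := by
          have hd : ∀ r, 0 < r → HasDerivAt (fun r => m * g (l*r) * Real.exp (K*r))
              ((m * (l * g1 n g (l*r))) * Real.exp (K*r) + m * g (l*r) * (Real.exp (K*r) * (K*1))) r := fun r hr =>
            (hd0 r hr).mul (((hasDerivAt_id r).const_mul K).exp)
          apply monotoneOn_of_deriv_nonneg (convex_Icc _ _)
          · intro r hr
            exact (hd r ((div_pos hs hl0).trans_le hr.1)).continuousAt.continuousWithinAt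
          · intro r hr
            rw [interior_Icc] at hr
            exact (hd r ((div_pos hs hl0).trans hr.1)).differentiableAt.differentiableWithinAt
          · intro r hr
            rw [interior_Icc] at hr
            rw [(hd r ((div_pos hs hl0).trans hr.1)).deriv]
            have h1 := hlow r hr.1.le
            have := mul_nonneg h1 (Real.exp_pos (K*r)).le
            linarith
        have hle : s/l ≤ r0/l := by gcongr
        have := hmono ⟨le_rfl, hle⟩ ⟨hle, le_rfl⟩ hle
        simp only [mul_div_cancel₀ _ hl0.ne', h00, mul_zero, zero_mul] at this
        have h2 := L.nn s hs
        have h3 := Real.exp_pos (K*(s/l))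
        by_contra hne
        have : 0 < g s := lt_of_le_of_ne h2 (Ne.symm hne)
        have : 0 < m * g s * Real.exp (K*(s/l)) := by positivity
        linarith
    have : Pf n (qq n) g = 0 := by
      rw [Pf]
      apply setIntegral_eq_zero_of_forall_eq_zero
      intro r hr
      rw [hz r hr, abs_zero, Real.zero_rpow (by linarith), mul_zero]
    rw [L.qn] at this
    linarith
  obtain ⟨M, hM, hgM⟩ := g_bdd hn L
  have hgl : ∃ y, Tendsto g (𝓝[>] 0) (𝓝 y) :=
    ⟨_, AntitoneOn.tendsto_nhdsGT (x := (0:ℝ)) L.anti ⟨M, by rintro _ ⟨r, hr, rfl⟩; exact hgM r hr⟩⟩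
  obtain ⟨y, hy⟩ := hgl
  have hy1 : g 1 ≤ y := by
    apply ge_of_tendsto hy
    filter_upwards [Ioc_mem_nhdsGT (one_pos : (0:ℝ) < 1)] with r hr
    exact L.anti hr.1 (mem_Ioi.2 one_pos) hr.2
  obtain ⟨C, hC⟩ := g1_lin hn L
  refine ⟨fun r => m * g (l*r), fun r => m * (l * g1 n g (l*r)), m*y,
    ⟨fun r hr => mul_pos hm0 (hpos _ (mul_pos hl0 hr)), hd0, hd1, ?_, mul_pos hm0 ((hpos 1 one_pos).trans_le hy1), ?_, ?_⟩, ?_⟩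
  · apply Tendsto.const_mul
    apply hy.comp
    apply tendsto_nhdsWithin_iff.2 ⟨?_, ?_⟩
    · have : Tendsto (fun r : ℝ => l*r) (𝓝 0) (𝓝 (l*0)) := (continuous_const.mul continuous_id).tendsto 0
      rw [mul_zero] at this
      exact this.mono_left nhdsWithin_le_nhds
    · filter_upwards [self_mem_nhdsWithin] with r hr
      exact mul_pos hl0 hr
  · refine ⟨m*l^2*C, fun r hr _ => ?_⟩
    have := hC (l*r) (mul_pos hl0 hr)
    rw [abs_mul, abs_mul, abs_of_pos hm0, abs_of_pos hl0]
    calc _ ≤ m * (l * (C * (l*r))) := by gcongr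
      _ = _ := by ring
  · refine ⟨m*n*l^(-(n/2)), fun r hr => ?_⟩
    have hr0 : 0 < r := by linarith
    have := L.far (l*r) (mul_pos hl0 hr0)
    rw [Real.mul_rpow hl0.le hr0.le] at this
    rw [neg_div]
    calc _ ≤ m * (n * (l^(-(n/2)) * r^(-(n/2)))) := by gcongr
      _ = _ := by ring
  · rw [Pf_scale hl0 hm0]
    have h1 := L.mass
    have h2 := Pf_nonneg n 2 g
    have e : (m^(2:ℝ) * l^(-n))^(2/n) = n * qq n/(4*SS n) * (2/n) := by
      rw [Real.mul_rpow (by positivity) (by positivity), ← Real.rpow_mul hm0.le, ← Real.rpow_mul hl0.le]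
      have e1 : (2:ℝ)*(2/n) = 4/n := by ring
      have e2 : -n*(2/n) = -(2:ℕ) := by field_simp; norm_num
      rw [e1, e2, hm4, Real.rpow_neg hl0.le, Real.rpow_natCast, hl2, inv_div]
    calc SS n * (m^(2:ℝ) * l^(-n) * Pf n 2 g)^(2/n) ≤ SS n * (m^(2:ℝ) * l^(-n) * 1)^(2/n) := by gcongr
      _ = qq n/2 := by rw [mul_one, e]; field_simp; ring
end CM

namespace CM
open Set Topology Asymptotics Metric

abbrev EE (N : ℕ) := EuclideanSpace ℝ (Fin N)

def kap (N : ℕ) : ℝ := (∫ k in ball (0 : EE N) 1, ‖k‖^2) / N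

lemma ball_int {N : ℕ} {f : EE N → ℝ} (hf : Continuous f) : IntegrableOn f (ball (0 : EE N) 1) :=
  (hf.continuousOn.integrableOn_compact (isCompact_closedBall (0 : EE N) 1)).mono_set ball_subset_closedBall

lemma kap_rot {N : ℕ} (x y : EE N) (h : ‖x‖ = ‖y‖) :
    ∫ k in ball (0 : EE N) 1, (inner ℝ x k)^2 = ∫ k in ball (0 : EE N) 1, (inner ℝ y k)^2 := by
  set R := (Submodule.span ℝ {x - y})ᗮ.reflection with hR
  have hxy : R x = y := Submodule.reflection_sub h
  have hmp := R.measurePreserving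
  have hpre : R ⁻¹' (ball (0 : EE N) 1) = ball 0 1 := by
    ext z; simp
  have := hmp.setIntegral_preimage_emb R.toHomeomorph.measurableEmbedding (fun k => (inner ℝ y k)^2) (ball 0 1)
  rw [hpre] at this
  rw [← this]
  congr 1; ext k
  rw [← hxy, R.inner_map_map]

lemma kap_eq {N : ℕ} (hN : 1 ≤ N) (x : EE N) :
    ∫ k in ball (0 : EE N) 1, (inner ℝ x k)^2 = ‖x‖^2 * kap N := by
  have h1 : ∀ i : Fin N, ∫ k in ball (0 : EE N) 1, (inner ℝ x k)^2 = ‖x‖^2 * ∫ k in ball (0 : EE N) 1, (k i)^2 := by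
    intro i
    rw [kap_rot x (‖x‖ • EuclideanSpace.single i (1:ℝ)) (by simp [norm_smul]), ← integral_const_mul]
    congr 1; ext k
    rw [inner_smul_left, EuclideanSpace.inner_single_left]
    simp; ring
  have h2 : ∑ i : Fin N, ∫ k in ball (0 : EE N) 1, (k i)^2 = ∫ k in ball (0 : EE N) 1, ‖k‖^2 := by
    rw [← integral_finsetSum]
    · congr 1; ext k
      rw [EuclideanSpace.norm_sq_eq]; simp
    · intro i _
      exact ball_int (by fun_prop)
  have h3 := Finset.sum_congr rfl fun i (_ : i ∈ Finset.univ) => h1 i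
  rw [← Finset.mul_sum, h2] at h3
  simp at h3
  rw [kap]
  have : (0:ℝ) < N := by exact_mod_cast hN
  field_simp
  linarith

lemma kap_pos {N : ℕ} (hN : 1 ≤ N) : 0 < kap N := by
  have hN' : (0:ℝ) < N := by exact_mod_cast hN
  have : Nonempty (Fin N) := ⟨⟨0, hN⟩⟩
  rw [kap]
  apply div_pos _ hN'
  rw [setIntegral_pos_iff_support_of_nonneg_ae (Eventually.of_forall fun k => by positivity) (ball_int (by fun_prop))]
  have h1 : ball (EuclideanSpace.single ⟨0, hN⟩ (1/2:ℝ)) (1/4) ⊆ Function.support (fun k : EE N => ‖k‖^2) ∩ ball 0 1 := by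
    intro z hz
    rw [mem_ball, dist_eq_norm] at hz
    have e : ‖(EuclideanSpace.single ⟨0, hN⟩ (1/2:ℝ) : EE N)‖ = 1/2 := by simp
    have a1 := norm_sub_norm_le z (EuclideanSpace.single ⟨0, hN⟩ (1/2:ℝ) : EE N)
    have a2 := norm_sub_norm_le (EuclideanSpace.single ⟨0, hN⟩ (1/2:ℝ) : EE N) z
    rw [norm_sub_rev] at a2
    rw [e] at a1 a2
    constructor
    · have : 0 < ‖z‖ := by linarith
      simp only [Function.mem_support]; positivity
    · rw [mem_ball_zero_iff]; linarith
  exact (measure_ball_pos _ _ (by norm_num)).trans_le (measure_mono h1)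

/-- for a linear map to ℝ -/
lemma kap_lin {N : ℕ} (hN : 1 ≤ N) (l : EE N →L[ℝ] ℝ) :
    ∫ k in ball (0 : EE N) 1, (l k)^2 = kap N * ∑ i, (l (EuclideanSpace.single i (1:ℝ)))^2 := by
  obtain ⟨x, rfl⟩ := (InnerProductSpace.toDual ℝ (EE N)).surjective l
  simp only [InnerProductSpace.toDual_apply_apply]
  rw [kap_eq hN, EuclideanSpace.norm_sq_eq, mul_comm]
  congr 1
  apply Finset.sum_congr rfl
  intro i _
  rw [EuclideanSpace.inner_single_right]; simp

lemma kap_linC {N : ℕ} (hN : 1 ≤ N) (l : EE N →L[ℝ] ℂ) :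
    ∫ k in ball (0 : EE N) 1, ‖l k‖^2 = kap N * ∑ i, ‖l (EuclideanSpace.single i (1:ℝ))‖^2 := by
  have e : ∀ z : ℂ, ‖z‖^2 = (reCLM z)^2 + (imCLM z)^2 := by
    intro z; rw [← normSq_eq_norm_sq, normSq_apply]; simp; ring
  simp only [e]
  rw [integral_add (ball_int (by fun_prop)) (ball_int (by fun_prop)), Finset.sum_add_distrib, mul_add]
  have h1 := kap_lin hN (reCLM ∘L l)
  have h2 := kap_lin hN (imCLM ∘L l)
  simp only [ContinuousLinearMap.comp_apply] at h1 h2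
  rw [h1, h2]
end CM

namespace CM
open Set Topology Asymptotics Metric ENNReal

lemma jen {α : Type*} [MeasurableSpace α] {μ : Measure α} [IsProbabilityMeasure μ] {f : α → ℝ≥0∞} (hf : AEMeasurable f μ)
    {s : ℝ} (hs : 1 ≤ s) : (∫⁻ x, f x ∂μ)^s ≤ ∫⁻ x, f x^s ∂μ := by
  have h := eLpNorm'_le_eLpNorm'_of_exponent_le (f := f) (μ := μ) one_pos hs hf.aestronglyMeasurable
  simp only [eLpNorm', enorm_eq_self, ENNReal.rpow_one, div_one] at h
  have h2 := ENNReal.rpow_le_rpow h (by linarith : 0 ≤ s)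
  rwa [← ENNReal.rpow_mul, one_div_mul_cancel (by linarith), ENNReal.rpow_one] at h2

lemma deriv_line {N : ℕ} {F : Type*} [NormedAddCommGroup F] [NormedSpace ℝ F] (v : EE N → F) (x h : EE N) (s : ℝ) :
    deriv (fun s : ℝ => v (x + s • h)) s = lineDeriv ℝ v (x + s • h) h := by
  rw [lineDeriv]
  have : (fun t : ℝ => v (x + s • h + t • h)) = fun t => (fun s : ℝ => v (x + s • h)) (s + t) := by
    ext t; simp only [add_smul, add_assoc]
  rw [this]
  have h2 := deriv_comp_const_add (f := fun s : ℝ => v (x + s • h)) s 0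
  rw [add_zero] at h2
  exact h2.symm

def FT {N : ℕ} {F : Type*} [NormedAddCommGroup F] [NormedSpace ℝ F] (v : EE N → F) : Prop :=
  ∀ x h, ‖v (x+h) - v x‖ₑ^2 ≤ ∫⁻ s in Ioc (0:ℝ) 1, ‖lineDeriv ℝ v (x + s • h) h‖ₑ^2

lemma ft_aux {F : Type*} [NormedAddCommGroup F] [NormedSpace ℝ F] {g : ℝ → F}
    (hm : AEStronglyMeasurable (deriv g) (volume.restrict (Ioc (0:ℝ) 1)))
    (h : ‖g 1 - g 0‖ₑ ≤ ∫⁻ s in Ioc (0:ℝ) 1, ‖deriv g s‖ₑ) :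
    ‖g 1 - g 0‖ₑ^2 ≤ ∫⁻ s in Ioc (0:ℝ) 1, ‖deriv g s‖ₑ^2 := by
  have : IsProbabilityMeasure (volume.restrict (Ioc (0:ℝ) 1)) := ⟨by simp⟩
  have := jen (μ := volume.restrict (Ioc (0:ℝ) 1)) hm.enorm one_le_two
  simp only [ENNReal.rpow_two] at this
  exact (pow_le_pow_left₀ zero_le h 2).trans this

lemma FT_diff {N : ℕ} {v : EE N → ℂ} (hv : Differentiable ℝ v) : FT v := by
  intro x h
  have hg : Differentiable ℝ (fun s : ℝ => v (x + s • h)) := hv.comp (by fun_prop)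
  have := ft_aux (g := fun s : ℝ => v (x + s • h)) (stronglyMeasurable_deriv _).aestronglyMeasurable ?_
  · simpa only [deriv_line, one_smul, zero_smul, add_zero] using this
  · by_cases hi : IntervalIntegrable (deriv fun s : ℝ => v (x + s • h)) volume 0 1
    · rw [← intervalIntegral.integral_eq_sub_of_hasDerivAt (fun s _ => (hg s).hasDerivAt) hi,
        intervalIntegral.integral_of_le zero_le_one]
      exact enorm_integral_le_lintegral_enorm _
    · have : ∫⁻ s in Ioc (0:ℝ) 1, ‖deriv (fun s : ℝ => v (x + s • h)) s‖ₑ = ⊤ := by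
        by_contra hc
        apply hi
        rw [intervalIntegrable_iff_integrableOn_Ioc_of_le zero_le_one]
        exact ⟨(stronglyMeasurable_deriv _).aestronglyMeasurable, lt_top_iff_ne_top.2 hc⟩
      rw [this]; exact le_top

lemma FT_lip {N : ℕ} {v : EE N → ℝ} {L : NNReal} (hv : LipschitzWith L v) : FT v := by
  intro x h
  have hl : LipschitzWith (‖h‖₊) (fun s : ℝ => x + s • h) := by
    apply LipschitzWith.of_dist_le_mul
    intro a b
    rw [dist_add_left, dist_eq_norm, ← sub_smul, norm_smul, mul_comm, dist_eq_norm, coe_nnnorm]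
  have hg := hv.comp hl
  have := ft_aux (g := fun s : ℝ => v (x + s • h)) (stronglyMeasurable_deriv _).aestronglyMeasurable ?_
  · simpa only [deriv_line, one_smul, zero_smul, add_zero] using this
  · have hA := (hg.lipschitzOnWith (s := uIcc (0:ℝ) 1)).absolutelyContinuousOnInterval
    have h1 := hA.integral_deriv_eq_sub
    have h2 : v (x + (1:ℝ) • h) - v (x + (0:ℝ) • h) = ∫ s in (0:ℝ)..1, deriv (fun s : ℝ => v (x + s • h)) s := h1.symm
    rw [h2, intervalIntegral.integral_of_le zero_le_one]
    exact enorm_integral_le_lintegral_enorm _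

def DD {N : ℕ} {F : Type*} [NormedAddCommGroup F] (t : ℝ) (v : EE N → F) : ℝ≥0∞ :=
  ∫⁻ x, ∫⁻ k in ball (0 : EE N) 1, ‖v (x + t • k) - v x‖ₑ^2

lemma DD_le {N : ℕ} {F : Type*} [NormedAddCommGroup F] [NormedSpace ℝ F] [MeasurableSpace F] [BorelSpace F]
    [CompleteSpace F] [SecondCountableTopology F]
    (hκ : ∀ l : EE N →L[ℝ] F, ∫ k in ball (0 : EE N) 1, ‖l k‖^2 = kap N * ∑ i, ‖l (EuclideanSpace.single i (1:ℝ))‖^2)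
    {v : EE N → F} (hc : Continuous v) (hF : FT v) (hd : ∀ᵐ x, DifferentiableAt ℝ v x) (t : ℝ) :
    DD t v ≤ ENNReal.ofReal (t^2 * kap N) * ∫⁻ x, ENNReal.ofReal (gradSq v x) := by
  have hml := measurable_lineDeriv_uncurry (𝕜 := ℝ) hc
  calc DD t v = ∫⁻ k in ball (0 : EE N) 1, ∫⁻ x, ‖v (x + t • k) - v x‖ₑ^2 := by
        rw [DD, lintegral_lintegral_swap]
        exact (Continuous.measurable (by fun_prop)).aemeasurable
    _ ≤ ∫⁻ k in ball (0 : EE N) 1, ∫⁻ x, ∫⁻ s in Ioc (0:ℝ) 1, ‖lineDeriv ℝ v (x + s • t • k) (t • k)‖ₑ^2 := by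
        gcongr with k x
        exact hF x (t • k)
    _ = ∫⁻ k in ball (0 : EE N) 1, ∫⁻ x, ‖lineDeriv ℝ v x (t • k)‖ₑ^2 := by
        congr 1; ext k
        rw [lintegral_lintegral_swap]
        · have : ∀ s : ℝ, ∫⁻ x, ‖lineDeriv ℝ v (x + s • t • k) (t • k)‖ₑ^2 = ∫⁻ x, ‖lineDeriv ℝ v x (t • k)‖ₑ^2 :=
            fun s => lintegral_add_right_eq_self (fun x => ‖lineDeriv ℝ v x (t • k)‖ₑ^2) _
          simp only [this, lintegral_const]
          simp
        · have : Measurable fun p : EE N × ℝ => lineDeriv ℝ v (p.1 + p.2 • t • k) (t • k) :=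
            hml.comp (f := fun p : EE N × ℝ => (p.1 + p.2 • t • k, t • k)) (by fun_prop)
          exact (this.enorm.pow_const 2).aemeasurable
    _ = ∫⁻ x, ∫⁻ k in ball (0 : EE N) 1, ‖lineDeriv ℝ v x (t • k)‖ₑ^2 := by
        rw [lintegral_lintegral_swap]
        have : Measurable fun p : EE N × EE N => lineDeriv ℝ v p.2 (t • p.1) :=
            hml.comp (f := fun p : EE N × EE N => (p.2, t • p.1)) (by fun_prop)
        exact (this.enorm.pow_const 2).aemeasurable
    _ = ∫⁻ x, ENNReal.ofReal (t^2 * kap N) * ENNReal.ofReal (gradSq v x) := by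
        apply lintegral_congr_ae
        filter_upwards [hd] with x hx
        have e1 : ∀ k : EE N, ‖lineDeriv ℝ v x (t • k)‖ₑ^2 = ENNReal.ofReal (t^2 * ‖fderiv ℝ v x k‖^2) := by
          intro k
          rw [hx.lineDeriv_eq_fderiv, ← ofReal_norm, ← ENNReal.ofReal_pow (norm_nonneg _), map_smul, norm_smul,
            mul_pow, Real.norm_eq_abs, sq_abs]
        simp only [e1]
        have hk : 0 ≤ t^2 * kap N := by rw [kap]; positivity
        rw [← ofReal_integral_eq_lintegral_ofReal (ball_int (by fun_prop)) (Eventually.of_forall fun k => by positivity),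
          integral_const_mul, hκ, ← ENNReal.ofReal_mul hk, gradSq, mul_assoc]
    _ = _ := by
        rw [lintegral_const_mul' _ _ ENNReal.ofReal_ne_top]
end CM

namespace CM
open Set Topology Asymptotics Metric ENNReal

structure Refl {N : ℕ} (σ : EE N → EE N) (A : Set (EE N)) : Prop where
  inv : ∀ x, σ (σ x) = x
  iso : ∀ x y, dist (σ x) (σ y) = dist x y
  mp : MeasurePreserving σ volume volume
  out : ∀ x, x ∉ A → σ x ∈ A
  fix : ∀ x, x ∈ A → σ x ∈ A → σ x = x
  near : ∀ x y, x ∈ A → y ∈ A → dist x y ≤ dist x (σ y)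
  nor : ∀ x, x ∈ A → ‖x‖ ≤ ‖σ x‖

lemma exists_refl {N : ℕ} {x y : EE N} (h : ‖x‖ < ‖y‖) :
    ∃ σ A, Refl σ A ∧ x ∈ A ∧ σ x = y := by
  have hne : y - x ≠ 0 := by
    intro h0; rw [sub_eq_zero] at h0; rw [h0] at h; exact lt_irrefl _ h
  have hd : 0 < ‖y - x‖ := norm_pos_iff.2 hne
  set e : EE N := ‖y - x‖⁻¹ • (y - x) with he
  have hen : ‖e‖ = 1 := by rw [he, norm_smul, norm_inv, norm_norm, inv_mul_cancel₀ hd.ne']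
  have hee : inner ℝ e e = (1:ℝ) := by rw [real_inner_self_eq_norm_sq, hen, one_pow]
  set κ : ℝ := (‖y‖^2 - ‖x‖^2) / (2 * ‖y - x‖) with hκ
  have hκ0 : 0 < κ := by
    apply div_pos _ (by positivity)
    have := norm_nonneg x
    nlinarith
  have hxe : inner ℝ x e - κ = - (‖y - x‖ / 2) := by
    have h1 := norm_sub_sq_real y x
    rw [he, inner_smul_right, inner_sub_right, real_inner_self_eq_norm_sq, real_inner_comm, hκ]
    field_simp
    linarith
  let σ : EE N → EE N := fun z => z - (2 * (inner ℝ z e - κ)) • e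
  have hσ : ∀ z, σ z = z - (2 * (inner ℝ z e - κ)) • e := fun _ => rfl
  have hse : ∀ z, inner ℝ (σ z) e - κ = -(inner ℝ z e - κ) := by
    intro z; rw [hσ, inner_sub_left, inner_smul_left, hee]; simp; ring
  have hinv : ∀ z, σ (σ z) = z := by
    intro z
    rw [hσ (σ z), hse, hσ z]; module
  have hdist : ∀ a b, ‖a - σ b‖^2 = ‖a - b‖^2 + 4 * (inner ℝ a e - κ) * (inner ℝ b e - κ) := by
    intro a b
    have : a - σ b = (a - b) + (2 * (inner ℝ b e - κ)) • e := by rw [hσ]; module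
    rw [this, norm_add_sq_real, inner_smul_right, norm_smul, hen, mul_one, Real.norm_eq_abs, sq_abs, inner_sub_left]
    ring
  have hiso : ∀ a b, dist (σ a) (σ b) = dist a b := by
    intro a b
    rw [dist_eq_norm, dist_eq_norm, ← sq_eq_sq₀ (norm_nonneg _) (norm_nonneg _), hdist, norm_sub_rev, hdist, hse,
      norm_sub_rev a b]
    ring
  have hnor : ∀ z, ‖σ z‖^2 = ‖z‖^2 - 4 * (inner ℝ z e - κ) * κ := by
    intro z
    have := hdist 0 z
    simp only [zero_sub, norm_neg, inner_zero_left] at this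
    rw [this]; ring
  refine ⟨σ, {z | inner ℝ z e - κ ≤ 0}, ⟨hinv, hiso, ?_, ?_, ?_, ?_, ?_⟩, ?_, ?_⟩
  · let I : EE N ≃ᵢ EE N := ⟨⟨σ, σ, hinv, hinv⟩, Isometry.of_dist_eq hiso⟩
    have h1 := (measurePreserving_add_right volume (I 0)).comp I.toRealLinearIsometryEquiv.measurePreserving
    have h2 : (fun x => x + I 0) ∘ I.toRealLinearIsometryEquiv = σ := by
      ext1 x
      simp only [Function.comp, IsometryEquiv.toRealLinearIsometryEquiv_apply, sub_add_cancel]; rfl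
    rwa [h2] at h1
  · intro z hz
    simp only [mem_ofPred_eq, hse] at hz ⊢; linarith
  · intro z hz hz'
    simp only [mem_ofPred_eq, hse] at hz hz'
    rw [hσ, show inner ℝ z e - κ = 0 by linarith]; simp
  · intro a b ha hb
    simp only [mem_ofPred_eq] at ha hb
    rw [dist_eq_norm, dist_eq_norm, ← sq_le_sq₀ (norm_nonneg _) (norm_nonneg _), hdist]
    nlinarith [mul_nonneg_of_nonpos_of_nonpos ha hb]
  · intro z hz
    simp only [mem_ofPred_eq] at hz
    rw [← sq_le_sq₀ (norm_nonneg _) (norm_nonneg _), hnor]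
    nlinarith
  · simp only [mem_ofPred_eq, hxe]; linarith
  · rw [hσ, hxe, he, smul_smul, show 2 * -(‖y - x‖/2) * ‖y - x‖⁻¹ = -1 by field_simp]; module

def pol {N : ℕ} (σ : EE N → EE N) (A : Set (EE N)) (v : EE N → ℝ) (z : EE N) : ℝ :=
  open Classical in if z ∈ A then max (v z) (v (σ z)) else min (v z) (v (σ z))

section
variable {N : ℕ} {σ : EE N → EE N} {A : Set (EE N)} {v : EE N → ℝ}

lemma pol_in {z : EE N} (hz : z ∈ A) : pol σ A v z = max (v z) (v (σ z)) := by rw [pol, if_pos hz]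
lemma pol_out {z : EE N} (hz : z ∉ A) : pol σ A v z = min (v z) (v (σ z)) := by rw [pol, if_neg hz]
lemma pol_refl (h : Refl σ A) {z : EE N} (hz : z ∈ A) : pol σ A v (σ z) = min (v z) (v (σ z)) := by
  by_cases h1 : σ z ∈ A
  · rw [h.fix z hz h1, pol_in hz, h.fix z hz h1, max_self, min_self]
  · rw [pol_out h1, h.inv, min_comm]

lemma pol_nonneg (h0 : ∀ x, 0 ≤ v x) (z : EE N) : 0 ≤ pol σ A v z := by
  by_cases hz : z ∈ A
  · rw [pol_in hz]; exact le_max_of_le_left (h0 z)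
  · rw [pol_out hz]; exact le_min (h0 z) (h0 _)

lemma pol_supp (h : Refl σ A) (h0 : ∀ x, 0 ≤ v x) {R : ℝ} (hR : ∀ x, R ≤ ‖x‖ → v x = 0) (z : EE N) (hz : R ≤ ‖z‖) :
    pol σ A v z = 0 := by
  by_cases hA : z ∈ A
  · rw [pol_in hA, hR z hz, hR _ (hz.trans (h.nor z hA)), max_self]
  · rw [pol_out hA, hR z hz, min_eq_left (h0 _)]

lemma pol_lip (h : Refl σ A) {L : NNReal} (hL : LipschitzWith L v) : LipschitzWith L (pol σ A v) := by
  apply LipschitzWith.of_dist_le_mul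
  have hv : ∀ a b, v a - v b ≤ L * dist a b := fun a b =>
    (le_abs_self _).trans (hL.dist_le_mul a b)
  have hLm : ∀ {a b : ℝ}, a ≤ b → (L:ℝ) * a ≤ L * b := fun h => mul_le_mul_of_nonneg_left h L.2
  have key : ∀ x y, pol σ A v x - pol σ A v y ≤ L * dist x y := by
    intro x y
    have a1 := hv x y
    have a2 := hv (σ x) (σ y)
    rw [h.iso] at a2
    by_cases hx : x ∈ A <;> by_cases hy : y ∈ A
    · rw [pol_in hx, pol_in hy]
      rcases max_cases (v x) (v (σ x)) with ⟨e, _⟩ | ⟨e, _⟩ <;> rcases max_cases (v y) (v (σ y)) with ⟨e', _⟩ | ⟨e', _⟩ <;>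
        rw [e, e'] <;> linarith
    · have hn := h.near x _ hx (h.out y hy)
      rw [h.inv] at hn
      have a3 := (hv x (σ y)).trans (hLm hn)
      have a4 := hv (σ x) y
      have a5 : dist (σ x) y = dist x (σ y) := by rw [← h.iso, h.inv]
      rw [a5] at a4
      have a6 := a4.trans (hLm hn)
      rw [pol_in hx, pol_out hy]
      rcases max_cases (v x) (v (σ x)) with ⟨e, _⟩ | ⟨e, _⟩ <;> rcases min_cases (v y) (v (σ y)) with ⟨e', _⟩ | ⟨e', _⟩ <;>
        rw [e, e'] <;> linarith
    · have hn := h.near _ _ (h.out x hx) hy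
      rw [h.iso] at hn
      have a3 := (hv (σ x) y).trans (hLm hn)
      rw [pol_out hx, pol_in hy]
      rcases min_cases (v x) (v (σ x)) with ⟨e, _⟩ | ⟨e, _⟩ <;> rcases max_cases (v y) (v (σ y)) with ⟨e', _⟩ | ⟨e', _⟩ <;>
        rw [e, e'] <;> linarith
    · rw [pol_out hx, pol_out hy]
      rcases min_cases (v x) (v (σ x)) with ⟨e, _⟩ | ⟨e, _⟩ <;> rcases min_cases (v y) (v (σ y)) with ⟨e', _⟩ | ⟨e', _⟩ <;>
        rw [e, e'] <;> linarith
  intro x y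
  rw [Real.dist_eq, abs_le]
  have := key x y
  have h2 := key y x
  rw [dist_comm] at h2
  constructor <;> linarith

/-- either both values stay or they swap -/
lemma pol_cases (h : Refl σ A) (z : EE N) : (pol σ A v z = v z ∧ pol σ A v (σ z) = v (σ z)) ∨
    (pol σ A v z = v (σ z) ∧ pol σ A v (σ z) = v z) := by
  by_cases hz : z ∈ A
  · rw [pol_in hz, pol_refl h hz]
    rcases le_total (v z) (v (σ z)) with h | h
    · rw [max_eq_right h, min_eq_left h]; tauto
    · rw [max_eq_left h, min_eq_right h]; tauto
  · have h2 := pol_in (σ := σ) (v := v) (h.out z hz)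
    rw [h.inv] at h2
    rw [pol_out hz, h2]
    rcases le_total (v z) (v (σ z)) with h | h
    · rw [max_eq_left h, min_eq_left h]; tauto
    · rw [max_eq_right h, min_eq_right h]; tauto

end
end CM

namespace CM
open Set Topology Asymptotics Metric ENNReal

def ker (t d : ℝ) : ℝ := if d < t then 1 else 0
lemma ker_nonneg (t d : ℝ) : 0 ≤ ker t d := by rw [ker]; split_ifs <;> norm_num
lemma ker_anti (t : ℝ) {d d' : ℝ} (h : d ≤ d') : ker t d' ≤ ker t d := by
  rw [ker, ker]; split_ifs <;> linarith
lemma ker_meas (t : ℝ) : Measurable (ker t) := by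
  unfold ker
  exact Measurable.ite measurableSet_Iio measurable_const measurable_const

def NF {N : ℕ} (t : ℝ) (v : EE N → ℝ) (x y : EE N) : ℝ := (v x - v y)^2 * ker t (dist x y)

def NN {N : ℕ} (t : ℝ) (v : EE N → ℝ) : ℝ≥0∞ := ∫⁻ x, ∫⁻ y, ENNReal.ofReal (NF t v x y)

section
variable {N : ℕ} {σ : EE N → EE N} {A : Set (EE N)} {v : EE N → ℝ}

lemma NF_nonneg (t : ℝ) (v : EE N → ℝ) (x y : EE N) : 0 ≤ NF t v x y := mul_nonneg (sq_nonneg _) (ker_nonneg _ _)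

lemma NF_meas (t : ℝ) (hv : Continuous v) : Measurable fun p : EE N × EE N => ENNReal.ofReal (NF t v p.1 p.2) := by
  have : Measurable fun p : EE N × EE N => ker t (dist p.1 p.2) := (ker_meas t).comp (by fun_prop)
  have h2 : Measurable fun p : EE N × EE N => (v p.1 - v p.2)^2 := Continuous.measurable (by fun_prop)
  exact (h2.mul this).ennreal_ofReal

lemma quad (h : Refl σ A) {F : EE N → EE N → ℝ≥0∞} (hF : Measurable fun p : EE N × EE N => F p.1 p.2) :
    4 * ∫⁻ x, ∫⁻ y, F x y = ∫⁻ x, ∫⁻ y, (F x y + F x (σ y) + (F (σ x) y + F (σ x) (σ y))) := by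
  have hσ := h.mp.measurable
  have m1 : ∀ x, Measurable (F x) := fun x => hF.comp (by fun_prop : Measurable fun y => (x, y))
  have e1 : ∀ x, ∫⁻ y, (F x y + F x (σ y) + (F (σ x) y + F (σ x) (σ y))) = 2 * (∫⁻ y, F x y) + 2 * ∫⁻ y, F (σ x) y := by
    intro x
    have m3 : Measurable fun y => F x y + F x (σ y) := (m1 x).add ((m1 x).comp hσ)
    rw [lintegral_add_left m3, lintegral_add_left (m1 x), lintegral_add_left (m1 (σ x)),
      h.mp.lintegral_comp (m1 x), h.mp.lintegral_comp (m1 (σ x))]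
    ring
  simp only [e1]
  have m2 : Measurable fun x => ∫⁻ y, F x y := hF.lintegral_prod_right'
  have m4 : Measurable fun x => ∫⁻ y, F (σ x) y := m2.comp hσ
  rw [lintegral_add_left (m2.const_mul 2), lintegral_const_mul _ m2, lintegral_const_mul _ m4,
    h.mp.lintegral_comp m2]
  ring

lemma ineq4 {a b c d K1 K2 : ℝ} (h : K2 ≤ K1) :
    (max a b - max c d)^2 * K1 + (max a b - min c d)^2 * K2 + ((min a b - max c d)^2 * K2 + (min a b - min c d)^2 * K1)
    ≤ (a - c)^2 * K1 + (a - d)^2 * K2 + ((b - c)^2 * K2 + (b - d)^2 * K1) := by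
  rcases le_total a b with h1 | h1 <;> rcases le_total c d with h2 | h2 <;> simp only [h1, h2, max_eq_right, max_eq_left, min_eq_left, min_eq_right]
  · linarith
  · nlinarith [mul_nonneg (sub_nonneg.2 h) (mul_nonneg (sub_nonneg.2 h1) (sub_nonneg.2 h2))]
  · nlinarith [mul_nonneg (sub_nonneg.2 h) (mul_nonneg (sub_nonneg.2 h1) (sub_nonneg.2 h2))]
  · linarith

lemma pol_four (h : Refl σ A) (t : ℝ) (v : EE N → ℝ) (x y : EE N) :
    NF t (pol σ A v) x y + NF t (pol σ A v) x (σ y) + (NF t (pol σ A v) (σ x) y + NF t (pol σ A v) (σ x) (σ y)) ≤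
    NF t v x y + NF t v x (σ y) + (NF t v (σ x) y + NF t v (σ x) (σ y)) := by
  wlog hx : x ∈ A generalizing x
  · have := this (σ x) (h.out x hx)
    simp only [h.inv] at this
    linarith
  wlog hy : y ∈ A generalizing y
  · have := this (σ y) (h.out y hy)
    simp only [h.inv] at this
    linarith
  have d1 : dist (σ x) y = dist x (σ y) := by rw [← h.iso, h.inv]
  simp only [NF, pol_in hx, pol_in hy, pol_refl h hx, pol_refl h hy, h.iso, d1]
  exact ineq4 (ker_anti t (h.near x y hx hy))

lemma pol_NN (h : Refl σ A) {L : NNReal} (hL : LipschitzWith L v) (t : ℝ) : NN t (pol σ A v) ≤ NN t v := by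
  have e1 := quad (F := fun x y => ENNReal.ofReal (NF t (pol σ A v) x y)) h (NF_meas t (pol_lip h hL).continuous)
  have e2 := quad (F := fun x y => ENNReal.ofReal (NF t v x y)) h (NF_meas t hL.continuous)
  have : 4 * NN t (pol σ A v) ≤ 4 * NN t v := by
    rw [NN, NN, e1, e2]
    refine lintegral_mono fun x => lintegral_mono fun y => ?_
    dsimp only
    have hn := NF_nonneg t (pol σ A v)
    have hn' := NF_nonneg t v
    simp only [← ENNReal.ofReal_add (hn _ _) (hn _ _), ← ENNReal.ofReal_add (hn' _ _) (hn' _ _),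
      ← ENNReal.ofReal_add (add_nonneg (hn _ _) (hn _ _)) (add_nonneg (hn _ _) (hn _ _)),
      ← ENNReal.ofReal_add (add_nonneg (hn' _ _) (hn' _ _)) (add_nonneg (hn' _ _) (hn' _ _))]
    exact ENNReal.ofReal_le_ofReal (pol_four h t v x y)
  exact (ENNReal.mul_le_mul_iff_right (by norm_num) (by norm_num)).1 this

lemma cs_of {g : EE N → ℝ} {R : ℝ} (h : ∀ x, R ≤ ‖x‖ → g x = 0) : HasCompactSupport g := by
  apply HasCompactSupport.intro (isCompact_closedBall (0 : EE N) R)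
  intro x hx
  apply h
  simp at hx
  exact hx.le

lemma Refl.cont (h : Refl σ A) : Continuous σ := (Isometry.of_dist_eq h.iso).continuous

lemma Refl.emb (h : Refl σ A) : MeasurableEmbedding σ :=
  MeasurableEquiv.measurableEmbedding ⟨⟨σ, σ, h.inv, h.inv⟩, h.mp.measurable, h.mp.measurable⟩

lemma two_int (h : Refl σ A) {g : EE N → ℝ} (hg : Integrable g) : Integrable (fun x => g x + g (σ x)) ∧
    ∫ x, (g x + g (σ x)) = 2 * ∫ x, g x := by
  have h2 : Integrable (fun x => g (σ x)) := h.mp.integrable_comp_of_integrable hg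
  refine ⟨hg.add h2, ?_⟩
  rw [integral_add hg h2, h.mp.integral_comp h.emb]; ring

lemma pol_int (h : Refl σ A) (h0 : ∀ x, 0 ≤ v x) {L : NNReal} (hL : LipschitzWith L v) {R : ℝ} (hR : ∀ x, R ≤ ‖x‖ → v x = 0)
    {s : ℝ} (hs : 1 ≤ s) : ∫ x, pol σ A v x ^ s = ∫ x, v x ^ s := by
  have hI : ∀ g : EE N → ℝ, Continuous g → (∀ x, R ≤ ‖x‖ → g x = 0) → Integrable (fun x => g x ^ s) := by
    intro g hg hz
    apply Continuous.integrable_of_hasCompactSupport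
    · exact hg.rpow_const fun x => Or.inr (by linarith)
    · exact cs_of (R := R) fun x hx => by rw [hz x hx, Real.zero_rpow (by linarith)]
  have a1 := (two_int h (hI _ (pol_lip h hL).continuous (pol_supp h h0 hR))).2
  have a2 := (two_int h (hI _ hL.continuous hR)).2
  have : ∀ x, pol σ A v x ^ s + pol σ A v (σ x) ^ s = v x ^ s + v (σ x) ^ s := by
    intro x
    rcases pol_cases (v := v) h x with ⟨e, e'⟩ | ⟨e, e'⟩ <;> rw [e, e']
    ring
  simp only [this] at a1
  linarith

lemma pol_mom (h : Refl σ A) (h0 : ∀ x, 0 ≤ v x) {L : NNReal} (hL : LipschitzWith L v) {R : ℝ} (hR : ∀ x, R ≤ ‖x‖ → v x = 0)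
    {x : EE N} (hx : x ∈ A) (hlt : ‖x‖ < ‖σ x‖) (hv : v x < v (σ x)) :
    ∫ x, pol σ A v x * ‖x‖^2 < ∫ x, v x * ‖x‖^2 := by
  have hσ := h.cont
  have hp := (pol_lip h hL).continuous
  have hc := hL.continuous
  have i1 : Integrable (fun x => v x * ‖x‖^2) := Continuous.integrable_of_hasCompactSupport (by fun_prop)
    (cs_of (R := R) fun x hx => by rw [hR x hx, zero_mul])
  have i2 : Integrable (fun x => pol σ A v x * ‖x‖^2) := Continuous.integrable_of_hasCompactSupport (by fun_prop)
    (cs_of (R := R) fun x hx => by rw [pol_supp h h0 hR x hx, zero_mul])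
  have a0 := (two_int h (i1.sub i2)).2
  have e : ∀ x, (v x * ‖x‖^2 - pol σ A v x * ‖x‖^2) + (v (σ x) * ‖σ x‖^2 - pol σ A v (σ x) * ‖σ x‖^2) =
      (pol σ A v x - v x) * (‖σ x‖^2 - ‖x‖^2) := by
    intro x
    rcases pol_cases (v := v) h x with ⟨e, e'⟩ | ⟨e, e'⟩ <;> rw [e, e'] <;> ring
  simp only [Pi.sub_apply, e] at a0
  have pos : 0 < ∫ x, (pol σ A v x - v x) * (‖σ x‖^2 - ‖x‖^2) := by
    refine Continuous.integral_pos_of_hasCompactSupport_nonneg_nonzero (x := x) (by fun_prop)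
      (cs_of (R := R) fun x hx => by rw [pol_supp h h0 hR x hx, hR x hx, sub_self, zero_mul]) ?_ ?_
    · intro z
      by_cases hz : z ∈ A
      · have := h.nor z hz
        apply mul_nonneg
        · rw [pol_in hz]; exact sub_nonneg.2 (le_max_left _ _)
        · exact sub_nonneg.2 (pow_le_pow_left₀ (norm_nonneg _) this 2)
      · have := h.nor _ (h.out z hz)
        rw [h.inv] at this
        apply mul_nonneg_of_nonpos_of_nonpos
        · rw [pol_out hz]; exact sub_nonpos.2 (min_le_left _ _)
        · exact sub_nonpos.2 (pow_le_pow_left₀ (norm_nonneg _) this 2)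
    · rw [pol_in hx, max_eq_right hv.le]
      apply (mul_pos (sub_pos.2 hv) (sub_pos.2 (pow_lt_pow_left₀ hlt (norm_nonneg _) two_ne_zero))).ne'
  rw [a0] at pos
  have := integral_sub i1 i2
  linarith
end
end CM

namespace CM
open Set Topology Asymptotics Metric ENNReal

structure Cl {N : ℕ} (L : NNReal) (R : ℝ) (w v : EE N → ℝ) : Prop where
  nn : ∀ x, 0 ≤ v x
  lip : LipschitzWith L v
  sup : ∀ x, R ≤ ‖x‖ → v x = 0
  int : ∀ s : ℝ, 1 ≤ s → ∫ x, v x ^ s = ∫ x, w x ^ s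
  en : ∀ t, NN t v ≤ NN t w

lemma Cl.bdd {N : ℕ} (hN : 1 ≤ N) {L : NNReal} {R : ℝ} {w v : EE N → ℝ} (h : Cl L R w v) (x : EE N) :
    v x ≤ L * (‖x‖ + |R|) := by
  have : Nonempty (Fin N) := ⟨⟨0, hN⟩⟩
  let e : EE N := |R| • EuclideanSpace.single ⟨0, hN⟩ (1:ℝ)
  have he : ‖e‖ = |R| := by simp [e, norm_smul]
  have h1 := h.lip.dist_le_mul x e
  rw [h.sup e (by rw [he]; exact le_abs_self R), Real.dist_eq, sub_zero] at h1
  refine (le_abs_self _).trans (h1.trans (mul_le_mul_of_nonneg_left ?_ L.2))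
  rw [dist_eq_norm, ← he]
  exact norm_sub_le _ _

lemma Cl.bd {N : ℕ} (hN : 1 ≤ N) {L : NNReal} {R : ℝ} {w v : EE N → ℝ} (h : Cl L R w v) (x : EE N) :
    v x ≤ (closedBall (0 : EE N) |R|).indicator (fun _ => L * (|R| + |R|)) x := by
  by_cases hx : x ∈ closedBall (0 : EE N) |R|
  · rw [indicator_of_mem hx]
    refine (h.bdd hN x).trans (mul_le_mul_of_nonneg_left ?_ L.2)
    simp at hx
    linarith
  · rw [indicator_of_notMem hx, h.sup x]
    simp at hx
    exact (le_abs_self R).trans hx.le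

lemma Cl_compact {N : ℕ} (hN : 1 ≤ N) {L : NNReal} {R : ℝ} {w : EE N → ℝ} {v : ℕ → EE N → ℝ} (h : ∀ k, Cl L R w (v k)) :
    ∃ φ : ℕ → ℕ, StrictMono φ ∧ ∃ g : EE N → ℝ, ∀ x, Tendsto (fun k => v (φ k) x) atTop (𝓝 (g x)) := by
  let D := TopologicalSpace.denseSeq (EE N)
  have hK : IsCompact (Set.pi univ fun i : ℕ => Icc (0:ℝ) (L * (‖D i‖ + |R|))) :=
    isCompact_univ_pi fun x => isCompact_Icc
  obtain ⟨y, -, φ, hφ, hy⟩ := hK.tendsto_subseq (x := fun k i => v k (D i)) (fun k i _ =>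
    ⟨(h k).nn _, (h k).bdd hN _⟩)
  have hy' : ∀ i, Tendsto (fun k => v (φ k) (D i)) atTop (𝓝 (y i)) := fun x => (tendsto_pi_nhds.1 hy) x
  have hlim : ∀ x, ∃ l, Tendsto (fun k => v (φ k) x) atTop (𝓝 l) := by
    intro x
    apply cauchySeq_tendsto_of_complete
    rw [Metric.cauchySeq_iff]
    intro e he
    have hη : 0 < e / (3 * (L + 1)) := by positivity
    obtain ⟨i, hi⟩ := (TopologicalSpace.denseRange_denseSeq (EE N)).exists_dist_lt x hη
    obtain ⟨K, hKK⟩ := Metric.cauchySeq_iff.1 (hy' i).cauchySeq (e/3) (by positivity)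
    refine ⟨K, fun k hk l hl => ?_⟩
    have h1 := hKK k hk l hl
    have hb : ∀ k, dist (v (φ k) x) (v (φ k) (D i)) < e/3 := by
      intro k
      refine ((h (φ k)).lip.dist_le_mul _ _).trans_lt ?_
      have : (L:ℝ) * dist x (D i) ≤ L * (e / (3 * (L + 1))) := mul_le_mul_of_nonneg_left hi.le L.2
      refine this.trans_lt ?_
      have hL : (0:ℝ) ≤ L := L.2
      rw [← mul_div_assoc, div_lt_div_iff₀ (by positivity) (by positivity)]
      nlinarith
    have h2 := hb k
    have h3 := hb l
    calc dist (v (φ k) x) (v (φ l) x) ≤ dist (v (φ k) x) (v (φ k) (D i)) + dist (v (φ k) (D i)) (v (φ l) (D i)) + dist (v (φ l) (D i)) (v (φ l) x) := dist_triangle4 _ _ _ _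
      _ < e := by rw [dist_comm (v (φ l) (D i))]; linarith
  choose g hg using hlim
  exact ⟨φ, hφ, g, hg⟩

lemma Cl_lim {N : ℕ} (hN : 1 ≤ N) {L : NNReal} {R : ℝ} {w : EE N → ℝ} {v : ℕ → EE N → ℝ} (h : ∀ k, Cl L R w (v k))
    {g : EE N → ℝ} (hg : ∀ x, Tendsto (fun k => v k x) atTop (𝓝 (g x))) : Cl L R w g ∧
    Tendsto (fun k => ∫ x, v k x * ‖x‖^2) atTop (𝓝 (∫ x, g x * ‖x‖^2)) := by
  have hlip : LipschitzWith L g := by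
    apply LipschitzWith.of_dist_le_mul
    intro x y
    exact le_of_tendsto ((hg x).dist (hg y)) (Eventually.of_forall fun k => (h k).lip.dist_le_mul x y)
  have hnn : ∀ x, 0 ≤ g x := fun x => ge_of_tendsto (hg x) (Eventually.of_forall fun k => (h k).nn x)
  have hind : ∀ C : ℝ, Integrable ((closedBall (0 : EE N) |R|).indicator fun _ => C) := by
    intro C
    rw [integrable_indicator_iff measurableSet_closedBall]
    exact integrableOn_const (by exact (isCompact_closedBall _ _).measure_lt_top.ne)
  refine ⟨⟨hnn, hlip, ?_, ?_, ?_⟩, ?_⟩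
  · intro x hx
    refine tendsto_nhds_unique (hg x) ?_
    simp only [fun k => (h k).sup x hx]; exact tendsto_const_nhds
  · intro s hs
    have : Tendsto (fun k => ∫ x, v k x ^ s) atTop (𝓝 (∫ x, g x ^ s)) := by
      refine tendsto_integral_of_dominated_convergence ((closedBall (0 : EE N) |R|).indicator fun _ => (L * (|R| + |R|))^s) ?_ (hind _) ?_ ?_
      · intro k
        exact ((h k).lip.continuous.rpow_const fun x => Or.inr (by linarith)).aestronglyMeasurable
      · intro k
        refine Eventually.of_forall fun x => ?_
        have h1 := (h k).bd hN x
        rw [Real.norm_of_nonneg (Real.rpow_nonneg ((h k).nn x) _)]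
        by_cases hx : x ∈ closedBall (0 : EE N) |R|
        · rw [indicator_of_mem hx] at h1 ⊢
          exact Real.rpow_le_rpow ((h k).nn x) h1 (by linarith)
        · rw [indicator_of_notMem hx] at h1 ⊢
          rw [le_antisymm h1 ((h k).nn x), Real.zero_rpow (by linarith)]
      · refine Eventually.of_forall fun x => (hg x).rpow_const (Or.inr (by linarith))
    simp only [fun k => (h k).int s hs] at this
    exact tendsto_nhds_unique this tendsto_const_nhds
  · intro t
    have hP : ∀ u : EE N → ℝ, Continuous u → NN t u = ∫⁻ z : EE N × EE N, ENNReal.ofReal (NF t u z.1 z.2) := by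
      intro u hu
      exact (lintegral_prod _ (NF_meas t hu).aemeasurable).symm
    rw [hP g hlip.continuous]
    have hl : ∀ z : EE N × EE N, ENNReal.ofReal (NF t g z.1 z.2) = liminf (fun k => ENNReal.ofReal (NF t (v k) z.1 z.2)) atTop := by
      intro z
      refine (Tendsto.liminf_eq ?_).symm
      apply ENNReal.tendsto_ofReal
      exact (((hg z.1).sub (hg z.2)).pow 2).mul_const _
    simp only [hl]
    refine (lintegral_liminf_le fun k => NF_meas t (h k).lip.continuous).trans ?_
    simp only [← fun k => hP _ (h k).lip.continuous]
    exact (liminf_le_liminf (Eventually.of_forall fun k => (h k).en t)).trans (by simp)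
  · refine tendsto_integral_of_dominated_convergence ((closedBall (0 : EE N) |R|).indicator fun _ => (L * (|R| + |R|)) * |R|^2) ?_ (hind _) ?_ ?_
    · intro k
      have := (h k).lip.continuous
      exact Continuous.aestronglyMeasurable (by fun_prop)
    · intro k
      refine Eventually.of_forall fun x => ?_
      have h1 := (h k).bd hN x
      rw [Real.norm_of_nonneg (mul_nonneg ((h k).nn x) (by positivity))]
      by_cases hx : x ∈ closedBall (0 : EE N) |R|
      · rw [indicator_of_mem hx] at h1 ⊢
        simp at hx
        gcongr
      · rw [indicator_of_notMem hx] at h1 ⊢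
        rw [le_antisymm h1 ((h k).nn x), zero_mul]
    · exact Eventually.of_forall fun x => (hg x).mul_const _

lemma PS {N : ℕ} (hN : 1 ≤ N) {L : NNReal} {R : ℝ} {w : EE N → ℝ} (h0 : ∀ x, 0 ≤ w x) (hL : LipschitzWith L w)
    (hR : ∀ x, R ≤ ‖x‖ → w x = 0) : ∃ v, Cl L R w v ∧ ∀ x y, ‖x‖ ≤ ‖y‖ → v y ≤ v x := by
  let Φ : (EE N → ℝ) → ℝ := fun v => ∫ x, v x * ‖x‖^2
  let I : Set ℝ := Φ '' {v | Cl L R w v}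
  have hne : I.Nonempty := ⟨_, w, ⟨h0, hL, hR, fun _ _ => rfl, fun _ => le_rfl⟩, rfl⟩
  have hb : BddBelow I := ⟨0, by rintro _ ⟨v, hv, rfl⟩; exact integral_nonneg fun x => mul_nonneg (hv.nn x) (by positivity)⟩
  obtain ⟨a, -, ha, haI⟩ := exists_seq_tendsto_sInf hne hb
  choose v hv hva using haI
  obtain ⟨φ, hφ, g, hg⟩ := Cl_compact hN (v := v) hv
  obtain ⟨hc, hm⟩ := Cl_lim hN (fun k => hv (φ k)) hg
  have hm2 : Φ g = sInf I := by
    refine tendsto_nhds_unique hm ?_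
    have := ha.comp hφ.tendsto_atTop
    refine this.congr fun k => ?_
    exact (hva (φ k)).symm
  have hs : ∀ x y, ‖x‖ < ‖y‖ → g y ≤ g x := by
    intro x y hxy
    by_contra hlt
    push Not at hlt
    obtain ⟨σ, A, hr, hx, rfl⟩ := exists_refl hxy
    have h1 := pol_mom hr hc.nn hc.lip hc.sup hx hxy hlt
    have h2 : Cl L R w (pol σ A g) := ⟨pol_nonneg hc.nn, pol_lip hr hc.lip, pol_supp hr hc.nn hc.sup,
      fun s hs => (pol_int hr hc.nn hc.lip hc.sup hs).trans (hc.int s hs), fun t => (pol_NN hr hc.lip t).trans (hc.en t)⟩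
    have h3 : sInf I ≤ Φ (pol σ A g) := csInf_le hb ⟨_, h2, rfl⟩
    rw [← hm2] at h3
    exact absurd h1 (not_lt.2 h3)
  refine ⟨g, hc, fun x y hxy => ?_⟩
  rcases hxy.lt_or_eq with h | h
  · exact hs x y h
  · by_cases hy : y = 0
    · rw [hy, norm_zero, norm_eq_zero] at h
      rw [hy, h]
    · have hy0 : 0 < ‖y‖ := norm_pos_iff.2 hy
      have ht : Tendsto (fun s : ℝ => g (s • y)) (𝓝[>] 1) (𝓝 (g y)) := by
        have : Continuous fun s : ℝ => g (s • y) := hc.lip.continuous.comp (by fun_prop)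
        have := this.tendsto 1
        rw [one_smul] at this
        exact this.mono_left nhdsWithin_le_nhds
      refine le_of_tendsto ht ?_
      filter_upwards [self_mem_nhdsWithin] with s hs1
      apply hs
      have hs1 : 1 < s := hs1
      rw [h, norm_smul, Real.norm_of_nonneg (by linarith)]
      nlinarith
end CM

namespace CM
open Set Topology Asymptotics Metric ENNReal

lemma NN_DD {N : ℕ} {v : EE N → ℝ} (hv : Continuous v) {t : ℝ} (ht : 0 < t) :
    NN t v = ENNReal.ofReal (t^N) * DD t v := by
  rw [NN, DD, ← lintegral_const_mul' _ _ ENNReal.ofReal_ne_top]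
  congr 1; ext1 x
  have hm : Measurable fun y => ENNReal.ofReal (NF t v x y) :=
    (NF_meas t hv).comp (by fun_prop : Measurable fun y => (x, y))
  have hm2 : Measurable fun h => ENNReal.ofReal (NF t v x (x + h)) := hm.comp (by fun_prop : Measurable fun h => x + h)
  rw [← lintegral_add_left_eq_self _ x]
  have h1 := Measure.map_addHaar_smul (volume : Measure (EE N)) ht.ne'
  have h2 : ∫⁻ k, ENNReal.ofReal (NF t v x (x + t • k)) = ENNReal.ofReal |(t ^ N)⁻¹| * ∫⁻ h, ENNReal.ofReal (NF t v x (x + h)) := by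
    rw [← lintegral_map (f := fun h => ENNReal.ofReal (NF t v x (x + h))) (g := fun k => t • k) hm2 (by fun_prop), h1, lintegral_smul_measure]
    simp
  have h3 : ∀ k, ENNReal.ofReal (NF t v x (x + t • k)) = (ball (0 : EE N) 1).indicator (fun k => ‖v (x + t • k) - v x‖ₑ^2) k := by
    intro k
    rw [NF, ker, dist_self_add_right, norm_smul, Real.norm_of_nonneg ht.le]
    by_cases hk : k ∈ ball (0 : EE N) 1
    · rw [indicator_of_mem hk, if_pos, mul_one, ← ofReal_norm, ← ENNReal.ofReal_pow (norm_nonneg _), Real.norm_eq_abs, sq_abs,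
        ← neg_sub, neg_sq]
      simp at hk
      nlinarith
    · rw [indicator_of_notMem hk, if_neg, mul_zero, ENNReal.ofReal_zero]
      simp at hk
      nlinarith
  simp only [h3] at h2
  rw [lintegral_indicator measurableSet_ball] at h2
  rw [h2, ← mul_assoc, abs_of_pos (by positivity), ← ENNReal.ofReal_mul (by positivity), mul_inv_cancel₀ (by positivity), ENNReal.ofReal_one, one_mul]

lemma kap_linR {N : ℕ} (hN : 1 ≤ N) (l : EE N →L[ℝ] ℝ) :
    ∫ k in ball (0 : EE N) 1, ‖l k‖^2 = kap N * ∑ i, ‖l (EuclideanSpace.single i (1:ℝ))‖^2 := by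
  simp only [Real.norm_eq_abs, sq_abs]; exact kap_lin hN l

lemma DD_ge {N : ℕ} (hN : 1 ≤ N) {v : EE N → ℝ} {L : NNReal} (hL : LipschitzWith L v) {a : ℝ≥0∞}
    (h : ∀ t, 0 < t → DD t v ≤ ENNReal.ofReal (t^2 * kap N) * a) :
    ∫⁻ x, ENNReal.ofReal (gradSq v x) ≤ a := by
  have hκ := kap_pos hN
  have hc := hL.continuous
  obtain ⟨T, hT, hT0⟩ : ∃ T : ℕ → ℝ, (∀ j, 0 < T j) ∧ Tendsto T atTop (𝓝[≠] 0) := by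
    refine ⟨fun j => 1 / ((j:ℝ) + 1), fun j => by positivity, ?_⟩
    rw [tendsto_nhdsWithin_iff]
    exact ⟨tendsto_one_div_add_atTop_nhds_zero_nat, Eventually.of_forall fun j => (by positivity : (0:ℝ) < 1 / ((j:ℝ) + 1)).ne'⟩
  obtain ⟨F, hF⟩ : ∃ F : ℕ → EE N → EE N → ℝ≥0∞, ∀ j x k, F j x k = ENNReal.ofReal (((v (x + T j • k) - v x) / T j)^2) :=
    ⟨_, fun _ _ _ => rfl⟩
  have hFm : ∀ j, Measurable fun p : EE N × EE N => F j p.1 p.2 := by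
    intro j
    simp only [hF]
    exact (Continuous.measurable (by fun_prop)).ennreal_ofReal
  have hFm1 : ∀ j x, Measurable fun k => F j x k := by
    intro j x
    simp only [hF]
    exact (Continuous.measurable (by fun_prop)).ennreal_ofReal
  have hFD : ∀ j, ∫⁻ x, ∫⁻ k in ball (0 : EE N) 1, F j x k ≤ ENNReal.ofReal (kap N) * a := by
    intro j
    have e : ∀ x k, F j x k = ENNReal.ofReal ((T j^2)⁻¹) * ‖v (x + T j • k) - v x‖ₑ^2 := by
      intro x k
      rw [hF, ← ofReal_norm, ← ENNReal.ofReal_pow (norm_nonneg _), ← ENNReal.ofReal_mul (by positivity), Real.norm_eq_abs, sq_abs]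
      congr 1
      rw [div_pow, div_eq_inv_mul]
    simp only [e, lintegral_const_mul' _ _ ENNReal.ofReal_ne_top]
    refine (mul_le_mul_right (h (T j) (hT j)) _).trans ?_
    rw [← mul_assoc, ← ENNReal.ofReal_mul (by positivity), ← mul_assoc, inv_mul_cancel₀ (pow_pos (hT j) 2).ne', one_mul]
  have key : ∫⁻ x, ENNReal.ofReal (kap N) * ENNReal.ofReal (gradSq v x) ≤ ENNReal.ofReal (kap N) * a := by
    calc ∫⁻ x, ENNReal.ofReal (kap N) * ENNReal.ofReal (gradSq v x)
        = ∫⁻ x, ∫⁻ k in ball (0 : EE N) 1, liminf (fun j => F j x k) atTop := by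
          apply lintegral_congr_ae
          filter_upwards [hL.ae_differentiableAt] with x hx
          have e : ∀ k, liminf (fun j => F j x k) atTop = ENNReal.ofReal (‖fderiv ℝ v x k‖^2) := by
            intro k
            simp only [hF]
            apply Tendsto.liminf_eq
            apply ENNReal.tendsto_ofReal
            rw [Real.norm_eq_abs, sq_abs]
            apply Filter.Tendsto.pow
            have h1 := (hx.hasFDerivAt.hasLineDerivAt k).tendsto_slope_zero
            have h2 := h1.comp hT0
            refine h2.congr fun j => ?_
            simp only [Function.comp, smul_eq_mul]; rw [div_eq_inv_mul]
          simp only [e]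
          rw [← ofReal_integral_eq_lintegral_ofReal (ball_int (by fun_prop)) (Eventually.of_forall fun k => by positivity),
            kap_linR hN, ENNReal.ofReal_mul hκ.le, gradSq]
      _ ≤ ∫⁻ x, liminf (fun j => ∫⁻ k in ball (0 : EE N) 1, F j x k) atTop := by
          refine lintegral_mono fun x => lintegral_liminf_le fun j => hFm1 j x
      _ ≤ liminf (fun j => ∫⁻ x, ∫⁻ k in ball (0 : EE N) 1, F j x k) atTop :=
          lintegral_liminf_le fun j => (hFm j).lintegral_prod_right'
      _ ≤ _ := (liminf_le_liminf (Eventually.of_forall hFD)).trans (by simp)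
  rw [lintegral_const_mul' _ _ ENNReal.ofReal_ne_top] at key
  exact (ENNReal.mul_le_mul_iff_right (by simpa using hκ) ENNReal.ofReal_ne_top).1 key

lemma norm_fd {N : ℕ} {x : EE N} (hx : x ≠ 0) : HasFDerivAt (fun y : EE N => ‖y‖) (‖x‖⁻¹ • innerSL ℝ x) x := by
  have hx0 : 0 < ‖x‖ := norm_pos_iff.2 hx
  have h1 := (hasStrictFDerivAt_norm_sq x).hasFDerivAt.sqrt (by positivity)
  simp only [Real.sqrt_sq (norm_nonneg _)] at h1
  refine h1.congr_fderiv ?_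
  ext y
  simp
  field_simp

lemma grad_rad {N : ℕ} {v : EE N → ℝ} {f : ℝ → ℝ} (hv : ∀ x, v x = f ‖x‖) {x : EE N} (hx : x ≠ 0)
    (hd : DifferentiableAt ℝ v x) : gradSq v x = (deriv f ‖x‖)^2 := by
  have hx0 : 0 < ‖x‖ := norm_pos_iff.2 hx
  have hf : DifferentiableAt ℝ f ‖x‖ := by
    have h1 : f =ᶠ[𝓝 ‖x‖] fun r => v ((r / ‖x‖) • x) := by
      filter_upwards [Ioi_mem_nhds hx0] with r hr
      have hr : 0 < r := hr
      rw [hv, norm_smul, Real.norm_of_nonneg (by positivity), div_mul_cancel₀ _ hx0.ne']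
    refine DifferentiableAt.congr_of_eventuallyEq ?_ h1
    have h2 : DifferentiableAt ℝ v ((‖x‖ / ‖x‖) • x) := by rwa [div_self hx0.ne', one_smul]
    exact h2.comp ‖x‖ (f := fun r : ℝ => (r / ‖x‖) • x) (by fun_prop)
  have h3 : HasFDerivAt v (deriv f ‖x‖ • (‖x‖⁻¹ • innerSL ℝ x)) x := by
    have := hf.hasDerivAt.comp_hasFDerivAt x (norm_fd hx)
    refine this.congr_of_eventuallyEq (Eventually.of_forall fun y => hv y)
  rw [gradSq, h3.fderiv]
  simp only [smul_apply, innerSL_apply_apply, EuclideanSpace.inner_single_right, smul_eq_mul, norm_mul, mul_pow]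
  simp only [Real.norm_eq_abs, sq_abs, ← Finset.mul_sum]
  simp
  rw [← EuclideanSpace.real_norm_sq_eq]
  field_simp

def cN (N : ℕ) : ℝ := N * volume.real (ball (0 : EE N) 1)

lemma cN_pos {N : ℕ} (hN : 1 ≤ N) : 0 < cN N := by
  have : 0 < volume.real (ball (0 : EE N) 1) := by
    rw [measureReal_def]
    exact ENNReal.toReal_pos (measure_ball_pos _ _ one_pos).ne' measure_ball_lt_top.ne
  have : (0:ℝ) < N := by exact_mod_cast hN
  rw [cN]; positivity

lemma polar {N : ℕ} (hN : 1 ≤ N) (g : ℝ → ℝ) : ∫ x : EE N, g ‖x‖ = cN N * ∫ r in Ioi 0, r^((N:ℝ)-1) * g r := by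
  have : Nontrivial (EE N) := by
    have : Nonempty (Fin N) := ⟨⟨0, hN⟩⟩
    infer_instance
  rw [integral_fun_norm_addHaar]
  simp only [finrank_euclideanSpace, Fintype.card_fin, nsmul_eq_mul, smul_eq_mul, cN, mul_assoc]
  congr 2
  apply setIntegral_congr_fun measurableSet_Ioi
  intro r hr
  dsimp only
  rw [← Real.rpow_natCast, Nat.cast_sub hN, Nat.cast_one]

lemma polar_int {N : ℕ} (hN : 1 ≤ N) {g : ℝ → ℝ} (h : IntegrableOn (fun r => r^((N:ℝ)-1) * g r) (Ioi 0)) :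
    Integrable (fun x : EE N => g ‖x‖) := by
  have : Nontrivial (EE N) := by
    have : Nonempty (Fin N) := ⟨⟨0, hN⟩⟩
    infer_instance
  rw [integrable_fun_norm_addHaar]
  simp only [finrank_euclideanSpace, Fintype.card_fin, smul_eq_mul]
  refine h.congr_fun ?_ measurableSet_Ioi
  intro r hr
  dsimp only
  rw [← Real.rpow_natCast, Nat.cast_sub hN, Nat.cast_one]

lemma rad_lint {N : ℕ} (hN : 1 ≤ N) {v : EE N → ℝ} {f : ℝ → ℝ} (hf : Prof f) (hv : ∀ x, v x = f ‖x‖) {L : NNReal}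
    (hL : LipschitzWith L v) : ∫⁻ x, ENNReal.ofReal (gradSq v x) = ENNReal.ofReal (cN N * Af N f) := by
  have hn : (1:ℝ) ≤ N := by exact_mod_cast hN
  have : Nontrivial (EE N) := by
    have : Nonempty (Fin N) := ⟨⟨0, hN⟩⟩
    infer_instance
  have h1 : ∀ᵐ x : EE N, x ≠ 0 := by
    rw [ae_iff]; simp
  have : ∫⁻ x, ENNReal.ofReal (gradSq v x) = ∫⁻ x : EE N, ENNReal.ofReal ((deriv f ‖x‖)^2) := by
    apply lintegral_congr_ae
    filter_upwards [h1, hL.ae_differentiableAt] with x hx hd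
    rw [grad_rad hv hx hd]
  rw [this, ← ofReal_integral_eq_lintegral_ofReal (polar_int hN (g := fun r => (deriv f r)^2) (hf.intA hn)) (Eventually.of_forall fun k => by positivity),
    polar hN (fun r => (deriv f r)^2), Af]

lemma L0 {N : ℕ} (hN : 1 ≤ N) {L : NNReal} {R : ℝ} {w : EE N → ℝ} (h0 : ∀ x, 0 ≤ w x) (hL : LipschitzWith L w)
    (hR : ∀ x, R ≤ ‖x‖ → w x = 0) {a : ℝ} (ha : 0 ≤ a) (hD : ∀ t, 0 < t → DD t w ≤ ENNReal.ofReal (t^2 * kap N) * ENNReal.ofReal a) :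
    ∃ f, Dec f ∧ cN N * Af N f ≤ a ∧ ∀ s : ℝ, 1 ≤ s → cN N * Pf N s f = ∫ x, w x ^ s := by
  obtain ⟨v, hc, hm⟩ := PS hN h0 hL hR
  let e : EE N := EuclideanSpace.single ⟨0, hN⟩ (1:ℝ)
  have he : ‖e‖ = 1 := by simp [e]
  have hne : ∀ r : ℝ, ‖r • e‖ = |r| := fun r => by rw [norm_smul, he, mul_one, Real.norm_eq_abs]
  let f : ℝ → ℝ := fun r => v (r • e)
  have hv : ∀ x, v x = f ‖x‖ := by
    intro x
    have : ‖‖x‖ • e‖ = ‖x‖ := by rw [hne, abs_norm]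
    exact le_antisymm (hm _ _ this.le) (hm _ _ this.ge)
  have hl : LipschitzWith 1 (fun s : ℝ => s • e) := by
    apply LipschitzWith.of_dist_le_mul
    intro a b
    rw [dist_eq_norm, ← sub_smul, hne, NNReal.coe_one, one_mul, Real.dist_eq]
  have hP : Prof f := ⟨⟨_, hc.lip.comp hl⟩, |R| + 1, by positivity, fun r hr => hc.sup _ (by
    rw [hne]; exact (le_abs_self R).trans ((by linarith : |R| ≤ |R| + 1).trans (hr.trans (le_abs_self r))))⟩
  have hDec : Dec f := ⟨hP, fun r => hc.nn _, fun r hr s hs hrs => hm _ _ (by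
    rw [hne, hne, abs_of_pos hr, abs_of_pos hs]; exact hrs)⟩
  refine ⟨f, hDec, ?_, ?_⟩
  · have h1 : ∫⁻ x, ENNReal.ofReal (gradSq v x) ≤ ENNReal.ofReal a := by
      refine DD_ge hN hc.lip fun t ht => le_trans ?_ (hD t ht)
      have := hc.en t
      rw [NN_DD hc.lip.continuous ht, NN_DD hL.continuous ht] at this
      exact (ENNReal.mul_le_mul_iff_right (by simpa using pow_pos ht N) ENNReal.ofReal_ne_top).1 this
    rw [rad_lint hN hP hv hc.lip, ENNReal.ofReal_le_ofReal_iff ha] at h1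
    exact h1
  · intro s hs
    rw [← hc.int s hs, Pf, ← polar hN (fun r => |f r|^s)]
    congr 1; ext x
    rw [← hv, abs_of_nonneg (hc.nn x)]

lemma L1 {N : ℕ} (hN : 1 ≤ N) : GNall N := by
  intro F a m hF ha hm hA hM
  have hn : (1:ℝ) ≤ N := by exact_mod_cast hN
  have hc := cN_pos hN
  obtain ⟨L, hL⟩ := hF.1
  obtain ⟨R, hR, hz⟩ := hF.2
  let V : EE N → ℝ := fun x => F ‖x‖
  have hV : LipschitzWith L V := by
    have := hL.comp (lipschitzWith_one_norm (E := EE N))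
    rwa [mul_one] at this
  have hVV : LipschitzWith L (fun x => |V x|) := by
    have := (lipschitzWith_one_norm (E := ℝ)).comp hV
    rwa [one_mul] at this
  obtain ⟨f, hf, hfA, hfP⟩ := L0 hN (fun x => abs_nonneg (V x)) hVV (R := R) (fun x hx => by
    show |F ‖x‖| = 0
    rw [hz _ hx, abs_zero]) (mul_nonneg hc.le (Af_nonneg N F)) (fun t ht => by
      rw [← rad_lint hN hF (v := V) (fun x => rfl) hV]
      refine le_trans ?_ (DD_le (kap_linR hN) hV.continuous (FT_lip hV) hV.ae_differentiableAt t)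
      refine lintegral_mono fun x => lintegral_mono fun k => ?_
      apply pow_le_pow_left₀ zero_le
      rw [← ofReal_norm, ← ofReal_norm]
      apply ENNReal.ofReal_le_ofReal
      exact abs_abs_sub_abs_le _ _)
  have e : ∀ s : ℝ, 1 ≤ s → Pf N s f = Pf N s F := by
    intro s hs
    have := hfP s hs
    exact mul_left_cancel₀ hc.ne' (this.trans (polar hN (fun r => |F r|^s)))
  have h2 := qq_gt (n := N) hn
  rw [← e _ (by linarith)]
  rw [← e 2 (by norm_num)] at hM
  exact GNdec hn hf ha hm ((le_of_mul_le_mul_left hfA hc).trans hA) hM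
end CM

namespace CM
open Set Topology Asymptotics Metric ENNReal

def PP {N : ℕ} {F : Type*} [NormedAddCommGroup F] (s : ℝ) (v : EE N → F) : ℝ≥0∞ := ∫⁻ x, ‖v x‖ₑ^s

lemma avg_PP {N : ℕ} {U : EE N → ℝ} (hU : Continuous U) (μ : Measure (EE N)) [IsProbabilityMeasure μ] {s : ℝ} (hs : 1 ≤ s) :
    PP s (fun x => ∫ y, U (x - y) ∂μ) ≤ PP s U := by
  have hs0 : 0 ≤ s := by linarith
  have hm : Measurable fun p : EE N × EE N => ‖U (p.1 - p.2)‖ₑ^s :=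
    (Continuous.measurable (by fun_prop : Continuous fun p : EE N × EE N => U (p.1 - p.2))).enorm.pow_const s
  calc PP s (fun x => ∫ y, U (x - y) ∂μ) ≤ ∫⁻ x, ∫⁻ y, ‖U (x - y)‖ₑ^s ∂μ := by
        refine lintegral_mono fun x => ?_
        refine (ENNReal.rpow_le_rpow (enorm_integral_le_lintegral_enorm _) hs0).trans (jen ?_ hs)
        exact (Continuous.measurable (by fun_prop : Continuous fun y => U (x - y))).enorm.aemeasurable
    _ = ∫⁻ y, ∫⁻ x, ‖U (x - y)‖ₑ^s ∂volume ∂μ := lintegral_lintegral_swap hm.aemeasurable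
    _ = ∫⁻ y, PP s U ∂μ := by
        congr 1; ext1 y
        exact lintegral_sub_right_eq_self (fun x => ‖U x‖ₑ^s) y
    _ = PP s U := by simp

lemma avg_DD {N : ℕ} {U : EE N → ℝ} (hU : Continuous U) (hs : HasCompactSupport U) (μ : Measure (EE N)) [IsProbabilityMeasure μ] (t : ℝ) :
    DD t (fun x => ∫ y, U (x - y) ∂μ) ≤ DD t U := by
  have hi : ∀ x, Integrable (fun y => U (x - y)) μ := by
    intro x
    obtain ⟨C, hC⟩ := hs.exists_bound_of_continuous hU
    exact Integrable.of_bound (by fun_prop : Continuous fun y => U (x - y)).aestronglyMeasurable C (Eventually.of_forall fun y => hC _)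
  have hm : Measurable fun p : (EE N × EE N) × EE N => ‖U (p.1.1 + t • p.2 - p.1.2) - U (p.1.1 - p.1.2)‖ₑ^2 :=
    (Continuous.measurable (by fun_prop : Continuous fun p : (EE N × EE N) × EE N => U (p.1.1 + t • p.2 - p.1.2) - U (p.1.1 - p.1.2))).enorm.pow_const 2
  calc DD t (fun x => ∫ y, U (x - y) ∂μ) ≤ ∫⁻ x, ∫⁻ k in ball (0 : EE N) 1, ∫⁻ y, ‖U (x + t • k - y) - U (x - y)‖ₑ^2 ∂μ := by
        refine lintegral_mono fun x => lintegral_mono fun k => ?_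
        dsimp only
        rw [← integral_sub (hi _) (hi _)]
        have := jen (μ := μ) (f := fun y => ‖U (x + t • k - y) - U (x - y)‖ₑ)
          (Continuous.measurable (by fun_prop : Continuous fun y => U (x + t • k - y) - U (x - y))).enorm.aemeasurable one_le_two
        simp only [ENNReal.rpow_two] at this
        exact (pow_le_pow_left₀ zero_le (enorm_integral_le_lintegral_enorm _) 2).trans this
    _ = ∫⁻ x, ∫⁻ y, ∫⁻ k in ball (0 : EE N) 1, ‖U (x + t • k - y) - U (x - y)‖ₑ^2 ∂volume ∂μ := by
        congr 1; ext1 x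
        apply lintegral_lintegral_swap
        exact ((Continuous.measurable (by fun_prop : Continuous fun p : EE N × EE N => U (x + t • p.1 - p.2) - U (x - p.2))).enorm.pow_const 2).aemeasurable
    _ = ∫⁻ y, ∫⁻ x, ∫⁻ k in ball (0 : EE N) 1, ‖U (x + t • k - y) - U (x - y)‖ₑ^2 ∂volume ∂volume ∂μ := by
        apply lintegral_lintegral_swap
        exact (hm.lintegral_prod_right' (ν := volume.restrict (ball (0 : EE N) 1))).aemeasurable
    _ = ∫⁻ y, DD t U ∂μ := by
        congr 1; ext1 y
        rw [DD, ← lintegral_sub_right_eq_self (fun x => ∫⁻ k in ball (0 : EE N) 1, ‖U (x + t • k) - U x‖ₑ^2) y]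
        simp only [sub_add_eq_add_sub]
    _ = DD t U := by simp

open ContinuousLinearMap Convolution in
lemma moll {N : ℕ} {U : EE N → ℝ} (hU : Continuous U) (h0 : ∀ x, 0 ≤ U x) {R : ℝ} (hR : ∀ x, R ≤ ‖x‖ → U x = 0) {q : ℝ}
    {b : ℝ≥0∞} (hb : b < PP q U) : ∃ (w : EE N → ℝ) (L : NNReal) (R' : ℝ), (∀ x, 0 ≤ w x) ∧ LipschitzWith L w ∧
      (∀ x, R' ≤ ‖x‖ → w x = 0) ∧ (∀ t, DD t w ≤ DD t U) ∧ (∀ s : ℝ, 1 ≤ s → PP s w ≤ PP s U) ∧ b < PP q w := by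
  have hcs : HasCompactSupport U := cs_of hR
  have hUi : Integrable U := hU.integrable_of_hasCompactSupport hcs
  let φ : ℕ → ContDiffBump (0 : EE N) := fun j => ⟨1 / (2 * ((j:ℝ) + 1)), 1 / ((j:ℝ) + 1), by positivity, by
    apply one_div_lt_one_div_of_lt (by positivity); have : (0:ℝ) ≤ j := by positivity
    linarith⟩
  let η : ℕ → EE N → ℝ := fun j => (φ j).normed volume
  let w : ℕ → EE N → ℝ := fun j => (η j) ⋆[lsmul ℝ ℝ, volume] U
  have hηc : ∀ j, Continuous (η j) := fun j => (φ j).continuous_normed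
  have hlip : ∀ j, ∃ L, LipschitzWith L (w j) := by
    intro j
    obtain ⟨K, hK⟩ := ContDiff.lipschitzWith_of_hasCompactSupport (φ j).hasCompactSupport_normed ((φ j).contDiff_normed (n := 1) (μ := volume)) one_ne_zero
    have hi : ∀ x, Integrable (fun y => η j (x - y) * U y) := by
      intro x
      have := hηc j
      exact Continuous.integrable_of_hasCompactSupport (by fun_prop) hcs.mul_left
    refine ⟨K * (∫ y, |U y|).toNNReal, LipschitzWith.of_dist_le_mul fun x x' => ?_⟩
    have e : ∀ x, w j x = ∫ y, η j (x - y) * U y := fun x => convolution_lsmul_swap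
    rw [Real.dist_eq, e, e, ← integral_sub (hi _) (hi _), NNReal.coe_mul, Real.coe_toNNReal _ (integral_nonneg fun _ => abs_nonneg _)]
    calc |∫ y, (η j (x - y) * U y - η j (x' - y) * U y)| ≤ ∫ y, |η j (x - y) * U y - η j (x' - y) * U y| := abs_integral_le_integral_abs
      _ ≤ ∫ y, (K * dist x x') * |U y| := by
          apply integral_mono ((hi x).sub (hi x')).abs (hUi.abs.const_mul _)
          intro y
          show |η j (x - y) * U y - η j (x' - y) * U y| ≤ _
          rw [← sub_mul, abs_mul]
          apply mul_le_mul_of_nonneg_right _ (abs_nonneg _)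
          have := hK.dist_le_mul (x - y) (x' - y)
          rwa [dist_sub_right, Real.dist_eq] at this
      _ = _ := by rw [integral_const_mul]; ring
  choose L hL using hlip
  have hw : ∀ j, ∃ μ : Measure (EE N), IsProbabilityMeasure μ ∧ w j = fun x => ∫ y, U (x - y) ∂μ := by
    intro j
    have hm : Measurable fun x => ENNReal.ofReal (η j x) := (hηc j).measurable.ennreal_ofReal
    refine ⟨volume.withDensity fun x => ENNReal.ofReal (η j x), ⟨?_⟩, ?_⟩
    · rw [withDensity_apply _ MeasurableSet.univ, Measure.restrict_univ,
        ← ofReal_integral_eq_lintegral_ofReal (φ j).integrable_normed (Eventually.of_forall fun x => (φ j).nonneg_normed x),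
        (φ j).integral_normed, ENNReal.ofReal_one]
    · ext x
      rw [integral_withDensity_eq_integral_toReal_smul hm (Eventually.of_forall fun x => ENNReal.ofReal_lt_top)]
      have e : ∀ x, (ENNReal.ofReal (η j x)).toReal = η j x := fun x => ENNReal.toReal_ofReal ((φ j).nonneg_normed x)
      simp only [e]
      exact convolution_lsmul
  have hlim : ∀ x, Tendsto (fun j => w j x) atTop (𝓝 (U x)) := fun x =>
    ContDiffBump.convolution_tendsto_right_of_continuous (tendsto_one_div_add_atTop_nhds_zero_nat) hU x
  have hfin : ∀ᶠ j in atTop, b < PP q (w j) := by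
    refine eventually_lt_of_lt_liminf (hb.trans_le ?_)
    have : PP q U = ∫⁻ x, liminf (fun j => ‖w j x‖ₑ^q) atTop := by
      refine lintegral_congr fun x => (Tendsto.liminf_eq ?_).symm
      exact ((ENNReal.continuous_rpow_const (y := q)).tendsto _).comp ((continuous_enorm.tendsto _).comp (hlim x))
    rw [this]
    exact lintegral_liminf_le fun j => (hL j).continuous.measurable.enorm.pow_const q
  obtain ⟨j, hj⟩ := hfin.exists
  obtain ⟨μ, hμ, hwμ⟩ := hw j
  refine ⟨w j, L j, R + (φ j).rOut, ?_, hL j, ?_, ?_, ?_, hj⟩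
  · intro x; rw [hwμ]; exact integral_nonneg fun y => h0 _
  · intro x hx
    have e : w j x = ∫ y, η j y • U (x - y) := convolution_lsmul
    rw [e]
    have : ∀ y, η j y • U (x - y) = 0 := by
      intro y
      by_cases hy : y ∈ ball (0 : EE N) (φ j).rOut
      · rw [hR, smul_zero]
        simp at hy
        have := norm_sub_norm_le x y
        linarith
      · rw [← (φ j).support_normed_eq (μ := volume), Function.notMem_support] at hy
        show (φ j).normed volume y • _ = 0
        rw [hy, zero_smul]
    simp only [this, integral_zero]
  · intro t; rw [hwμ]; exact avg_DD hU hcs μ t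
  · intro s hs; rw [hwμ]; exact avg_PP hU μ hs
end CM

namespace CM
open Set Topology Asymptotics Metric ENNReal

def chi {N : ℕ} (k : ℝ) (x : EE N) : ℝ := max 0 (min 1 (2 - ‖x‖ / k))

section
variable {N : ℕ} {k : ℝ}
lemma chi_nonneg (x : EE N) : 0 ≤ chi k x := le_max_left _ _
lemma chi_le (x : EE N) : chi k x ≤ 1 := max_le zero_le_one (min_le_left _ _)
lemma chi_cont : Continuous (chi k : EE N → ℝ) := by unfold chi; fun_prop
lemma chi_one (hk : 0 < k) {x : EE N} (hx : ‖x‖ ≤ k) : chi k x = 1 := by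
  have : ‖x‖ / k ≤ 1 := (div_le_one hk).2 hx
  rw [chi, min_eq_left (by linarith), max_eq_right zero_le_one]
lemma chi_zero (hk : 0 < k) {x : EE N} (hx : 2 * k ≤ ‖x‖) : chi k x = 0 := by
  have : 2 ≤ ‖x‖ / k := (le_div_iff₀ hk).2 hx
  rw [chi, max_eq_left]
  exact (min_le_right _ _).trans (by linarith)
lemma chi_lip (hk : 0 < k) (x y : EE N) : |chi k x - chi k y| ≤ ‖x - y‖ / k := by
  have h1 : |chi k x - chi k y| ≤ |min 1 (2 - ‖x‖ / k) - min 1 (2 - ‖y‖ / k)| := by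
    have := abs_max_sub_max_le_max 0 (min 1 (2 - ‖x‖ / k)) 0 (min 1 (2 - ‖y‖ / k))
    rw [sub_self, abs_zero] at this
    exact this.trans (max_eq_right (abs_nonneg _)).le
  have h2 : |min 1 (2 - ‖x‖ / k) - min 1 (2 - ‖y‖ / k)| ≤ |(2 - ‖x‖ / k) - (2 - ‖y‖ / k)| := by
    have := abs_min_sub_min_le_max 1 (2 - ‖x‖ / k) 1 (2 - ‖y‖ / k)
    rw [sub_self, abs_zero] at this
    exact this.trans (max_eq_right (abs_nonneg _)).le
  refine h1.trans (h2.trans ?_)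
  rw [show (2 - ‖x‖ / k) - (2 - ‖y‖ / k) = (‖y‖ - ‖x‖) / k by ring, abs_div, abs_of_pos hk, norm_sub_rev]
  gcongr
  exact abs_norm_sub_norm_le y x

lemma young {a b δ : ℝ} (hδ : 0 < δ) : (a + b)^2 ≤ (1 + δ) * a^2 + (1 + δ⁻¹) * b^2 := by
  have : 0 ≤ (δ * a - b)^2 * δ⁻¹ := by positivity
  have e : (δ * a - b)^2 * δ⁻¹ = δ * a^2 - 2 * a * b + δ⁻¹ * b^2 := by field_simp; ring
  nlinarith

lemma cut_pt (hk : 0 < k) (u : EE N → ℂ) {δ : ℝ} (hδ : 0 < δ) (x h : EE N) {t : ℝ} (ht : ‖h‖ ≤ t) :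
    ‖chi k (x + h) * ‖u (x + h)‖ - chi k x * ‖u x‖‖ₑ^2 ≤
      ENNReal.ofReal (1 + δ) * ‖u (x + h) - u x‖ₑ^2 + ENNReal.ofReal ((1 + δ⁻¹) * (t / k)^2) * ‖u (x + h)‖ₑ^2 := by
  have ht0 : 0 ≤ t := (norm_nonneg _).trans ht
  simp only [← ofReal_norm, ← ENNReal.ofReal_pow (norm_nonneg _)]
  rw [← ENNReal.ofReal_mul (by positivity), ← ENNReal.ofReal_mul (by positivity), ← ENNReal.ofReal_add (by positivity) (by positivity)]
  apply ENNReal.ofReal_le_ofReal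
  have h1 : |chi k (x + h) * ‖u (x + h)‖ - chi k x * ‖u x‖| ≤ ‖u (x+h) - u x‖ + t / k * ‖u (x + h)‖ := by
    rw [show chi k (x + h) * ‖u (x + h)‖ - chi k x * ‖u x‖ = chi k x * (‖u (x+h)‖ - ‖u x‖) + (chi k (x+h) - chi k x) * ‖u (x+h)‖ by ring]
    refine (abs_add_le _ _).trans ?_
    rw [abs_mul, abs_mul, abs_norm, abs_of_nonneg (chi_nonneg x)]
    have a1 := abs_norm_sub_norm_le (u (x+h)) (u x)
    have a2 := chi_lip hk (x+h) x
    rw [add_sub_cancel_left] at a2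
    have a3 : |chi k (x+h) - chi k x| ≤ t / k := a2.trans (by gcongr)
    have a4 := mul_le_mul_of_nonneg_right a3 (norm_nonneg (u (x+h)))
    have a5 := mul_le_mul_of_nonneg_right (chi_le (k := k) x) (abs_nonneg (‖u (x+h)‖ - ‖u x‖))
    linarith
  rw [Real.norm_eq_abs]
  refine (pow_le_pow_left₀ (abs_nonneg _) h1 2).trans ((young hδ).trans (le_of_eq ?_))
  ring

lemma cut_DD (hk : 0 < k) {u : EE N → ℂ} (hu : Continuous u) {δ : ℝ} (hδ : 0 < δ) {t : ℝ} (ht : 0 < t) :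
    DD t (fun x => chi k x * ‖u x‖) ≤ ENNReal.ofReal (1 + δ) * DD t u +
      ENNReal.ofReal ((1 + δ⁻¹) * (t / k)^2) * (volume (ball (0 : EE N) 1) * ∫⁻ x, ‖u x‖ₑ^2) := by
  have m1 : Measurable fun p : EE N × EE N => ‖u (p.1 + t • p.2) - u p.1‖ₑ^2 :=
    (Continuous.measurable (by fun_prop : Continuous fun p : EE N × EE N => u (p.1 + t • p.2) - u p.1)).enorm.pow_const 2
  have m2 : Measurable fun p : EE N × EE N => ‖u (p.1 + t • p.2)‖ₑ^2 :=
    (Continuous.measurable (by fun_prop : Continuous fun p : EE N × EE N => u (p.1 + t • p.2))).enorm.pow_const 2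
  have m1' : ∀ x, Measurable fun y : EE N => ‖u (x + t • y) - u x‖ₑ^2 := fun x =>
    (Continuous.measurable (by fun_prop : Continuous fun y : EE N => u (x + t • y) - u x)).enorm.pow_const 2
  calc DD t (fun x => chi k x * ‖u x‖) ≤ ∫⁻ x, ∫⁻ y in ball (0 : EE N) 1, (ENNReal.ofReal (1 + δ) * ‖u (x + t • y) - u x‖ₑ^2 +
        ENNReal.ofReal ((1 + δ⁻¹) * (t / k)^2) * ‖u (x + t • y)‖ₑ^2) := by
        refine lintegral_mono fun x => setLIntegral_mono' measurableSet_ball fun y hy => ?_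
        apply cut_pt hk u hδ
        simp at hy
        rw [norm_smul, Real.norm_of_nonneg ht.le]
        nlinarith
    _ = ENNReal.ofReal (1 + δ) * DD t u + ENNReal.ofReal ((1 + δ⁻¹) * (t / k)^2) * ∫⁻ x, ∫⁻ y in ball (0 : EE N) 1, ‖u (x + t • y)‖ₑ^2 := by
        simp only [fun x => lintegral_add_left (μ := volume.restrict (ball (0 : EE N) 1)) ((m1' x).const_mul (ENNReal.ofReal (1 + δ)))
          (fun y => ENNReal.ofReal ((1 + δ⁻¹) * (t / k)^2) * ‖u (x + t • y)‖ₑ^2), lintegral_const_mul' _ _ ENNReal.ofReal_ne_top]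
        rw [lintegral_add_left, lintegral_const_mul' _ _ ENNReal.ofReal_ne_top, lintegral_const_mul' _ _ ENNReal.ofReal_ne_top, DD]
        exact (m1.lintegral_prod_right' (ν := volume.restrict (ball (0 : EE N) 1))).const_mul _
    _ = _ := by
        congr 2
        rw [lintegral_lintegral_swap m2.aemeasurable]
        have : ∀ y : EE N, ∫⁻ x, ‖u (x + t • y)‖ₑ^2 = ∫⁻ x, ‖u x‖ₑ^2 := fun y => lintegral_add_right_eq_self (fun x => ‖u x‖ₑ^2) _
        simp only [this, lintegral_const, Measure.restrict_apply MeasurableSet.univ, univ_inter]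
        rw [mul_comm]
end

lemma PP_of {N : ℕ} {F : Type*} [NormedAddCommGroup F] {s : ℝ} (hs : 0 ≤ s) (v : EE N → F) :
    PP s v = ∫⁻ x, ENNReal.ofReal (‖v x‖^s) := by
  rw [PP]; congr 1; ext1 x
  rw [← ofReal_norm, ENNReal.ofReal_rpow_of_nonneg (norm_nonneg _) hs]

lemma L2 {N : ℕ} (hN : 1 ≤ N) {u : EE N → ℂ} (hu : Differentiable ℝ u) (h2 : Integrable fun x => ‖u x‖^2)
    (hg : Integrable fun x => gradSq u x) {ε : ℝ} (hε : 0 < ε) {q : ℝ} (hq : 1 ≤ q) {b : ℝ≥0∞} (hb : b < PP q u) :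
    ∃ f, Dec f ∧ cN N * Af N f ≤ (∫ x, gradSq u x) + ε ∧ (∀ s : ℝ, 1 ≤ s → ENNReal.ofReal (cN N * Pf N s f) ≤ PP s u) ∧
      b < ENNReal.ofReal (cN N * Pf N q f) := by
  have hκ := kap_pos hN
  have hc := hu.continuous
  have hgn : ∀ x, 0 ≤ gradSq u x := fun x => by rw [gradSq]; positivity
  obtain ⟨A, hA⟩ : ∃ A, A = ∫ x, gradSq u x := ⟨_, rfl⟩
  obtain ⟨M, hM⟩ : ∃ M, M = ∫ x, ‖u x‖^2 := ⟨_, rfl⟩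
  have hA0 : 0 ≤ A := by rw [hA]; exact integral_nonneg hgn
  have hM0 : 0 ≤ M := by rw [hM]; exact integral_nonneg fun x => by positivity
  have hAl : ∫⁻ x, ENNReal.ofReal (gradSq u x) = ENNReal.ofReal A := by
    rw [hA, ofReal_integral_eq_lintegral_ofReal hg (Eventually.of_forall hgn)]
  have hMl : ∫⁻ x, ‖u x‖ₑ^2 = ENNReal.ofReal M := by
    rw [hM, ofReal_integral_eq_lintegral_ofReal h2 (Eventually.of_forall fun x => by positivity)]
    simp only [← ofReal_norm, ← ENNReal.ofReal_pow (norm_nonneg _)]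
  rw [← hA]
  let δ : ℝ := ε / (2 * (A + 1))
  have hδ : 0 < δ := by positivity
  have hδA : δ * A ≤ ε / 2 := by
    simp only [δ]; rw [div_mul_eq_mul_div, div_le_div_iff₀ (by positivity) (by positivity)]; nlinarith
  obtain ⟨V, hV⟩ : ∃ V, V = volume.real (ball (0 : EE N) 1) := ⟨_, rfl⟩
  have hV0 : 0 ≤ V := by rw [hV]; positivity
  have hVl : volume (ball (0 : EE N) 1) = ENNReal.ofReal V := by
    rw [hV, ofReal_measureReal]
  let c0 : ℝ := (1 + δ⁻¹) * V * M / kap N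
  have hc0 : 0 ≤ c0 := by positivity
  have hcut : ∀ k : ℝ, 1 ≤ k → 2 * c0 / ε ≤ k → ∀ t, 0 < t → DD t (fun x => chi k x * ‖u x‖) ≤
      ENNReal.ofReal (t^2 * kap N) * ENNReal.ofReal (A + ε) := by
    intro k hk1 hk t ht
    have hk0 : 0 < k := by linarith
    have h3 := DD_le (kap_linC hN) hc (FT_diff hu) (Eventually.of_forall fun x => hu x) t
    rw [hAl] at h3
    refine (cut_DD hk0 hc hδ ht).trans ((add_le_add_left (mul_le_mul_right h3 _) _).trans ?_)
    rw [hMl, hVl]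
    simp only [← ENNReal.ofReal_mul, hV0, show 0 ≤ 1 + δ by positivity, show 0 ≤ t^2 * kap N by positivity,
      show 0 ≤ (1 + δ⁻¹) * (t / k)^2 by positivity]
    rw [← ENNReal.ofReal_add (by positivity) (by positivity)]
    apply ENNReal.ofReal_le_ofReal
    have e : (1 + δ⁻¹) * (t / k)^2 * (V * M) = t^2 * kap N * (c0 / k^2) := by
      simp only [c0]; field_simp
    rw [e, show (1 + δ) * (t^2 * kap N * A) = t^2 * kap N * (A + δ * A) by ring, ← mul_add]
    apply mul_le_mul_of_nonneg_left _ (by positivity)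
    have : c0 / k^2 ≤ ε / 2 := by
      rw [div_le_iff₀ hε] at hk
      rw [div_le_div_iff₀ (by positivity) (by positivity)]
      nlinarith [mul_le_mul_of_nonneg_left hk1 (mul_nonneg hε.le hk0.le)]
    linarith
  have hfin : ∀ᶠ j : ℕ in atTop, b < PP q (fun x => chi ((j:ℝ) + 1) x * ‖u x‖) := by
    refine eventually_lt_of_lt_liminf (hb.trans_le ?_)
    have : PP q u = ∫⁻ x, liminf (fun j : ℕ => ‖chi ((j:ℝ) + 1) x * ‖u x‖‖ₑ^q) atTop := by
      refine lintegral_congr fun x => (Tendsto.liminf_eq ?_).symm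
      refine tendsto_const_nhds.congr' ?_
      obtain ⟨n, hn⟩ := exists_nat_ge ‖x‖
      filter_upwards [eventually_ge_atTop n] with j hj
      have : (n:ℝ) ≤ j := by exact_mod_cast hj
      rw [chi_one (by positivity) (by linarith), one_mul, enorm_norm]
    rw [this]
    refine lintegral_liminf_le fun j => ?_
    have := chi_cont (N := N) (k := (j:ℝ) + 1)
    exact (Continuous.measurable (by fun_prop : Continuous fun x => chi ((j:ℝ) + 1) x * ‖u x‖)).enorm.pow_const q
  obtain ⟨n, hn⟩ := exists_nat_ge (2 * c0 / ε)
  obtain ⟨j, hj, hjn⟩ := (hfin.and (eventually_ge_atTop n)).exists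
  have hjn : (n:ℝ) ≤ j := by exact_mod_cast hjn
  have hj0 : (0:ℝ) ≤ j := by positivity
  have hcc := chi_cont (N := N) (k := (j:ℝ) + 1)
  obtain ⟨w, L, R', w0, wL, wR, wD, wP, wb⟩ := moll (U := fun x => chi ((j:ℝ) + 1) x * ‖u x‖) (by fun_prop)
    (fun x => mul_nonneg (chi_nonneg x) (norm_nonneg _)) (R := 2 * ((j:ℝ) + 1))
    (fun x hx => by rw [chi_zero (by positivity) hx, zero_mul]) hj
  obtain ⟨f, hf, hfA, hfP⟩ := L0 hN w0 wL wR (a := A + ε) (by positivity)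
    (fun t ht => (wD t).trans (hcut _ (by linarith) (by linarith) t ht))
  have hfP' : ∀ s : ℝ, 1 ≤ s → ENNReal.ofReal (cN N * Pf N s f) = PP s w := by
    intro s hs
    rw [hfP s hs, PP_of (by linarith), ofReal_integral_eq_lintegral_ofReal]
    · simp only [fun x => Real.norm_of_nonneg (w0 x)]
    · exact Continuous.integrable_of_hasCompactSupport (wL.continuous.rpow_const fun x => Or.inr (by linarith))
        (cs_of (R := R') fun x hx => by rw [wR x hx, Real.zero_rpow (by linarith)])
    · exact Eventually.of_forall fun x => Real.rpow_nonneg (w0 x) _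
  refine ⟨f, hf, hfA, fun s hs => ?_, ?_⟩
  · rw [hfP' s hs]
    refine (wP s hs).trans (lintegral_mono fun x => ?_)
    apply ENNReal.rpow_le_rpow _ (by linarith)
    rw [← ofReal_norm, ← ofReal_norm]
    apply ENNReal.ofReal_le_ofReal
    rw [norm_mul, norm_norm, Real.norm_of_nonneg (chi_nonneg x)]
    exact mul_le_of_le_one_left (norm_nonneg _) (chi_le x)
  · rwa [hfP' q hq]
end CM

namespace CM
open Set Topology Asymptotics Metric ENNReal

lemma mass_c {N : ℕ} (hN : 1 ≤ N) {Q : EE N → ℝ} (hQ : IsGroundState N Q) :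
    SS N * ((∫ x, (Q x)^2) / cN N)^(2/(N:ℝ)) ≤ qq N / 2 := by
  have hn : (1:ℝ) ≤ N := by exact_mod_cast hN
  obtain ⟨P, P1, p0, hP, h⟩ := exists_opt hn (L1 hN)
  obtain ⟨v, v1, v0, hv, hQv⟩ := Q_sol hN hQ
  have hc := cN_pos hN
  have e : (∫ x, (Q x)^2) / cN N = Pf N 2 P := by
    simp only [hQv]
    rw [polar hN (fun r => (v r)^2), mul_div_cancel_left₀ _ hc.ne', Pf]
    refine setIntegral_congr_fun measurableSet_Ioi fun r hr => ?_
    rw [sol_unique hN hv hP hr, Real.rpow_two, sq_abs]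
  rw [e]; exact h

section
variable {N : ℕ} {u : EE N → ℂ}

lemma PP_two (h2 : Integrable fun x => ‖u x‖^2) : PP 2 u = ENNReal.ofReal (∫ x, ‖u x‖^2) := by
  rw [PP_of (by norm_num), ofReal_integral_eq_lintegral_ofReal h2 (Eventually.of_forall fun x => by positivity)]
  simp only [Real.rpow_two]

lemma PP_int {s : ℝ} (hs : 0 ≤ s) (h : Integrable fun x => ‖u x‖^s) : PP s u = ENNReal.ofReal (∫ x, ‖u x‖^s) := by
  rw [PP_of hs, ofReal_integral_eq_lintegral_ofReal h (Eventually.of_forall fun x => by positivity)]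

lemma sharp1 (hN : 1 ≤ N) (hu : Differentiable ℝ u) (h2 : Integrable fun x => ‖u x‖^2)
    (hg : Integrable fun x => gradSq u x) (hM : 0 < ∫ x, ‖u x‖^2)
    (hK : SS N * ((∫ x, ‖u x‖^2) / cN N)^(2/(N:ℝ)) ≤ qq N / 2) {ε : ℝ} (hε : 0 < ε) :
    PP (qq N) u ≤ ENNReal.ofReal (qq N / 2 * ((∫ x, gradSq u x) + ε)) := by
  have hn : (1:ℝ) ≤ N := by exact_mod_cast hN
  have hq := qq_gt hn
  have hc := cN_pos hN
  have hA0 : 0 ≤ ∫ x, gradSq u x := integral_nonneg fun x => by rw [gradSq]; positivity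
  by_contra hcon
  push Not at hcon
  obtain ⟨f, hf, hfA, hfP, hfb⟩ := L2 hN hu h2 hg hε (by linarith) hcon
  have hm : 0 < (∫ x, ‖u x‖^2) / cN N := by positivity
  have h3 := hfP 2 (by norm_num)
  rw [PP_two h2, ENNReal.ofReal_le_ofReal_iff hM.le] at h3
  have h4 := GNdec hn hf (a := ((∫ x, gradSq u x) + ε) / cN N) (by positivity) hm
    (by rw [le_div_iff₀ hc]; linarith) (by rw [le_div_iff₀ hc]; linarith)
  refine absurd hfb (not_lt.2 (ENNReal.ofReal_le_ofReal ?_))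
  have h5 := mul_le_mul_of_nonneg_left h4 hc.le
  refine h5.trans ?_
  have e : ∀ X Y Z : ℝ, cN N * (X * (Y / cN N) * Z) = X * Z * Y := fun X Y Z => by field_simp
  rw [e]
  exact mul_le_mul_of_nonneg_right hK (by positivity)

lemma sharp (hN : 1 ≤ N) (hu : Differentiable ℝ u) (h2 : Integrable fun x => ‖u x‖^2)
    (hg : Integrable fun x => gradSq u x) (hM : 0 < ∫ x, ‖u x‖^2)
    (hK : SS N * ((∫ x, ‖u x‖^2) / cN N)^(2/(N:ℝ)) ≤ qq N / 2) :
    Integrable (fun x => ‖u x‖^(qq N)) ∧ ∫ x, ‖u x‖^(qq N) ≤ qq N / 2 * ∫ x, gradSq u x := by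
  have hn : (1:ℝ) ≤ N := by exact_mod_cast hN
  have hq := qq_gt hn
  have hA0 : 0 ≤ ∫ x, gradSq u x := integral_nonneg fun x => by rw [gradSq]; positivity
  have hi : Integrable (fun x => ‖u x‖^(qq N)) := by
    refine ⟨(hu.continuous.norm.rpow_const fun x => Or.inr (by linarith)).aestronglyMeasurable, ?_⟩
    rw [hasFiniteIntegral_iff_ofReal (Eventually.of_forall fun x => by positivity), ← PP_of (by linarith)]
    exact (sharp1 hN hu h2 hg hM hK one_pos).trans_lt ENNReal.ofReal_lt_top
  refine ⟨hi, le_of_forall_pos_le_add fun ε hε => ?_⟩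
  have h := sharp1 hN hu h2 hg hM hK (ε := ε / (qq N / 2)) (by positivity)
  rw [PP_int (by linarith) hi, ENNReal.ofReal_le_ofReal_iff (by positivity)] at h
  refine h.trans (le_of_eq ?_)
  field_simp

lemma dich (hN : 1 ≤ N) {s M : ℝ} (hs : 2 < s) (hM : 0 < M) : ∃ T > 0, ∀ u : EE N → ℂ, Differentiable ℝ u →
    Integrable (fun x => ‖u x‖^2) → Integrable (fun x => gradSq u x) → ∫ x, ‖u x‖^2 = M → 1 ≤ ∫ x, gradSq u x →
    Integrable (fun x => ‖u x‖^(qq N)) → Integrable (fun x => ‖u x‖^s) →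
    ∫ x, ‖u x‖^(qq N) ≤ qq N / 4 * ∫ x, gradSq u x ∨ (∫ x, gradSq u x)^((N:ℝ)*(s-2)/4) ≤ T * ∫ x, ‖u x‖^s := by
  have hn : (1:ℝ) ≤ N := by exact_mod_cast hN
  have hq := qq_gt hn
  have hc := cN_pos hN
  obtain ⟨m, hm⟩ : ∃ m, m = M / cN N := ⟨_, rfl⟩
  have hm0 : 0 < m := by rw [hm]; positivity
  have hMm : M = m * cN N := by rw [hm]; field_simp
  obtain ⟨δ, hδ, hB⟩ := B_small hn (s := s) (by linarith) (η := m * m^(-(qq N / 2)) * (qq N / 8)) (by positivity)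
  refine ⟨(M/2)^((N:ℝ)*(s-2)/4) * m^(-(s/2)) / cN N / δ, by positivity, fun u hu h2 hg hMu hA1 hqi hsi => ?_⟩
  obtain ⟨A, hA⟩ : ∃ A, A = ∫ x, gradSq u x := ⟨_, rfl⟩
  rw [← hA] at hA1 ⊢
  have hA0 : 0 < A := by linarith
  by_contra hcon
  push Not at hcon
  obtain ⟨hc1, hc2⟩ := hcon
  have hb : ENNReal.ofReal (qq N / 4 * A) < PP (qq N) u := by
    rw [PP_int (by linarith) hqi]
    exact (ENNReal.ofReal_lt_ofReal_iff_of_nonneg (by positivity)).2 hc1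
  obtain ⟨f, hf, hfA, hfP, hfb⟩ := L2 hN hu h2 hg hA0 (by linarith) hb
  rw [← hA] at hfA
  have h3 := hfP 2 (by norm_num)
  rw [PP_two h2, hMu, ENNReal.ofReal_le_ofReal_iff hM.le] at h3
  have h4 := hfP s (by linarith)
  have hD0 : 0 ≤ ∫ x, ‖u x‖^s := integral_nonneg fun x => by positivity
  rw [PP_int (by linarith) hsi, ENNReal.ofReal_le_ofReal_iff hD0] at h4
  have h5 := (ENNReal.ofReal_lt_ofReal_iff_of_nonneg (by positivity)).1 hfb
  obtain ⟨g, hgU, hgs⟩ := scale_unit hf (a := 2 * A / cN N) (m := m) (by positivity) hm0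
    (by rw [le_div_iff₀ hc]; linarith) (by rw [hm, le_div_iff₀ hc]; linarith)
  have e1 : (N:ℝ) * (qq N - 2) / 4 = 1 := by rw [qq]; field_simp; ring
  have e2 : m / (2 * A / cN N) = M / 2 / A := by rw [hMm]; field_simp
  have h6 : m * m^(-(qq N / 2)) * (qq N / 8) < Pf N (qq N) g := by
    rw [hgs, e1, Real.rpow_one]
    have h7 : qq N / 4 * A / cN N < Pf N (qq N) f := by rw [div_lt_iff₀ hc]; linarith
    refine lt_of_eq_of_lt ?_ (mul_lt_mul_of_pos_left h7 (by positivity))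
    field_simp
    ring
  have h8 : δ < Pf N s g := by
    by_contra h
    exact absurd (hB g hgU (not_lt.1 h)) (not_le.2 h6)
  rw [hgs, e2, Real.div_rpow (by positivity) hA0.le] at h8
  have hAp : 0 < A^((N:ℝ)*(s-2)/4) := by positivity
  have h9 : Pf N s f ≤ (∫ x, ‖u x‖^s) / cN N := by rw [le_div_iff₀ hc]; linarith
  have h10 := h8.trans_le (mul_le_mul_of_nonneg_left h9 (by positivity))
  refine absurd hc2 (not_lt.2 ?_)
  have h11 : δ * A^((N:ℝ)*(s-2)/4) ≤ (M/2)^((N:ℝ)*(s-2)/4) * m^(-(s/2)) / cN N * ∫ x, ‖u x‖^s := by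
    have := mul_le_mul_of_nonneg_right h10.le hAp.le
    refine this.trans (le_of_eq ?_)
    field_simp
  rw [div_mul_eq_mul_div, le_div_iff₀ hδ]
  linarith

lemma int_mid (hu : Continuous u) {q s : ℝ} (hs : 2 ≤ s) (hsq : s ≤ q) (h2 : Integrable fun x => ‖u x‖^2)
    (hq : Integrable fun x => ‖u x‖^q) : Integrable fun x => ‖u x‖^s := by
  refine (h2.add hq).mono' (hu.norm.rpow_const fun x => Or.inr (by linarith)).aestronglyMeasurable
    (Eventually.of_forall fun x => ?_)
  simp only [Pi.add_apply]
  rw [Real.norm_of_nonneg (by positivity)]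
  rcases le_total ‖u x‖ 1 with h | h
  · rcases eq_or_lt_of_le (norm_nonneg (u x)) with h0 | h0
    · rw [← h0, Real.zero_rpow (by linarith), Real.zero_rpow (by linarith)]; norm_num
    · have := Real.rpow_le_rpow_of_exponent_ge h0 h hs
      rw [Real.rpow_two] at this
      have : 0 ≤ ‖u x‖^q := by positivity
      linarith
  · have := Real.rpow_le_rpow_of_exponent_le h hsq
    have : 0 ≤ ‖u x‖^2 := by positivity
    linarith

lemma zero_case (hu : Differentiable ℝ u) (h2 : Integrable fun x => ‖u x‖^2) (hM : ∫ x, ‖u x‖^2 = 0) :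
    ∫ x, gradSq u x = 0 := by
  rw [integral_eq_zero_iff_of_nonneg (fun x => by positivity) h2] at hM
  have hc := hu.continuous
  have h := (Continuous.ae_eq_iff_eq volume (by fun_prop) continuous_const).1 (hM : _ =ᵐ[volume] fun _ => (0:ℝ))
  have h0 : u = fun _ => 0 := by
    funext x
    have : ‖u x‖^2 = 0 := congrFun h x
    simpa using this
  subst h0
  simp [gradSq]
end
end CM

/-- uniform a priori `H¹` bound at critical mass for the defocusing
perturbation energy `E⁻(u) = ½‖∇u‖₂² − (1/(2+4/N))‖u‖_{2+4/N}^{2+4/N} + (1/(p+1))‖u‖_{p+1}^{p+1}`: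
every `u ∈ H¹` with `‖u‖₂ = ‖Q‖₂` and `E⁻(u) ≤ E₀` satisfies `‖u‖_{H¹} ≤ C`. -/
theorem critical_mass_H1_bound (N : ℕ) (hN : 1 ≤ N) (p : ℝ) (hp1 : 1 < p)
    (hp2 : p < 1 + 4 / N) (E₀ : ℝ)
    (Q : EuclideanSpace ℝ (Fin N) → ℝ) (hQ : IsGroundState N Q) :
    ∃ C : ℝ, 0 < C ∧ ∀ u : EuclideanSpace ℝ (Fin N) → ℂ,
      Differentiable ℝ u →
      Integrable (fun x => ‖u x‖ ^ 2) →
      Integrable (fun x => gradSq u x) →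
      (∫ x, ‖u x‖ ^ 2) = (∫ x, (Q x) ^ 2) →
      (1 / 2) * (∫ x, gradSq u x)
          - (1 / (2 + 4 / (N : ℝ))) * (∫ x, ‖u x‖ ^ (2 + 4 / (N : ℝ)))
          + (1 / (p + 1)) * (∫ x, ‖u x‖ ^ (p + 1)) ≤ E₀ →
      Real.sqrt ((∫ x, ‖u x‖ ^ 2) + ∫ x, gradSq u x) ≤ C := by
  have hn : (1:ℝ) ≤ N := by exact_mod_cast hN
  have hq := CM.qq_gt hn
  have hqe : (2 + 4 / (N:ℝ)) = CM.qq N := rfl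
  simp only [hqe]
  have hK := CM.mass_c hN hQ
  obtain ⟨M, hM⟩ : ∃ M, M = ∫ x, (Q x)^2 := ⟨_, rfl⟩
  rw [← hM] at hK ⊢
  have hM0 : 0 ≤ M := by rw [hM]; exact integral_nonneg fun x => by positivity
  rcases eq_or_lt_of_le hM0 with h0 | hMp
  · refine ⟨1, one_pos, fun u hu h2 hg hm _ => ?_⟩
    rw [hm, CM.zero_case hu h2 (hm.trans h0.symm), ← h0]
    simp
  obtain ⟨T, hT, hdich⟩ := CM.dich hN (s := p + 1) (by linarith) hMp
  have hθ : 0 < (N:ℝ) * (p + 1 - 2) / 4 := by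
    have : 0 < p + 1 - 2 := by linarith
    positivity
  let W : ℝ := T * ((p + 1) * |E₀|)
  have hW : 0 ≤ W := by have : 0 < p := by linarith
                        positivity
  let B : ℝ := 1 + 4 * |E₀| + W^(((N:ℝ) * (p + 1 - 2) / 4)⁻¹)
  have hB : 0 < B := by positivity
  refine ⟨Real.sqrt (M + B), Real.sqrt_pos.2 (by linarith), fun u hu h2 hg hm hE => ?_⟩
  apply Real.sqrt_le_sqrt
  rw [hm]
  have hWp : 0 ≤ W^(((N:ℝ) * (p + 1 - 2) / 4)⁻¹) := by positivity
  have hEa := le_abs_self E₀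
  have hE0 := abs_nonneg E₀
  suffices h : ∫ x, gradSq u x ≤ B by linarith
  by_cases hA1 : 1 ≤ ∫ x, gradSq u x
  swap
  · simp only [B]; linarith [not_le.1 hA1]
  rw [← hm] at hK
  obtain ⟨hqi, hqb⟩ := CM.sharp hN hu h2 hg (by rw [hm]; exact hMp) hK
  have hsi := CM.int_mid hu.continuous (s := p + 1) (by linarith) (by rw [← hqe]; linarith) h2 hqi
  have hD0 : 0 ≤ ∫ x, ‖u x‖^(p+1) := integral_nonneg fun x => by positivity
  have hp0 : 0 < p + 1 := by linarith
  have hq0 : 0 < CM.qq N := by linarith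
  rcases hdich u hu h2 hg hm hA1 hqi hsi with h | h
  · have h3 : 1 / CM.qq N * ∫ x, ‖u x‖^(CM.qq N) ≤ 1 / 4 * ∫ x, gradSq u x := by
      refine (mul_le_mul_of_nonneg_left h (by positivity)).trans (le_of_eq ?_)
      field_simp
    have h4 : 0 ≤ 1 / (p+1) * ∫ x, ‖u x‖^(p+1) := by positivity
    simp only [B]; linarith
  · have h3 : 1 / CM.qq N * ∫ x, ‖u x‖^(CM.qq N) ≤ 1 / 2 * ∫ x, gradSq u x := by
      refine (mul_le_mul_of_nonneg_left hqb (by positivity)).trans (le_of_eq ?_)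
      field_simp
    have h4 : 1 / (p+1) * ∫ x, ‖u x‖^(p+1) ≤ |E₀| := by linarith
    have h5 : ∫ x, ‖u x‖^(p+1) ≤ (p+1) * |E₀| := by
      rw [one_div, inv_mul_le_iff₀ hp0] at h4; exact h4
    have h6 := h.trans (mul_le_mul_of_nonneg_left h5 hT.le)
    have h7 := (Real.le_rpow_inv_iff_of_pos (by linarith) hW hθ).2 h6
    simp only [B]; linarith
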